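/- Let K be a quadratic field and let c ∈ K. Then f_c cannot simultaneously admit a fixed point in K, a point of exact period 2 in K, and a point of exact period 3 in K. -/

import Mathlib

/-- The quadratic map `z ↦ z ^ 2 + c`. -/
def fc {K : Type*} [Field K] (c : K) : K → K := fun z => z ^ 2 + c

/-- `α` has exact period `m` under `fc c`. -/
def HasExactPeriod {K : Type*} [Field K] (c : K) (m : ℕ) (α : K) : Prop :=
  (fc c)^[m] α = α ∧ ∀ j : ℕ, 1 ≤ j → j < m → (fc c)^[j] α ≠ α

/-- `α` has preperiodic type `m_n` under `fc c`: preperiod exactly `n`, eventual period `m`. -/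
def HasPreperiodicType {K : Type*} [Field K] (c : K) (m n : ℕ) (α : K) : Prop :=
  HasExactPeriod c m ((fc c)^[n] α) ∧ (fc c)^[n + m - 1] α ≠ (fc c)^[n - 1] α

open Polynomial NumberField

/-- Multiplication of coordinate vectors with respect to the family
`1, θ, θ², I, I θ, I θ²`, where `I² = -D` and `θ³ = 1 + (2 + 2 I) θ + (-1 + 2 I) θ²`. -/
def cmul {S : Type*} [CommRing S] (D : S) (x y : Fin 6 → S) : Fin 6 → S :=
  let p4 := x 2 * y 2 - D * (x 5 * y 5)
  let q4 := x 2 * y 5 + x 5 * y 2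
  let p3 := x 1 * y 2 + x 2 * y 1 - D * (x 4 * y 5 + x 5 * y 4) - p4 - 2 * D * q4
  let q3 := x 1 * y 5 + x 2 * y 4 + x 4 * y 2 + x 5 * y 1 + 2 * p4 - q4
  ![x 0 * y 0 - D * (x 3 * y 3) + p3,
    x 0 * y 1 + x 1 * y 0 - D * (x 3 * y 4 + x 4 * y 3) + p4 + 2 * p3 - 2 * D * q3,
    x 0 * y 2 + x 1 * y 1 + x 2 * y 0 - D * (x 3 * y 5 + x 4 * y 4 + x 5 * y 3)
      + 2 * p4 - 2 * D * q4 - p3 - 2 * D * q3,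
    x 0 * y 3 + x 3 * y 0 + q3,
    x 0 * y 4 + x 1 * y 3 + x 3 * y 1 + x 4 * y 0 + q4 + 2 * p3 + 2 * q3,
    x 0 * y 5 + x 1 * y 4 + x 2 * y 3 + x 3 * y 2 + x 4 * y 1 + x 5 * y 0
      + 2 * p4 + 2 * q4 + 2 * p3 - q3]

/-- The element with given coordinates with respect to `1, θ, θ², I, I θ, I θ²`. -/
def cval {S : Type*} [CommRing S] (θ I : S) (x : Fin 6 → S) : S :=
  x 0 + x 1 * θ + x 2 * θ ^ 2 + x 3 * I + x 4 * (I * θ) + x 5 * (I * θ ^ 2)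

theorem map_cmul {S T : Type*} [CommRing S] [CommRing T] (φ : S →+* T) (D : S) (x y : Fin 6 → S)
    (i : Fin 6) : φ (cmul D x y i) = cmul (φ D) (fun j => φ (x j)) (fun j => φ (y j)) i := by
  have h2 : φ 2 = 2 := map_ofNat φ 2
  fin_cases i <;> simp [cmul, h2]

theorem cval_cmul {S : Type*} [CommRing S] {D θ I : S} (hI : I ^ 2 = -D)
    (hθ : θ ^ 3 = 1 + 2 * θ - θ ^ 2 + 2 * I * (θ ^ 2 + θ)) (x y : Fin 6 → S) :
    cval θ I (cmul D x y) = cval θ I x * cval θ I y := by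
  have h4 : θ ^ 4 = θ + 2 * θ ^ 2 - θ ^ 3 + 2 * I * (θ ^ 3 + θ ^ 2) := by
    linear_combination θ * hθ
  obtain rfl : D = - I ^ 2 := by rw [hI, neg_neg]
  rw [hθ] at h4
  simp only [cval, cmul]
  simp
  ring_nf
  rw [h4, hθ]
  ring

/-- A number field of degree six generated by `I = √-D` and a root `θ` of the cubic
`X³ + X² - 2 X - 1 - 2 I (X² + X)`. -/
structure SexticField (D : ℤ) (L : Type*) [Field L] [NumberField L] where
  θ : 𝓞 L
  I : 𝓞 L
  sq_I : I ^ 2 = -(D : 𝓞 L)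
  cube_θ : θ ^ 3 = 1 + 2 * θ - θ ^ 2 + 2 * I * (θ ^ 2 + θ)
  finrank_eq : Module.finrank ℚ L = 6
  indep : ∀ x : Fin 6 → ℚ, cval (θ : L) (I : L) (fun i => (x i : L)) = 0 → x = 0

namespace SexticField
variable {D : ℤ} {L : Type*} [Field L] [NumberField L] (E : SexticField D L)

theorem sq_I' : (E.I : L) ^ 2 = -((D : ℚ) : L) := by
  have := congrArg (algebraMap (𝓞 L) L) E.sq_I
  simpa using this

theorem cube_θ' : (E.θ : L) ^ 3 = 1 + 2 * (E.θ : L) - (E.θ : L) ^ 2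
    + 2 * (E.I : L) * ((E.θ : L) ^ 2 + (E.θ : L)) := by
  have := congrArg (algebraMap (𝓞 L) L) E.cube_θ
  have h2 : algebraMap (𝓞 L) L 2 = 2 := map_ofNat _ 2
  simpa [h2] using this

/-- The algebraic integer with given integral coordinates. -/
noncomputable def int (x : Fin 6 → ℤ) : 𝓞 L := cval E.θ E.I (fun i => (x i : 𝓞 L))

/-- The element with given rational coordinates. -/
noncomputable def rat (x : Fin 6 → ℚ) : L := cval (E.θ : L) (E.I : L) (fun i => (x i : L))

theorem int_mul (x y : Fin 6 → ℤ) : E.int (cmul D x y) = E.int x * E.int y := by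
  rw [int, int, int, ← cval_cmul E.sq_I E.cube_θ]
  congr 1
  ext i
  exact congrArg _ (map_cmul (Int.castRingHom (𝓞 L)) D x y i)

theorem rat_mul (x y : Fin 6 → ℚ) : E.rat (cmul (D : ℚ) x y) = E.rat x * E.rat y := by
  rw [rat, rat, rat, ← cval_cmul E.sq_I' E.cube_θ']
  congr 1
  ext i
  exact map_cmul (algebraMap ℚ L) D x y i

theorem coe_int (x : Fin 6 → ℤ) : (E.int x : L) = E.rat (fun i => (x i : ℚ)) := by
  simp [int, rat, cval]

theorem int_add (x y : Fin 6 → ℤ) : E.int (x + y) = E.int x + E.int y := by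
  simp [int, cval]; ring

theorem int_smul (n : ℤ) (y : Fin 6 → ℤ) : E.int (n • y) = n * E.int y := by
  simp [int, cval]; ring

theorem int_sub (x y : Fin 6 → ℤ) : E.int (x - y) = E.int x - E.int y := by
  simp [int, cval]; ring

theorem int_injective : Function.Injective E.int := by
  intro x y h
  have h0 : E.rat (fun i => ((x - y) i : ℚ)) = 0 := by
    rw [← coe_int, int_sub, h, sub_self]
    rfl
  have := E.indep _ h0
  ext i
  have := congrFun this i
  simp only [Pi.sub_apply, Int.cast_sub, Pi.zero_apply] at this
  exact_mod_cast sub_eq_zero.mp this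

/-- The family `1, θ, θ², I, I θ, I θ²`. -/
noncomputable def family : Fin 6 → L :=
  ![1, (E.θ : L), (E.θ : L) ^ 2, (E.I : L), (E.I : L) * E.θ, (E.I : L) * (E.θ : L) ^ 2]

theorem sum_family (x : Fin 6 → ℚ) : ∑ i, x i • E.family i = E.rat x := by
  simp [Fin.sum_univ_six, family, rat, cval, Algebra.smul_def]

/-- The basis `1, θ, θ², I, I θ, I θ²`. -/
noncomputable def basis : Module.Basis (Fin 6) ℚ L :=
  basisOfLinearIndependentOfCardEqFinrank (b := E.family)
    (Fintype.linearIndependent_iff.mpr fun x hx => by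
      rw [sum_family] at hx
      exact congrFun (E.indep x hx)) (by simp [E.finrank_eq])

theorem coe_basis : ⇑E.basis = E.family := by simp [basis]

theorem basis_repr_rat (x : Fin 6 → ℚ) : ⇑(E.basis.repr (E.rat x)) = x := by
  rw [← sum_family, ← coe_basis, E.basis.repr_sum_self]

theorem basis_eq_rat (i : Fin 6) : E.basis i = E.rat (Pi.single i 1) := by
  rw [← sum_family, coe_basis]; simp [Pi.single_apply]

theorem exists_rat (z : L) : ∃ x, E.rat x = z :=
  ⟨E.basis.repr z, by rw [← sum_family, ← coe_basis, E.basis.sum_repr]⟩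

/-- The matrix of multiplication by a vector of coordinates. -/
def mulMatrix (D : ℤ) (x : Fin 6 → ℤ) : Matrix (Fin 6) (Fin 6) ℤ :=
  Matrix.of fun i j => cmul D x (Pi.single j 1) i

theorem leftMulMatrix_int (x : Fin 6 → ℤ) :
    Algebra.leftMulMatrix E.basis (E.int x : L) = (mulMatrix D x).map (Int.castRingHom ℚ) := by
  ext i j
  rw [Algebra.leftMulMatrix_eq_repr_mul, basis_eq_rat, coe_int, ← rat_mul, basis_repr_rat]
  simp only [mulMatrix, Matrix.map_apply, Matrix.of_apply]
  rw [map_cmul]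
  simp only [eq_intCast]
  congr 2
  ext k
  by_cases h : k = j <;> simp [h]

theorem norm_int (x : Fin 6 → ℤ) : Algebra.norm ℤ (E.int x) = (mulMatrix D x).det := by
  have h : ((Algebra.norm ℤ (E.int x) : ℤ) : ℚ) = ((mulMatrix D x).det : ℚ) := by
    rw [Algebra.coe_norm_int, Algebra.norm_eq_matrix_det E.basis, leftMulMatrix_int]
    exact (RingHom.map_det _ _).symm
  exact_mod_cast h

theorem trace_int (x : Fin 6 → ℤ) :
    Algebra.trace ℚ L (E.int x : L) = ((mulMatrix D x).trace : ℤ) := by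
  rw [Algebra.trace_eq_matrix_trace E.basis, leftMulMatrix_int]
  simp [Matrix.trace]

/-- The trace form on the family `1, θ, θ², I, I θ, I θ²`. -/
def traceGram (D : ℤ) : Matrix (Fin 6) (Fin 6) ℤ :=
  Matrix.of fun i j => (mulMatrix D (cmul D (Pi.single i 1) (Pi.single j 1))).trace

theorem basis_eq_int (i : Fin 6) : E.basis i = (E.int (Pi.single i 1) : L) := by
  rw [basis_eq_rat, coe_int]
  congr 1
  ext k
  by_cases h : k = i <;> simp [h]

theorem discr_basis : Algebra.discr ℚ E.basis = ((traceGram D).det : ℤ) := by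
  rw [Algebra.discr_def]
  have : Algebra.traceMatrix ℚ E.basis = (traceGram D).map (Int.castRingHom ℚ) := by
    ext i j
    rw [Algebra.traceMatrix_apply, Algebra.traceForm_apply, basis_eq_int, basis_eq_int,
      ← map_mul, ← int_mul, trace_int]
    simp [traceGram]
  rw [this]
  exact (RingHom.map_det _ _).symm

theorem abs_discr_le (E : SexticField D L) : |NumberField.discr L| ≤ |(traceGram D).det| := by
  classical
  let e : Fin 6 ≃ Module.Free.ChooseBasisIndex ℤ (𝓞 L) := Fintype.equivOfCardEq (by
    rw [← Module.finrank_eq_card_chooseBasisIndex, RingOfIntegers.rank, E.finrank_eq]; simp)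
  let B := (RingOfIntegers.basis L).reindex e.symm
  have hB : Algebra.discr ℤ B = NumberField.discr L := discr_eq_discr L B
  let v : Fin 6 → 𝓞 L := fun i => E.int (Pi.single i 1)
  have hv : (Algebra.discr ℤ v) = (traceGram D).det := by
    have h1 : ((Algebra.discr ℤ v : ℤ) : ℚ) = Algebra.discr ℚ E.basis := by
      rw [Algebra.discr_def, Algebra.discr_def]
      change (Int.castRingHom ℚ) _ = _
      rw [RingHom.map_det]
      congr 1
      ext i j
      simp only [RingHom.mapMatrix_apply, Matrix.map_apply, Algebra.traceMatrix_apply,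
        Algebra.traceForm_apply, basis_eq_int, eq_intCast]
      rw [Algebra.coe_trace_int]
      rfl
    rw [discr_basis] at h1
    exact_mod_cast h1
  have hdet := Algebra.discr_of_matrix_vecMul (A := ℤ) (B : Fin 6 → 𝓞 L) (B.toMatrix v)
  have hvec : Matrix.vecMul (B : Fin 6 → 𝓞 L) ((B.toMatrix v).map (algebraMap ℤ (𝓞 L))) = v := by
    rw [Module.Basis.toMatrix_map_vecMul]
  rw [hvec, hv, hB] at hdet
  have hne : (traceGram D).det ≠ 0 := by
    have := Algebra.discr_not_zero_of_basis ℚ E.basis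
    rw [discr_basis] at this
    exact_mod_cast this
  rw [hdet, abs_mul]
  have h0 : (B.toMatrix v).det ^ 2 ≠ 0 := by
    intro h; rw [h, zero_mul] at hdet; exact hne hdet
  have h1 : 1 ≤ |(B.toMatrix v).det ^ 2| := Int.one_le_abs h0
  nlinarith [abs_nonneg (NumberField.discr L)]

end SexticField

namespace SexticField
variable {D : ℤ} {L : Type*} [Field L] [NumberField L]

theorem nrComplexPlaces_eq (hD : 0 < D) (E : SexticField D L) :
    InfinitePlace.nrComplexPlaces L = 3 := by
  have h0 : InfinitePlace.nrRealPlaces L = 0 := by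
    classical
    rw [InfinitePlace.nrRealPlaces, Fintype.card_eq_zero_iff]
    refine ⟨fun ⟨w, hw⟩ => ?_⟩
    let φ := InfinitePlace.embedding_of_isReal hw
    have h := congrArg φ E.sq_I'
    have hD' : (0 : ℝ) < D := by exact_mod_cast hD
    have h2 : φ (E.I : L) ^ 2 = -(D : ℝ) := by simpa using h
    nlinarith [sq_nonneg (φ (E.I : L))]
  have := InfinitePlace.card_add_two_mul_card_eq_rank L
  rw [h0, E.finrank_eq] at this
  omega

theorem isPrincipalIdealRing_of_bound (hD : 0 < D) (E : SexticField D L) (B : ℕ)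
    (hB : 10 * |((traceGram D).det : ℝ)| < 9849 * ((B : ℝ) + 1) ^ 2)
    (h : ∀ P : Ideal (𝓞 L), P.IsPrime → Nat.card (𝓞 L ⧸ P) ≠ 0 →
      Nat.card (𝓞 L ⧸ P) ≤ B → P.IsPrincipal) :
    IsPrincipalIdealRing (𝓞 L) := by
  refine RingOfIntegers.isPrincipalIdealRing_of_isPrincipal_of_norm_le_of_isPrime ?_
  intro P hP hle
  have hcard : Ideal.absNorm (P : Ideal (𝓞 L)) = Nat.card (𝓞 L ⧸ (P : Ideal (𝓞 L))) := by
    rw [Ideal.absNorm_apply, Submodule.cardQuot_apply]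
  refine h _ hP ?_ ?_
  · rw [← hcard, Ne, Ideal.absNorm_eq_zero_iff]
    exact nonZeroDivisors.coe_ne_zero P
  rw [← hcard]
  rw [nrComplexPlaces_eq hD E, E.finrank_eq] at hle
  have hd : |((NumberField.discr L : ℤ) : ℝ)| ≤ |((traceGram D).det : ℝ)| := by
    exact_mod_cast E.abs_discr_le
  set d := |((NumberField.discr L : ℤ) : ℝ)|
  have hd0 : 0 ≤ d := abs_nonneg _
  have hs : √d ^ 2 = d := Real.sq_sqrt hd0
  have hs0 : 0 ≤ √d := Real.sqrt_nonneg d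
  have hpi : (4 / Real.pi) ^ 3 * ((Nat.factorial 6 : ℝ) / ((6 : ℕ) : ℝ) ^ 6) ≤ 0.03186 := by
    have h3 := Real.pi_gt_d6
    have : (4 / Real.pi) ≤ 4 / 3.141592 := by
      apply div_le_div_of_nonneg_left <;> linarith
    have h4 : (4 / Real.pi) ^ 3 ≤ (4 / 3.141592) ^ 3 := by
      gcongr
    calc _ ≤ (4 / 3.141592 : ℝ) ^ 3 * ((Nat.factorial 6 : ℝ) / ((6 : ℕ) : ℝ) ^ 6) := by gcongr
      _ ≤ _ := by norm_num [Nat.factorial]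
  have hlt : (Ideal.absNorm (P : Ideal (𝓞 L)) : ℝ) < B + 1 := by
    refine lt_of_le_of_lt hle ?_
    rw [← mul_assoc]
    refine lt_of_le_of_lt (mul_le_mul_of_nonneg_right hpi hs0) ?_
    refine lt_of_pow_lt_pow_left₀ 2 (by positivity) ?_
    rw [mul_pow, hs]
    nlinarith
  have : Ideal.absNorm (P : Ideal (𝓞 L)) < B + 1 := by exact_mod_cast hlt
  omega

theorem natCast_card_eq_zero {k : Type*} [Ring k] : ((Nat.card k : ℕ) : k) = 0 := by
  rcases finite_or_infinite k with h | h
  · have := Fintype.ofFinite k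
    rw [Nat.card_eq_fintype_card, Nat.cast_card_eq_zero]
  · simp

theorem pow_card_eq {k : Type*} [Field k] (h : Nat.card k ≠ 0) (x : k) : x ^ Nat.card k = x := by
  have := Nat.finite_of_card_ne_zero h
  have := Fintype.ofFinite k
  rw [Nat.card_eq_fintype_card, FiniteField.pow_card]

theorem det_traceGram_one : (traceGram 1).det = -10816 := by
  have h : traceGram 1 = !![6, -2, 2, 0, -4, 0; -2, 2, -8, -4, 0, -8; 2, -8, -6, 0, -8, 16;
      0, -4, 0, -6, 2, -2; -4, 0, -8, 2, -2, 8; 0, -8, 16, -2, 8, 6] := by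
    decide +kernel
  rw [h]
  simp [Matrix.det_succ_row_zero, Fin.sum_univ_succ, Fin.succAbove]

theorem det_traceGram_two : (traceGram 2).det = -41472 := by
  have h : traceGram 2 = !![6, -2, -6, 0, -8, 0; -2, -6, -8, -8, 0, 16; -6, -8, 26, 0, 16, 32;
      0, -8, 0, -12, 4, 12; -8, 0, 16, 4, 12, 16; 0, 16, 32, 12, 16, -52] := by
    decide +kernel
  rw [h]
  simp [Matrix.det_succ_row_zero, Fin.sum_univ_succ, Fin.succAbove]

theorem isPrincipalIdealRing_one (E : SexticField 1 L) : IsPrincipalIdealRing (𝓞 L) := by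
  refine isPrincipalIdealRing_of_bound one_pos E 3 (by rw [det_traceGram_one]; norm_num) ?_
  intro P hP h0 hle
  exfalso
  have hfin := Nat.finite_of_card_ne_zero h0
  let _ : Field (𝓞 L ⧸ P) := (Finite.isField_of_domain _).toField
  set π := Ideal.Quotient.mk P
  have hθ : (π E.θ) ^ 3 = 1 + 2 * π E.θ - (π E.θ) ^ 2 + 2 * π E.I * ((π E.θ) ^ 2 + π E.θ) := by
    have := congrArg π E.cube_θ
    have h2 : π 2 = 2 := map_ofNat π 2
    simpa [h2] using this
  have hI : (π E.I) ^ 2 = -1 := by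
    have := congrArg π E.sq_I
    simpa using this
  have hz := natCast_card_eq_zero (k := 𝓞 L ⧸ P)
  have hp1 := pow_card_eq h0 (π E.θ)
  have hp2 := pow_card_eq h0 (π E.I)
  have h1 : (1 : 𝓞 L ⧸ P) ≠ 0 := one_ne_zero
  generalize π E.θ = t at *
  generalize π E.I = i at *
  generalize Nat.card (𝓞 L ⧸ P) = n at *
  interval_cases n
  · exact h0 rfl
  · simp at hz
  · push_cast at hz
    apply h1
    grind
  · push_cast at hz
    apply h1
    grind

theorem det_mulMatrix_one : (mulMatrix 1 ![1, 1, 1, 0, 0, 0]).det = 13 := by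
  have h : mulMatrix 1 ![1, 1, 1, 0, 0, 0] = !![1, 1, 0, 0, 0, -2; 1, 3, -3, 0, -2, -4;
      1, 0, -1, 0, -2, 0; 0, 0, 2, 1, 1, 0; 0, 2, 4, 1, 3, -3; 0, 2, 0, 1, 0, -1] := by
    decide +kernel
  rw [h]
  simp [Matrix.det_succ_row_zero, Fin.sum_univ_succ, Fin.succAbove]

theorem det_mulMatrix_two : (mulMatrix 2 ![1, 0, 0, 0, 1, 0]).det = 3 := by
  have h : mulMatrix 2 ![1, 0, 0, 0, 1, 0] = !![1, 0, 0, 0, 0, -2; 0, 1, -4, -2, 0, -4;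
      0, 0, -3, 0, -2, 2; 0, 0, 1, 1, 0, 0; 1, 0, 2, 0, 1, -4; 0, 1, -1, 0, 0, -3] := by
    decide +kernel
  rw [h]
  simp [Matrix.det_succ_row_zero, Fin.sum_univ_succ, Fin.succAbove]

theorem isPrincipalIdealRing_two (E : SexticField 2 L) : IsPrincipalIdealRing (𝓞 L) := by
  refine isPrincipalIdealRing_of_bound two_pos E 6 (by rw [det_traceGram_two]; norm_num) ?_
  intro P hP h0 hle
  have hfin := Nat.finite_of_card_ne_zero h0
  let _ : Field (𝓞 L ⧸ P) := (Finite.isField_of_domain _).toField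
  set π := Ideal.Quotient.mk P with hπ
  have h2 : π 2 = 2 := map_ofNat π 2
  have hθ : (π E.θ) ^ 3 = 1 + 2 * π E.θ - (π E.θ) ^ 2 + 2 * π E.I * ((π E.θ) ^ 2 + π E.θ) := by
    have := congrArg π E.cube_θ
    simpa [h2] using this
  have hI : (π E.I) ^ 2 = -2 := by
    have := congrArg π E.sq_I
    simpa [h2] using this
  have hz := natCast_card_eq_zero (k := 𝓞 L ⧸ P)
  have hp1 := pow_card_eq h0 (π E.θ)
  have hp2 := pow_card_eq h0 (π E.I)
  have h1 : (1 : 𝓞 L ⧸ P) ≠ 0 := one_ne_zero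
  have h6 : Nat.card (𝓞 L ⧸ P) ≠ 6 := by
    intro h6
    have := Fintype.ofFinite (𝓞 L ⧸ P)
    have h := FiniteField.isPrimePow_card (𝓞 L ⧸ P)
    rw [← Nat.card_eq_fintype_card, h6] at h
    exact absurd h (by decide +kernel)
  have h3 : Nat.card (𝓞 L ⧸ P) = 3 := by
    clear_value π
    generalize π E.θ = t at *
    generalize π E.I = i at *
    generalize Nat.card (𝓞 L ⧸ P) = n at *
    interval_cases n
    · exact (h0 rfl).elim
    · simp at hz
    · push_cast at hz
      exact (h1 (by grind)).elim
    · rfl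
    · have hz : (2 : 𝓞 L ⧸ P) = 0 := by
        push_cast at hz
        have : (2 : 𝓞 L ⧸ P) * 2 = 0 := by rw [← hz]; norm_num
        simpa using this
      exact (h1 (by grind)).elim
    · push_cast at hz
      exact (h1 (by grind)).elim
    · exact (h6 rfl).elim
  have hq : 1 + E.I * E.θ ∈ P := by
    rw [← Ideal.Quotient.eq_zero_iff_mem, ← hπ]
    simp only [map_add, map_mul, map_one]
    clear_value π
    rw [h3] at hz hp1 hp2
    push_cast at hz
    generalize π E.θ = t at *
    generalize π E.I = i at *
    have : t = 0 ∨ t = 1 ∨ t = -1 := by grind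
    grind
  refine ⟨1 + E.I * E.θ, ?_⟩
  have hqi : E.int ![1, 0, 0, 0, 1, 0] = 1 + E.I * E.θ := by simp [int, cval]
  have hn : Ideal.absNorm (Ideal.span {1 + E.I * E.θ}) = 3 := by
    rw [Ideal.absNorm_span_singleton, ← hqi, norm_int, det_mulMatrix_two]
    rfl
  have hPn : Ideal.absNorm P = 3 := by
    rw [Ideal.absNorm_apply, Submodule.cardQuot_apply, h3]
  obtain ⟨J, hJ⟩ := Ideal.dvd_iff_le.mpr ((Ideal.span_singleton_le_iff_mem P).mpr hq)
  have hJn : Ideal.absNorm J = 1 := by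
    have := congrArg Ideal.absNorm hJ
    rw [map_mul, hn, hPn] at this
    omega
  rw [Ideal.absNorm_eq_one_iff.mp hJn, Ideal.mul_top] at hJ
  exact hJ.symm

end SexticField

namespace SexticField
variable {D : ℤ} {L : Type*} [Field L] [NumberField L] (E : SexticField D L)

theorem not_isUnit_two : ¬ IsUnit (2 : 𝓞 L) := by
  intro h
  have h1 := h.map (Algebra.norm ℤ)
  have h2 : (2 : 𝓞 L) = algebraMap ℤ (𝓞 L) 2 := by simp
  rw [h2, Algebra.norm_algebraMap, isUnit_pow_iff, Int.isUnit_iff] at h1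
  · omega
  · exact Module.finrank_pos.ne'

/-- Coordinatewise congruence modulo `n`. -/
def CoordModEq (n : ℤ) (x y : Fin 6 → ℤ) : Prop := ∀ i, n ∣ x i - y i

instance (n : ℤ) (x y : Fin 6 → ℤ) : Decidable (CoordModEq n x y) :=
  inferInstanceAs (Decidable (∀ i, n ∣ x i - y i))

theorem CoordModEq.exists_eq {n : ℤ} {x y : Fin 6 → ℤ} (h : CoordModEq n x y) :
    ∃ w, x = y + n • w := by
  choose w hw using h
  exact ⟨w, funext fun i => by simp [← hw]⟩

theorem exists_bit (z : Fin 6 → ℤ) : ∃ e : Fin 6 → Fin 2,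
    CoordModEq 2 z (fun i => ((e i : ℕ) : ℤ)) := by
  have (i : Fin 6) : ∃ e : Fin 2, 2 ∣ z i - ((e : ℕ) : ℤ) := by
    rcases Int.emod_two_eq_zero_or_one (z i) with h | h
    · exact ⟨0, by simp; omega⟩
    · exact ⟨1, by simp; omega⟩
  choose e he using this
  exact ⟨e, he⟩

theorem CoordModEq.two_dvd_int_iff {x y : Fin 6 → ℤ} (h : CoordModEq 2 x y) :
    2 ∣ E.int x ↔ 2 ∣ E.int y := by
  obtain ⟨w, rfl⟩ := h.exists_eq
  rw [int_add, int_smul]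
  exact_mod_cast dvd_add_left (Dvd.intro _ rfl)

theorem even_of_two_dvd_int {p : Fin 6 → ℤ} (hp : ¬ 2 ∣ E.int p)
    (hc : ∀ e : Fin 6 → Fin 2, e = 0 ∨
      ∃ w, CoordModEq 2 (cmul D (fun i => ((e i : ℕ) : ℤ)) w) p)
    {z : Fin 6 → ℤ} (hz : 2 ∣ E.int z) : ∃ w, z = (2 : ℤ) • w := by
  obtain ⟨e, he⟩ := exists_bit z
  rcases hc e with rfl | ⟨w, hw⟩
  · obtain ⟨w, hw⟩ := he.exists_eq
    refine ⟨w, ?_⟩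
    rw [hw]
    ext i
    simp
  · exfalso
    apply hp
    rw [← hw.two_dvd_int_iff, int_mul]
    exact Dvd.dvd.mul_right ((he.two_dvd_int_iff E).mp hz) _

theorem exists_odd_mul_eq_int (h : ∀ z, 2 ∣ E.int z → ∃ w, z = (2 : ℤ) • w) (x : 𝓞 L) :
    ∃ (N : ℕ) (z : Fin 6 → ℤ), Odd N ∧ (N : 𝓞 L) * x = E.int z := by
  obtain ⟨r, hr⟩ := E.exists_rat (x : L)
  have h0 : ∃ (M : ℕ) (z : Fin 6 → ℤ), 0 < M ∧ (M : 𝓞 L) * x = E.int z := by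
    refine ⟨∏ i, (r i).den, fun i => (∏ j ∈ Finset.univ.erase i, (r j).den : ℕ) * (r i).num,
      Finset.prod_pos fun i _ => (r i).den_pos, ?_⟩
    apply RingOfIntegers.ext
    rw [coe_int, show ∀ a b : 𝓞 L, ((a * b : 𝓞 L) : L) = a * b from fun _ _ => rfl, ← hr, show (((∏ i, (r i).den : ℕ) : 𝓞 L) : L) =
      ((∏ i, (r i).den : ℕ) : L) from map_natCast (algebraMap (𝓞 L) L) _]
    have (i : Fin 6) : ((((∏ j ∈ Finset.univ.erase i, (r j).den : ℕ) * (r i).num : ℤ)) : ℚ)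
        = ((∏ i, (r i).den : ℕ) : ℚ) * r i := by
      rw [← Finset.mul_prod_erase Finset.univ _ (Finset.mem_univ i)]
      push_cast
      rw [mul_right_comm, Rat.den_mul_eq_num, mul_comm]
    simp only [this]
    simp only [rat, cval]
    push_cast
    ring
  obtain ⟨M, z, hM, hz⟩ := h0
  induction M using Nat.strong_induction_on generalizing z with
  | _ M ih =>
    rcases Nat.even_or_odd' M with ⟨k, rfl | rfl⟩
    · have h2 : (2 : 𝓞 L) ∣ E.int z := ⟨k * x, by rw [← hz]; push_cast; ring⟩
      obtain ⟨w, rfl⟩ := h z h2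
      refine ih k (by omega) w (by omega) ?_
      rw [int_smul] at hz
      have h20 : (2 : 𝓞 L) ≠ 0 := two_ne_zero
      apply mul_left_cancel₀ h20
      push_cast at hz
      rw [← hz, mul_assoc]
    · exact ⟨_, z, ⟨k, rfl⟩, hz⟩

/-- Sixth power with respect to `cmul`. -/
def csix (D : ℤ) (x : Fin 6 → ℤ) : Fin 6 → ℤ :=
  cmul D (cmul D x x) (cmul D (cmul D x x) (cmul D x x))

/-- A cofactor turning a nonzero vector modulo two into the uniformizer `p`. -/
def cofactor (D : ℤ) (p e : Fin 6 → ℤ) : Fin 6 → ℤ :=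
  if CoordModEq 2 (cmul D p ![e 3, e 4, e 5, 0, 0, 0]) e then csix D ![e 3, e 4, e 5, 0, 0, 0]
  else cmul D p (cmul D e (cmul D (csix D e) (csix D e)))

theorem forall_bits {P : (Fin 6 → Fin 2) → Prop}
    (h : ∀ a b c d e f : Fin 2, P ![a, b, c, d, e, f]) (e : Fin 6 → Fin 2) : P e := by
  have : e = ![e 0, e 1, e 2, e 3, e 4, e 5] := by
    ext i; fin_cases i <;> rfl
  rw [this]
  exact h _ _ _ _ _ _

theorem cofactor_one (e : Fin 6 → Fin 2) : e = 0 ∨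
    CoordModEq 2 (cmul 1 (fun i => ((e i : ℕ) : ℤ))
      (cofactor 1 ![1, 0, 0, 1, 0, 0] (fun i => ((e i : ℕ) : ℤ)))) ![1, 0, 0, 1, 0, 0] := by
  revert e
  apply forall_bits
  decide +kernel

theorem cofactor_two (e : Fin 6 → Fin 2) : e = 0 ∨
    CoordModEq 2 (cmul 2 (fun i => ((e i : ℕ) : ℤ))
      (cofactor 2 ![0, 0, 0, 1, 0, 0] (fun i => ((e i : ℕ) : ℤ)))) ![0, 0, 0, 1, 0, 0] := by
  revert e
  apply forall_bits
  decide +kernel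

theorem exists_odd_mul_eq_int_one (E : SexticField 1 L) (x : 𝓞 L) :
    ∃ (N : ℕ) (z : Fin 6 → ℤ), Odd N ∧ (N : 𝓞 L) * x = E.int z := by
  refine E.exists_odd_mul_eq_int (fun z hz => E.even_of_two_dvd_int (p := ![1, 0, 0, 1, 0, 0]) ?_
    (fun e => (cofactor_one e).imp_right fun h => ⟨_, h⟩) hz) x
  rintro ⟨y, hy⟩
  have h1 : 1 + E.I = 2 * y := by simpa [int, cval] using hy
  have hI := E.sq_I
  apply not_isUnit_two (L := L)
  refine IsUnit.of_mul_eq_one (-2 * y ^ 4) ?_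
  have h20 : (4 : 𝓞 L) ≠ 0 := by exact_mod_cast (four_ne_zero : (4 : ℕ) ≠ 0)
  apply mul_left_cancel₀ h20
  push_cast at hI
  have : E.I = 2 * y - 1 := by rw [← h1]; ring
  rw [this] at hI
  grind

theorem exists_odd_mul_eq_int_two (E : SexticField 2 L) (x : 𝓞 L) :
    ∃ (N : ℕ) (z : Fin 6 → ℤ), Odd N ∧ (N : 𝓞 L) * x = E.int z := by
  refine E.exists_odd_mul_eq_int (fun z hz => E.even_of_two_dvd_int (p := ![0, 0, 0, 1, 0, 0]) ?_
    (fun e => (cofactor_two e).imp_right fun h => ⟨_, h⟩) hz) x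
  rintro ⟨y, hy⟩
  have h1 : E.I = 2 * y := by simpa [int, cval] using hy
  have hI := E.sq_I
  apply not_isUnit_two (L := L)
  refine IsUnit.of_mul_eq_one (-y ^ 2) ?_
  have h20 : (2 : 𝓞 L) ≠ 0 := two_ne_zero
  apply mul_left_cancel₀ h20
  rw [h1] at hI
  push_cast at hI
  linear_combination -hI

end SexticField

namespace SexticField

/-- Representatives modulo four of squares of polynomials of degree at most one. -/
def squareTargets : List (Fin 6 → ℤ) := [![1, 0, 0, 0, 0, 0], ![0, 0, 1, 0, 0, 0],
  ![1, 2, 1, 0, 0, 0]]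

/-- Residues modulo four of `l² + 2 l l'` with `l ≠ l'` nonzero modulo two of degree at most one. -/
def twistedTargets : List (Fin 6 → ℤ) := [![1, 2, 0, 0, 0, 0], ![-1, 2, 0, 0, 0, 0],
  ![0, 2, 1, 0, 0, 0], ![0, 2, -1, 0, 0, 0], ![-1, 0, 1, 0, 0, 0], ![1, 0, -1, 0, 0, 0]]

/-- The vector `x` or the unit vector. -/
def cbit (k : Fin 2) (x : Fin 6 → ℤ) : Fin 6 → ℤ := if k = 0 then ![1, 0, 0, 0, 0, 0] else x

/-- Products of subsets of generators of units, and of a prime. -/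
def classVec (D : ℤ) (g : Fin 3 → Fin 6 → ℤ) (q : Fin 6 → ℤ) (k : Fin 3 → Fin 2) (b : Fin 2) :
    Fin 6 → ℤ :=
  cmul D (cmul D (cmul D (cbit (k 0) (g 0)) (cbit (k 1) (g 1))) (cbit (k 2) (g 2))) (cbit b q)

/-- Units generating all units modulo squares, and a prime element, together with the
verification that their classes are detected modulo four. -/
structure UnitData (D : ℤ) where
  g : Fin 3 → Fin 6 → ℤ
  ginv : Fin 3 → Fin 6 → ℤ
  q : Fin 6 → ℤ
  mul_inv : ∀ i, cmul D (g i) (ginv i) = ![1, 0, 0, 0, 0, 0]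
  check : ∀ (k : Fin 3 → Fin 2) (b : Fin 2) (e : Fin 6 → Fin 2),
    (∀ t ∈ squareTargets, CoordModEq 4 (cmul D (classVec D g q k b)
      (cmul D (fun i => ((e i : ℕ) : ℤ)) (fun i => ((e i : ℕ) : ℤ)))) t → k = 0 ∧ b = 0) ∧
    (∀ t ∈ twistedTargets, ¬ CoordModEq 4 (cmul D (classVec D g q k b)
      (cmul D (fun i => ((e i : ℕ) : ℤ)) (fun i => ((e i : ℕ) : ℤ)))) t)

theorem forall_three {P : (Fin 3 → Fin 2) → Prop}
    (h : ∀ a b c : Fin 2, P ![a, b, c]) (e : Fin 3 → Fin 2) : P e := by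
  have : e = ![e 0, e 1, e 2] := by
    ext i; fin_cases i <;> rfl
  rw [this]
  exact h _ _ _

/-- The data for `D = 1`. -/
def unitDataOne : UnitData 1 where
  g := ![![0, 0, 0, 1, 0, 0], ![1, 0, 0, 0, 1, 0], ![1, 1, 0, 0, 1, 0]]
  ginv := ![![0, 0, 0, -1, 0, 0], ![1, -1, -1, 1, 1, 0], ![3, -1, -2, 2, 3, 0]]
  q := ![1, 1, 1, 0, 0, 0]
  mul_inv := by decide +kernel
  check := by
    refine forall_three fun a b c i => forall_bits ?_
    revert a b c i
    decide +kernel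

/-- The data for `D = 2`. -/
def unitDataTwo : UnitData 2 where
  g := ![![-1, 0, 0, 0, 0, 0], ![0, 1, 0, -1, 0, 0], ![1, 1, 0, 0, 1, 0]]
  ginv := ![![-1, 0, 0, 0, 0, 0], ![0, -1, -1, 1, 1, 0], ![6, 6, -1, -1, 3, 2]]
  q := ![1, 0, 0, 0, 1, 0]
  mul_inv := by decide +kernel
  check := by
    refine forall_three fun a b c i => forall_bits ?_
    revert a b c i
    decide +kernel

end SexticField

theorem exists_eq_mul_sq_of_sq_eq_mul {O : Type*} [CommRing O] [IsDomain O]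
    [IsPrincipalIdealRing O] {q α β γ : O} (hq : Prime q) (h : γ ^ 2 = α * β) (h0 : γ ≠ 0)
    (hcop : ∀ p, Prime p → p ∣ α → p ∣ β → p ∣ q) :
    ∃ (u : Oˣ) (b : Fin 2) (η : O), α = u * q ^ (b : ℕ) * η ^ 2 := by
  have hα : α ≠ 0 := by rintro rfl; simp [h0] at h
  have hβ : β ≠ 0 := by rintro rfl; simp [h0] at h
  obtain ⟨s, α', hα', rfl⟩ := WfDvdMonoid.max_power_factor hα hq.irreducible
  obtain ⟨r, β', hβ', rfl⟩ := WfDvdMonoid.max_power_factor hβ hq.irreducible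
  obtain ⟨t, γ', hγ', rfl⟩ := WfDvdMonoid.max_power_factor h0 hq.irreducible
  have e1 : q ^ (2 * t) * γ' ^ 2 = q ^ (s + r) * (α' * β') := by
    linear_combination h
  have hl : ¬ q ∣ γ' ^ 2 := fun hd => hγ' (hq.dvd_of_dvd_pow hd)
  have hr : ¬ q ∣ α' * β' := fun hd => (hq.dvd_or_dvd hd).elim hα' hβ'
  have e2 : 2 * t = s + r := by
    rcases lt_trichotomy (2 * t) (s + r) with hlt | heq | hlt
    · obtain ⟨d, hd⟩ := Nat.exists_eq_add_of_lt hlt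
      rw [hd, add_assoc, pow_add, mul_assoc] at e1
      have := mul_left_cancel₀ (pow_ne_zero _ hq.ne_zero) e1
      exact (hl (this ▸ Dvd.dvd.mul_right (dvd_pow_self q (by omega)) _)).elim
    · exact heq
    · obtain ⟨d, hd⟩ := Nat.exists_eq_add_of_lt hlt
      rw [hd, add_assoc, pow_add, mul_assoc] at e1
      have := mul_left_cancel₀ (pow_ne_zero _ hq.ne_zero) e1
      exact (hr (this ▸ Dvd.dvd.mul_right (dvd_pow_self q (by omega)) _)).elim
  rw [e2] at e1
  have e3 : α' * β' = γ' ^ 2 := (mul_left_cancel₀ (pow_ne_zero _ hq.ne_zero) e1).symm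
  have hco : IsCoprime α' β' := by
    refine isCoprime_of_prime_dvd (fun h00 => hα (by simp [h00.1])) fun p hp h1 h2 => ?_
    have h3 := hcop p hp (Dvd.dvd.mul_left h1 _) (Dvd.dvd.mul_left h2 _)
    exact hα' (((hp.dvd_prime_iff_associated hq).mp h3).symm.dvd.trans h1)
  obtain ⟨d, u, hd⟩ := exists_associated_pow_of_mul_eq_pow'
    hco e3
  have hb : s % 2 < 2 := Nat.mod_lt _ two_pos
  refine ⟨u, ⟨s % 2, hb⟩, q ^ (s / 2) * d, ?_⟩
  rw [← hd]
  conv_lhs => rw [← Nat.mod_add_div s 2, pow_add, pow_mul]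
  ring

/-- In a group whose elements are described by finitely many generators up to squares, a family of
the right size that is independent modulo squares represents all classes. -/
theorem exists_eq_mul_sq_of_card {G : Type*} [CommGroup G] (g : Fin 3 → G)
    (hG : ∃ s : Fin 3 → G, ∀ u, ∃ (k : Fin 3 → ℤ), u = ∏ i, s i ^ k i)
    (hg : ∀ (k : Fin 3 → Fin 2) (w : G), ∏ i, g i ^ (k i : ℕ) = w ^ 2 → k = 0) (u : G) :
    ∃ (k : Fin 3 → Fin 2) (w : G), u = (∏ i, g i ^ (k i : ℕ)) * w ^ 2 := by
  obtain ⟨s, hs⟩ := hG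
  let H : Subgroup G := (powMonoidHom 2 : G →* G).range
  let φ : (Fin 3 → Fin 2) → G ⧸ H := fun k => ((∏ i, s i ^ (k i : ℕ) : G) : G ⧸ H)
  let ψ : (Fin 3 → Fin 2) → G ⧸ H := fun k => ((∏ i, g i ^ (k i : ℕ) : G) : G ⧸ H)
  have hφ : Function.Surjective φ := by
    intro x
    obtain ⟨u, rfl⟩ := QuotientGroup.mk_surjective x
    obtain ⟨k, rfl⟩ := hs u
    have hk (i : Fin 3) : ∃ b : Fin 2, ∃ l : ℤ, k i = b + 2 * l := by
      rcases Int.even_or_odd' (k i) with ⟨l, hl | hl⟩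
      · exact ⟨0, l, by simpa using hl⟩
      · exact ⟨1, l, by simp; omega⟩
    choose b l hb using hk
    refine ⟨b, QuotientGroup.eq.mpr ⟨∏ i, s i ^ l i, ?_⟩⟩
    rw [powMonoidHom_apply, ← Finset.prod_pow, ← Finset.prod_inv_distrib,
      ← Finset.prod_mul_distrib]
    refine Finset.prod_congr rfl fun i _ => ?_
    rw [hb, zpow_add, zpow_natCast, inv_mul_cancel_left, mul_comm, zpow_mul]
    norm_cast
  have hψ : Function.Injective ψ := by
    intro k k' h
    obtain ⟨w, hw⟩ := QuotientGroup.eq.mp h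
    rw [powMonoidHom_apply] at hw
    have key := hg (fun i => if k i = k' i then 0 else 1)
      ((∏ i, g i ^ (k i : ℕ)) * w * (∏ i, if k i = k' i then (g i ^ (k i : ℕ))⁻¹ else 1)) ?_
    · ext i
      have := congrFun key i
      by_contra hne
      have hne' : k i ≠ k' i := fun h => hne (by rw [h])
      simp [hne'] at this
    · have e : (∏ i, g i ^ (k i : ℕ)) * (∏ i, g i ^ (k' i : ℕ))
        = ((∏ i, g i ^ (k i : ℕ)) * w) ^ 2 := by
        rw [mul_pow, hw, sq]; group
      rw [mul_pow, ← e, ← Finset.prod_pow, ← Finset.prod_mul_distrib, ← Finset.prod_mul_distrib]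
      refine Finset.prod_congr rfl fun i _ => ?_
      by_cases h : k i = k' i
      · simp [h, sq]
      · have : ((k i : ℕ) = 0 ∧ (k' i : ℕ) = 1) ∨ ((k i : ℕ) = 1 ∧ (k' i : ℕ) = 0) := by
          have : (k i : ℕ) ≠ k' i := fun h' => h (Fin.ext h')
          omega
        rcases this with ⟨h1, h2⟩ | ⟨h1, h2⟩ <;> simp [h, h1, h2]
  have : Finite (G ⧸ H) := Finite.of_surjective φ hφ
  have hcard : Nat.card (G ⧸ H) ≤ Nat.card (Fin 3 → Fin 2) := Nat.card_le_card_of_surjective φ hφ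
  obtain ⟨k, hk⟩ := (hψ.bijective_of_nat_card_le hcard).2 (u : G ⧸ H)
  obtain ⟨w, hw⟩ := QuotientGroup.eq.mp hk
  exact ⟨k, w, by rw [powMonoidHom_apply] at hw; rw [hw, mul_inv_cancel_left]⟩

namespace SexticField
variable {D : ℤ} {L : Type*} [Field L] [NumberField L]

theorem exists_three_generators (hD : 0 < D) (E : SexticField D L) :
    ∃ s : Fin 3 → (𝓞 L)ˣ, ∀ u, ∃ (k : Fin 3 → ℤ), u = ∏ i, s i ^ k i := by
  have hr : Units.rank L = 2 := by
    rw [Units.rank, InfinitePlace.card_eq_nrRealPlaces_add_nrComplexPlaces]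
    have h1 := nrComplexPlaces_eq hD E
    have := InfinitePlace.card_add_two_mul_card_eq_rank L
    rw [h1, E.finrank_eq] at this
    omega
  obtain ⟨z, hz⟩ := IsCyclic.exists_generator (α := Units.torsion L)
  refine ⟨![z, Units.fundSystem L ⟨0, by omega⟩, Units.fundSystem L ⟨1, by omega⟩], fun u => ?_⟩
  obtain ⟨⟨ζ, e⟩, he, -⟩ := Units.exist_unique_eq_mul_prod L u
  obtain ⟨a, ha⟩ := Subgroup.mem_zpowers_iff.mp (hz ζ)
  refine ⟨![a, e ⟨0, by omega⟩, e ⟨1, by omega⟩], ?_⟩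
  rw [he, Fin.prod_univ_three]
  simp only
  have hp : ∏ i, Units.fundSystem L i ^ e i = ∏ i : Fin 2,
      Units.fundSystem L (Fin.cast hr.symm i) ^ e (Fin.cast hr.symm i) :=
    (Fintype.prod_equiv (finCongr hr.symm) _ _ fun i => rfl).symm
  rw [hp, Fin.prod_univ_two, ← ha]
  simp [mul_assoc]
  rfl

end SexticField

namespace SexticField
variable {D : ℤ} {L : Type*} [Field L] [NumberField L] (E : SexticField D L)

theorem int_one : E.int ![1, 0, 0, 0, 0, 0] = 1 := by simp [int, cval]

theorem int_cbit (k : Fin 2) (x : Fin 6 → ℤ) : E.int (cbit k x) = E.int x ^ (k : ℕ) := by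
  fin_cases k <;> simp [cbit, int_one]

theorem int_classVec (g : Fin 3 → Fin 6 → ℤ) (q : Fin 6 → ℤ) (k : Fin 3 → Fin 2) (b : Fin 2) :
    E.int (classVec D g q k b) = (∏ i, E.int (g i) ^ (k i : ℕ)) * E.int q ^ (b : ℕ) := by
  simp only [classVec, int_mul, int_cbit, Fin.prod_univ_three]

theorem coordModEq_of_int_eq {n : ℤ} {x y : Fin 6 → ℤ} (w : Fin 6 → ℤ)
    (h : E.int x = E.int y + n * E.int w) : CoordModEq n x y := by
  have : x = y + n • w := E.int_injective (by rw [h, int_add, int_smul])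
  rw [this]
  intro i
  simp

/-- Reduction of the equation `α = c η²` to a congruence between coordinates modulo four. -/
theorem exists_coordModEq (hodd : ∀ x : 𝓞 L, ∃ (N : ℕ) (z : Fin 6 → ℤ), Odd N ∧
      (N : 𝓞 L) * x = E.int z) {m c : Fin 6 → ℤ} {η : 𝓞 L} (h : E.int m = E.int c * η ^ 2) :
    ∃ e : Fin 6 → Fin 2, CoordModEq 4 (cmul D c (cmul D (fun i => ((e i : ℕ) : ℤ))
      (fun i => ((e i : ℕ) : ℤ)))) m := by
  obtain ⟨N, z, ⟨k, rfl⟩, hz⟩ := hodd η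
  obtain ⟨e, he⟩ := exists_bit z
  obtain ⟨w, rfl⟩ := he.exists_eq
  refine ⟨e, E.coordModEq_of_int_eq (((k : ℤ) ^ 2 + k) • m - cmul D c (cmul D w
    ((fun i => ((e i : ℕ) : ℤ)) + w))) ?_⟩
  simp only [int_mul, int_add, int_sub, int_smul] at hz ⊢
  push_cast at hz ⊢
  have := congrArg (fun t => E.int c * t ^ 2) hz
  simp only [mul_pow] at this
  linear_combination -this - (2 * (k : 𝓞 L) + 1) ^ 2 * h

theorem isSquare_of_coordModEq (hD : 0 < D) [IsPrincipalIdealRing (𝓞 L)] (U : UnitData D)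
    (hodd : ∀ x : 𝓞 L, ∃ (N : ℕ) (z : Fin 6 → ℤ), Odd N ∧ (N : 𝓞 L) * x = E.int z)
    (hq : Prime (E.int U.q)) {m : Fin 6 → ℤ} {β γ : 𝓞 L} (h : γ ^ 2 = E.int m * β) (h0 : γ ≠ 0)
    (hcop : ∀ p, Prime p → p ∣ E.int m → p ∣ β → p ∣ E.int U.q) :
    (∀ t ∈ squareTargets, CoordModEq 4 m t → IsSquare (E.int m)) ∧
      ∀ t ∈ twistedTargets, ¬ CoordModEq 4 m t := by
  have hmul (i : Fin 3) : E.int (U.g i) * E.int (U.ginv i) = 1 := by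
    rw [← int_mul, U.mul_inv, int_one]
  let g (i : Fin 3) : (𝓞 L)ˣ :=
    ⟨E.int (U.g i), E.int (U.ginv i), hmul i, by rw [mul_comm]; exact hmul i⟩
  have hg (k : Fin 3 → Fin 2) (w : (𝓞 L)ˣ) (hk : ∏ i, g i ^ (k i : ℕ) = w ^ 2) : k = 0 := by
    have h1 : E.int ![1, 0, 0, 0, 0, 0]
        = E.int (classVec D U.g U.q k 0) * ((w⁻¹ : (𝓞 L)ˣ) : 𝓞 L) ^ 2 := by
      have := congrArg (fun u : (𝓞 L)ˣ => (u : 𝓞 L)) hk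
      simp only [Units.coe_prod, Units.val_pow_eq_pow_val] at this
      rw [int_classVec, int_one, this]
      simp [← mul_pow]
    obtain ⟨e, he⟩ := E.exists_coordModEq hodd h1
    exact ((U.check k 0 e).1 _ (by simp [squareTargets]) he).1
  obtain ⟨u, b, η, hη⟩ := exists_eq_mul_sq_of_sq_eq_mul hq h h0 hcop
  obtain ⟨k, w, rfl⟩ := exists_eq_mul_sq_of_card g (exists_three_generators hD E) hg u
  have h1 : E.int m = E.int (classVec D U.g U.q k b) * (w * η) ^ 2 := by
    rw [hη, int_classVec]
    simp only [Units.val_mul, Units.coe_prod, Units.val_pow_eq_pow_val, g]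
    ring
  obtain ⟨e, he⟩ := E.exists_coordModEq hodd h1
  refine ⟨fun t ht hm => ?_, fun t ht hm => (U.check k b e).2 t ht fun i => ?_⟩
  · obtain ⟨rfl, rfl⟩ := (U.check k b e).1 t ht fun i => by
      simpa using dvd_add (he i) (hm i)
    rw [h1, int_classVec]
    exact ⟨w * η, by simp [sq]⟩
  · simpa using dvd_add (he i) (hm i)

theorem prime_int_of_norm {p : ℕ} (hp : p.Prime) {x : Fin 6 → ℤ} (h : (mulMatrix D x).det = p) :
    Prime (E.int x) := by
  have hn : Ideal.absNorm (Ideal.span {E.int x}) = p := by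
    rw [Ideal.absNorm_span_singleton, norm_int, h]; simp
  have h0 : E.int x ≠ 0 := by
    rintro h0
    rw [h0] at hn
    simp at hn
    exact hp.ne_zero hn.symm
  rw [← Ideal.span_singleton_prime h0]
  exact Ideal.isPrime_of_irreducible_absNorm (by rw [hn]; exact hp)

theorem isSquare_of_coordModEq_one (E : SexticField 1 L) {m : Fin 6 → ℤ} {β γ : 𝓞 L}
    (h : γ ^ 2 = E.int m * β) (h0 : γ ≠ 0)
    (hcop : ∀ p, Prime p → p ∣ E.int m → p ∣ β → p ∣ 1 + E.θ + E.θ ^ 2) :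
    (∀ t ∈ squareTargets, CoordModEq 4 m t → IsSquare (E.int m)) ∧
      ∀ t ∈ twistedTargets, ¬ CoordModEq 4 m t := by
  have := E.isPrincipalIdealRing_one
  refine E.isSquare_of_coordModEq one_pos unitDataOne E.exists_odd_mul_eq_int_one
    (E.prime_int_of_norm (p := 13) (by norm_num) det_mulMatrix_one) h h0 fun p h1 h2 h3 => ?_
  have := hcop p h1 h2 h3
  simpa [unitDataOne, int, cval] using this

theorem isSquare_of_coordModEq_two (E : SexticField 2 L) {m : Fin 6 → ℤ} {β γ : 𝓞 L}
    (h : γ ^ 2 = E.int m * β) (h0 : γ ≠ 0)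
    (hcop : ∀ p, Prime p → p ∣ E.int m → p ∣ β → p ∣ 1 + E.I * E.θ) :
    (∀ t ∈ squareTargets, CoordModEq 4 m t → IsSquare (E.int m)) ∧
      ∀ t ∈ twistedTargets, ¬ CoordModEq 4 m t := by
  have := E.isPrincipalIdealRing_two
  refine E.isSquare_of_coordModEq two_pos unitDataTwo E.exists_odd_mul_eq_int_two
    (E.prime_int_of_norm (p := 3) (by norm_num) det_mulMatrix_two) h h0 fun p h1 h2 h3 => ?_
  have := hcop p h1 h2 h3
  simpa [unitDataTwo, int, cval] using this

end SexticField

/-- The cubic `X³ + X² + 1`. -/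
noncomputable def cubic (S : Type*) [CommRing S] : S[X] := X ^ 3 + X ^ 2 + 1

/-- The sextic `(X³ + X² - 2 X - 1)² + 4 D (X² + X)²`. -/
noncomputable def sextic (S : Type*) [CommRing S] (D : ℤ) : S[X] :=
  (X ^ 3 + X ^ 2 - 2 * X - 1) ^ 2 + 4 * (D : S[X]) * (X ^ 2 + X) ^ 2

@[simp] theorem map_cubic {S T : Type*} [CommRing S] [CommRing T] (φ : S →+* T) :
    (cubic S).map φ = cubic T := by simp [cubic]

@[simp] theorem map_sextic {S T : Type*} [CommRing S] [CommRing T] (φ : S →+* T) (D : ℤ) :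
    (sextic S D).map φ = sextic T D := by
  simp [sextic, Polynomial.map_ofNat]

theorem sextic_eq {S : Type*} [CommRing S] (D : ℤ) :
    sextic S D = cubic S ^ 2 + 4 * ((X ^ 2 + X) + ((D : S[X]) - 1) * (X ^ 2 + X) ^ 2) := by
  rw [sextic, cubic]; ring

theorem cubic_natDegree {S : Type*} [CommRing S] [Nontrivial S] : (cubic S).natDegree = 3 := by
  rw [cubic]; compute_degree!

theorem cubic_monic {S : Type*} [CommRing S] [Nontrivial S] : (cubic S).Monic := by
  rw [cubic]; monicity!

theorem sextic_expand {S : Type*} [CommRing S] (D : ℤ) :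
    sextic S D = X ^ 6 + 2 * X ^ 5 + C ((4 * D - 3 : ℤ) : S) * X ^ 4 +
      C ((8 * D - 6 : ℤ) : S) * X ^ 3 + C ((4 * D + 2 : ℤ) : S) * X ^ 2 + 4 * X + 1 := by
  rw [sextic]
  simp only [Int.cast_sub, Int.cast_add, Int.cast_mul, Int.cast_ofNat, C_sub, C_add, C_mul,
    map_ofNat, map_intCast]
  ring

theorem sextic_natDegree {S : Type*} [CommRing S] [Nontrivial S] (D : ℤ) :
    (sextic S D).natDegree = 6 := by
  rw [sextic_expand]; compute_degree!

theorem sextic_monic {S : Type*} [CommRing S] [Nontrivial S] (D : ℤ) : (sextic S D).Monic := by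
  rw [sextic_expand]; monicity!

theorem irreducible_cubic : Irreducible (cubic (ZMod 2)) := by
  rw [cubic_monic.irreducible_iff_roots_eq_zero_of_degree_le_three
    (by rw [cubic_natDegree]; norm_num) (by rw [cubic_natDegree]), Multiset.eq_zero_iff_forall_notMem]
  intro a ha
  have := (mem_roots'.mp ha).2
  simp only [cubic, IsRoot, eval_add, eval_pow, eval_X, eval_one] at this
  clear ha
  revert a
  decide

theorem eval_sextic_pos {D : ℤ} (hD : 0 < D) (x : ℝ) : 0 < (sextic ℝ D).eval x := by
  have hD' : (0 : ℝ) < D := by exact_mod_cast hD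
  simp only [sextic, eval_add, eval_mul, eval_pow, eval_sub, eval_X, eval_one, eval_ofNat,
    eval_intCast]
  have h1 : 0 ≤ (x ^ 3 + x ^ 2 - 2 * x - 1) ^ 2 := sq_nonneg _
  have h2 : 0 ≤ 4 * (D : ℝ) * (x ^ 2 + x) ^ 2 := by positivity
  rcases eq_or_ne (x ^ 2 + x) 0 with h | h
  · have : x ^ 3 + x ^ 2 - 2 * x - 1 = -2 * x - 1 := by linear_combination x * h
    have : (x ^ 3 + x ^ 2 - 2 * x - 1) ^ 2 = 1 := by
      rw [this]; linear_combination 4 * h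
    rw [this]; positivity
  · have : 0 < 4 * (D : ℝ) * (x ^ 2 + x) ^ 2 := by positivity
    positivity

theorem exists_root_of_odd_natDegree {g : ℝ[X]} (hg : g.Monic) (hodd : Odd g.natDegree) :
    ∃ x, g.eval x = 0 := by
  have hpos : 0 < g.degree := natDegree_pos_iff_degree_pos.mp hodd.pos
  have h1 : Filter.Tendsto (fun x => g.eval x) Filter.atTop Filter.atTop :=
    tendsto_atTop_of_leadingCoeff_nonneg g hpos (by rw [hg]; norm_num)
  have h2 : Filter.Tendsto (fun x => (-g.comp (-X)).eval x) Filter.atTop Filter.atTop := by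
    refine tendsto_atTop_of_leadingCoeff_nonneg _ ?_ ?_
    · rw [degree_neg, ← natDegree_pos_iff_degree_pos, natDegree_comp]
      simpa using hodd.pos
    · rw [leadingCoeff_neg, leadingCoeff_comp (by simp), hg]
      simp [hodd.neg_one_pow]
  obtain ⟨a, ha⟩ := (h1.eventually_ge_atTop 0).exists
  obtain ⟨b, hb⟩ := (h2.eventually_ge_atTop 0).exists
  simp only [eval_neg, eval_comp, eval_X] at hb
  exact mem_range_of_exists_le_of_exists_ge g.continuous ⟨-b, by linarith⟩ ⟨a, ha⟩

theorem irreducible_sextic_int {D : ℤ} (hD : 0 < D) : Irreducible (sextic ℤ D) := by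
  rw [(sextic_monic D).irreducible_iff_natDegree', sextic_natDegree]
  refine ⟨fun h => by simpa [h] using sextic_natDegree (S := ℤ) D, fun f g hf hg hfg hmem => ?_⟩
  have hdvd : g.map (Int.castRingHom (ZMod 2)) ∣ cubic (ZMod 2) ^ 2 := by
    refine ⟨f.map (Int.castRingHom (ZMod 2)), ?_⟩
    rw [mul_comm, ← Polynomial.map_mul, hfg, map_sextic, sextic_eq]
    have : (4 : (ZMod 2)[X]) = 0 := by
      rw [← C_ofNat]
      exact (congrArg C (by decide : (4 : ZMod 2) = 0)).trans C_0
    rw [this]; ring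
  obtain ⟨i, hi, has⟩ := (dvd_prime_pow irreducible_cubic.prime 2).mp hdvd
  have hdeg := natDegree_eq_of_degree_eq (degree_eq_degree_of_associated has)
  rw [natDegree_pow, cubic_natDegree, hg.natDegree_map] at hdeg
  rw [Finset.mem_Ioc] at hmem
  have hdeg3 : g.natDegree = 3 := by omega
  obtain ⟨x, hx⟩ := exists_root_of_odd_natDegree (g := g.map (Int.castRingHom ℝ)) (hg.map _)
    (by rw [hg.natDegree_map, hdeg3]; decide)
  have h := congrArg (fun p => (p.map (Int.castRingHom ℝ)).eval x) hfg
  simp only [Polynomial.map_mul, eval_mul, hx, mul_zero, map_sextic] at h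
  exact (eval_sextic_pos hD x).ne h

theorem irreducible_sextic {D : ℤ} (hD : 0 < D) : Irreducible (sextic ℚ D) := by
  have := (sextic_monic (S := ℤ) D).irreducible_iff_irreducible_map_fraction_map (K := ℚ)
  rw [map_sextic] at this
  exact this.mp (irreducible_sextic_int hD)

/-- Construction of a `SexticField` from elements of the field. -/
noncomputable def SexticField.ofField {D : ℤ} {L : Type*} [Field L] [NumberField L] (t i : L)
    (ht : IsIntegral ℤ t) (hi : IsIntegral ℤ i) (h1 : i ^ 2 = -(D : L))
    (h2 : t ^ 3 = 1 + 2 * t - t ^ 2 + 2 * i * (t ^ 2 + t)) (h3 : Module.finrank ℚ L = 6)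
    (h4 : ∀ x : Fin 6 → ℚ, cval t i (fun i => (x i : L)) = 0 → x = 0) : SexticField D L where
  θ := IsIntegralClosure.mk' (𝓞 L) t ht
  I := IsIntegralClosure.mk' (𝓞 L) i hi
  sq_I := by
    apply RingOfIntegers.coe_injective
    simpa [IsIntegralClosure.algebraMap_mk'] using h1
  cube_θ := by
    apply RingOfIntegers.coe_injective
    have h2' : algebraMap (𝓞 L) L 2 = 2 := map_ofNat _ 2
    simpa [h2', IsIntegralClosure.algebraMap_mk'] using h2
  finrank_eq := h3
  indep := by simpa only [IsIntegralClosure.algebraMap_mk'] using h4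

/-- The number field generated by a root of the sextic. -/
abbrev SexticRoot (D : ℤ) : Type := AdjoinRoot (sextic ℚ D)

section
variable {D : ℤ} [hirr : Fact (Irreducible (sextic ℚ D))]

instance : NumberField (SexticRoot D) where
  to_charZero := charZero_of_injective_algebraMap (algebraMap ℚ (SexticRoot D)).injective
  to_finiteDimensional := (AdjoinRoot.powerBasis (sextic_monic (S := ℚ) D).ne_zero).finite

theorem eq_zero_of_mk_eq_zero {p : ℚ[X]} (hp : p.natDegree < 6)
    (h : AdjoinRoot.mk (sextic ℚ D) p = 0) : p = 0 := by
  by_contra h0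
  have := natDegree_le_of_dvd (AdjoinRoot.mk_eq_zero.mp h) h0
  rw [sextic_natDegree] at this
  omega

theorem isIntegral_root : IsIntegral ℤ (AdjoinRoot.root (sextic ℚ D)) := by
  refine ⟨sextic ℤ D, sextic_monic D, ?_⟩
  have : eval₂ (algebraMap ℤ (SexticRoot D)) (AdjoinRoot.root (sextic ℚ D)) (sextic ℤ D)
      = eval₂ (AdjoinRoot.of (sextic ℚ D)) (AdjoinRoot.root (sextic ℚ D)) (sextic ℚ D) := by
    conv_rhs => arg 3; rw [← map_sextic (Int.castRingHom ℚ) D]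
    rw [eval₂_map]
    congr 1
  rw [this, AdjoinRoot.eval₂_root]

theorem root_sq_add_root_ne_zero :
    AdjoinRoot.root (sextic ℚ D) ^ 2 + AdjoinRoot.root (sextic ℚ D) ≠ 0 := by
  intro h
  have h1 : AdjoinRoot.mk (sextic ℚ D) (X ^ 2 + X) = 0 := by simpa using h
  have h2 := eq_zero_of_mk_eq_zero (by compute_degree!) h1
  simpa [coeff_X] using congrArg (fun p => p.coeff 2) h2

theorem root_relation : (AdjoinRoot.root (sextic ℚ D) ^ 3 + AdjoinRoot.root (sextic ℚ D) ^ 2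
    - 2 * AdjoinRoot.root (sextic ℚ D) - 1) ^ 2 +
    4 * (D : SexticRoot D) * (AdjoinRoot.root (sextic ℚ D) ^ 2 + AdjoinRoot.root (sextic ℚ D)) ^ 2
    = 0 := by
  have := AdjoinRoot.mk_self (f := sextic ℚ D)
  conv_lhs at this => arg 2; rw [sextic]
  simpa [map_ofNat] using this

/-- The square root of `-D` in the sextic field. -/
noncomputable def sexticI (D : ℤ) [Fact (Irreducible (sextic ℚ D))] : SexticRoot D :=
  (AdjoinRoot.root (sextic ℚ D) ^ 3 + AdjoinRoot.root (sextic ℚ D) ^ 2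
    - 2 * AdjoinRoot.root (sextic ℚ D) - 1) /
    (2 * (AdjoinRoot.root (sextic ℚ D) ^ 2 + AdjoinRoot.root (sextic ℚ D)))

theorem sexticI_mul : 2 * (AdjoinRoot.root (sextic ℚ D) ^ 2 + AdjoinRoot.root (sextic ℚ D))
    * sexticI D = AdjoinRoot.root (sextic ℚ D) ^ 3 + AdjoinRoot.root (sextic ℚ D) ^ 2
    - 2 * AdjoinRoot.root (sextic ℚ D) - 1 := by
  have := root_sq_add_root_ne_zero (D := D)
  rw [sexticI, mul_div_cancel₀]
  simpa using this

theorem sexticI_sq : sexticI D ^ 2 = -(D : SexticRoot D) := by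
  have h1 := root_sq_add_root_ne_zero (D := D)
  have h2 := root_relation (D := D)
  rw [← sexticI_mul] at h2
  have h3 : (4 * (AdjoinRoot.root (sextic ℚ D) ^ 2 + AdjoinRoot.root (sextic ℚ D)) ^ 2) ≠ 0 := by
    simpa using h1
  apply mul_left_cancel₀ h3
  linear_combination h2

theorem isIntegral_sexticI : IsIntegral ℤ (sexticI D) := by
  refine IsIntegral.of_pow two_pos ?_
  rw [sexticI_sq]
  exact_mod_cast isIntegral_algebraMap (R := ℤ) (A := SexticRoot D) (x := -D)

/-- The field `SexticRoot D` with its generators. -/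
noncomputable def sexticField (D : ℤ) [Fact (Irreducible (sextic ℚ D))] :
    SexticField D (SexticRoot D) := by
  refine SexticField.ofField (AdjoinRoot.root (sextic ℚ D)) (sexticI D) isIntegral_root
    isIntegral_sexticI sexticI_sq ?_ ?_ ?_
  · linear_combination -sexticI_mul (D := D)
  · rw [(AdjoinRoot.powerBasis (sextic_monic (S := ℚ) D).ne_zero).finrank,
      AdjoinRoot.powerBasis_dim, sextic_natDegree]
  · intro x hx
    simp only [cval] at hx
    set t := AdjoinRoot.root (sextic ℚ D) with ht
    let P : ℚ[X] := 2 * (X ^ 2 + X) * (C (x 0) + C (x 1) * X + C (x 2) * X ^ 2) +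
      (X ^ 3 + X ^ 2 - 2 * X - 1) * (C (x 3) + C (x 4) * X + C (x 5) * X ^ 2)
    have hP : P = C (x 5) * X ^ 5 + C (2 * x 2 + x 5 + x 4) * X ^ 4 +
      C (2 * x 1 + 2 * x 2 + x 3 + x 4 - 2 * x 5) * X ^ 3 +
      C (2 * x 0 + 2 * x 1 + x 3 - 2 * x 4 - x 5) * X ^ 2 +
      C (2 * x 0 - 2 * x 3 - x 4) * X + C (- x 3) := by
      simp only [P, C_add, C_sub, C_mul, C_neg, map_ofNat]
      ring
    have h1 : AdjoinRoot.mk (sextic ℚ D) P = 0 := by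
      have hc (q : ℚ) : AdjoinRoot.of (sextic ℚ D) q = (q : SexticRoot D) :=
        eq_ratCast (AdjoinRoot.of (sextic ℚ D)) q
      simp only [P, map_add, map_mul, map_sub, map_pow, AdjoinRoot.mk_X, AdjoinRoot.mk_C, map_one,
        map_ofNat, ← ht, hc]
      have := sexticI_mul (D := D)
      rw [← ht] at this
      rw [← this]
      linear_combination 2 * (t ^ 2 + t) * hx
    have h2 := eq_zero_of_mk_eq_zero (by rw [hP]; compute_degree!) h1
    rw [hP] at h2
    have c5 := congrArg (fun p => p.coeff 5) h2
    have c4 := congrArg (fun p => p.coeff 4) h2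
    have c3 := congrArg (fun p => p.coeff 3) h2
    have c2 := congrArg (fun p => p.coeff 2) h2
    have c1 := congrArg (fun p => p.coeff 1) h2
    have c0 := congrArg (fun p => p.coeff 0) h2
    simp [coeff_X, -map_add, -map_sub, -map_neg, -map_mul] at c0 c1 c2 c3 c4 c5
    ext i
    fin_cases i <;> simp <;> linarith

end

theorem derivative_relation_one {S : Type*} [CommRing S] {θ I : S} (hI : I ^ 2 = -1)
    (hθ : θ ^ 3 = 1 + 2 * θ - θ ^ 2 + 2 * I * (θ ^ 2 + θ)) :
    4 * I * (1 + θ + θ ^ 2) ^ 2 = 6 * θ ^ 5 + 10 * θ ^ 4 + 4 * θ ^ 3 + 6 * θ ^ 2 + 12 * θ + 4 := by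
  grind

theorem derivative_relation_two {S : Type*} [CommRing S] {θ I : S} (hI : I ^ 2 = -2)
    (hθ : θ ^ 3 = 1 + 2 * θ - θ ^ 2 + 2 * I * (θ ^ 2 + θ)) :
    4 * I * (1 + I * θ) ^ 4 = (7 * θ + θ ^ 2 - 2 * I - 2 * (I * θ) + 2 * (I * θ ^ 2)) *
      (6 * θ ^ 5 + 10 * θ ^ 4 + 20 * θ ^ 3 + 30 * θ ^ 2 + 20 * θ + 4) := by
  grind

theorem derivative_sextic {S : Type*} [CommRing S] (D : ℤ) :
    derivative (sextic S D) = 6 * X ^ 5 + 10 * X ^ 4 + C ((4 * (4 * D - 3) : ℤ) : S) * X ^ 3 +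
      C ((3 * (8 * D - 6) : ℤ) : S) * X ^ 2 + C ((2 * (4 * D + 2) : ℤ) : S) * X + 4 := by
  rw [sextic_expand]
  simp only [derivative_add, derivative_mul, derivative_X_pow, derivative_C, derivative_X,
    derivative_one, derivative_ofNat]
  simp only [Int.cast_sub, Int.cast_add, Int.cast_mul, Int.cast_ofNat,
    C_sub, C_add, C_mul, map_ofNat, map_intCast, map_natCast]
  push_cast
  ring

theorem sextic_eq_sq {S : Type*} [CommRing S] [CharP S 2] (D : ℤ) :
    sextic S D = cubic S ^ 2 := by
  rw [sextic_eq, show (4 : S[X]) = 2 * 2 by norm_num, CharTwo.two_eq_zero (R := S[X])]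
  ring

namespace SexticField
variable {D : ℤ} {L : Type*} [Field L] [NumberField L] (E : SexticField D L)

theorem aeval_sextic : aeval E.θ (sextic ℤ D) = 0 := by
  have h1 := E.sq_I
  have h2 := E.cube_θ
  have h3 : E.θ ^ 3 + E.θ ^ 2 - 2 * E.θ - 1 = 2 * E.I * (E.θ ^ 2 + E.θ) := by
    rw [h2]; ring
  simp only [sextic, map_add, map_mul, map_pow, map_sub, aeval_X, map_one, map_ofNat, map_intCast]
  rw [h3]
  linear_combination 4 * (E.θ ^ 2 + E.θ) ^ 2 * h1

theorem dvd_of_common_prime {q v : 𝓞 L} {j : ℕ} (hD : ∀ p : 𝓞 L, Prime p → p ∣ (D : 𝓞 L) → p ∣ 2)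
    (hv : 4 * E.I * q ^ j = v * aeval E.θ (derivative (sextic ℤ D)))
    {A m n : ℤ[X]} {e : ℤ} (h : A ^ 2 - C (e ^ 2) * sextic ℤ D = m * n) (hm : m.natDegree ≤ 2)
    (hm2 : m.map (Int.castRingHom (ZMod 2)) ≠ 0)
    (hcop : ∀ p : ℕ, p.Prime → (p : ℤ) ∣ e →
      IsCoprime (m.map (Int.castRingHom (ZMod p))) (n.map (Int.castRingHom (ZMod p))))
    (p : 𝓞 L) (hp : Prime p) (h1 : p ∣ aeval E.θ m) (h2 : p ∣ aeval E.θ n) : p ∣ q := by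
  let P : Ideal (𝓞 L) := Ideal.span {p}
  have hP : P.IsPrime := (Ideal.span_singleton_prime hp.ne_zero).mpr hp
  have hP0 : P ≠ ⊥ := by simpa [P] using hp.ne_zero
  have hfin : Finite (𝓞 L ⧸ P) := Ideal.finiteQuotientOfFreeOfNeBot P hP0
  let φ := Ideal.Quotient.mk P
  have hφ (x : 𝓞 L) : φ x = 0 ↔ p ∣ x := by
    rw [Ideal.Quotient.eq_zero_iff_mem, Ideal.mem_span_singleton]
  obtain ⟨l, hl⟩ := CharP.exists (𝓞 L ⧸ P)
  have hlp : l.Prime := (CharP.char_is_prime_or_zero (𝓞 L ⧸ P) l).resolve_right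
    (CharP.char_ne_zero_of_finite (𝓞 L ⧸ P) l)
  have hlf : Fact l.Prime := ⟨hlp⟩
  let t := φ E.θ
  let ψ : ZMod l →+* 𝓞 L ⧸ P := ZMod.castHom dvd_rfl _
  have hψ (g : ℤ[X]) : (g.map (Int.castRingHom (ZMod l))).eval₂ ψ t = φ (aeval E.θ g) := by
    rw [eval₂_map, aeval_def, hom_eval₂]
    congr 1
    exact RingHom.ext_int _ _
  have hm0 := (hφ _).mpr h1
  have hn0 := (hφ _).mpr h2
  have hf0 : φ (aeval E.θ (sextic ℤ D)) = 0 := by rw [aeval_sextic, map_zero]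
  have hl2 : l ≠ 2 := by
    rintro rfl
    have hc : IsCoprime (cubic (ZMod 2)) (m.map (Int.castRingHom (ZMod 2))) := by
      rw [irreducible_cubic.coprime_iff_not_dvd]
      intro hd
      have := natDegree_le_of_dvd hd hm2
      rw [cubic_natDegree] at this
      have := natDegree_map_le (f := Int.castRingHom (ZMod 2)) (p := m)
      omega
    obtain ⟨a, b, hab⟩ := hc
    have hab' := congrArg (eval₂ ψ t) hab
    rw [eval₂_add, eval₂_mul, eval₂_mul, hψ, hm0, mul_zero, add_zero, eval₂_one] at hab'
    have hcu : (cubic (ZMod 2)).eval₂ ψ t ^ 2 = 0 := by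
      rw [← eval₂_pow, ← hf0, ← hψ, map_sextic, sextic_eq_sq]
    rw [pow_eq_zero_iff two_ne_zero] at hcu
    rw [hcu, mul_zero] at hab'
    exact zero_ne_one hab'
  have hp2 : ¬ p ∣ 2 := by
    intro h
    have := (hφ _).mpr h
    rw [map_ofNat] at this
    have h3 : ((2 : ℕ) : 𝓞 L ⧸ P) = 0 := by exact_mod_cast this
    rw [CharP.cast_eq_zero_iff _ l] at h3
    exact hl2 ((Nat.prime_dvd_prime_iff_eq hlp Nat.prime_two).mp h3)
  have he : ¬ (l : ℤ) ∣ e := by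
    intro hd
    obtain ⟨a, b, hab⟩ := hcop l hlp hd
    have hab' := congrArg (eval₂ ψ t) hab
    rw [eval₂_add, eval₂_mul, eval₂_mul, hψ, hψ, hm0, hn0, mul_zero, mul_zero, add_zero,
      eval₂_one] at hab'
    exact zero_ne_one hab'
  have he0 : φ (e : 𝓞 L) ≠ 0 := by
    rw [map_intCast]
    exact fun h0 => he ((CharP.intCast_eq_zero_iff _ l e).mp h0)
  have hA : φ (aeval E.θ A) = 0 := by
    have := congrArg (fun g => φ (aeval E.θ g)) h
    simp only [map_sub, map_mul, map_pow, hm0, hf0] at this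
    simpa using this
  have hCe : φ (aeval E.θ (C e)) = φ (e : 𝓞 L) := by simp
  have hd := congrArg (fun g => φ (aeval E.θ (derivative g))) h
  simp only [derivative_mul, derivative_sq, derivative_C, zero_mul, zero_add,
    map_sub, map_mul, map_add, hA, hm0, hn0, mul_zero, zero_add] at hd
  have hd' : φ (aeval E.θ (derivative (sextic ℤ D))) = 0 := by
    simpa only [map_pow, hA, he0, mul_zero, zero_mul, zero_sub, neg_eq_zero, mul_eq_zero, hCe,
      pow_eq_zero_iff two_ne_zero, false_or] using hd
  have h4 : p ∣ 4 * E.I * q ^ j := by rw [hv]; exact Dvd.dvd.mul_left ((hφ _).mp hd') _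
  rcases hp.dvd_or_dvd h4 with h5 | h5
  · exfalso
    rcases hp.dvd_or_dvd h5 with h6 | h6
    · have : (4 : 𝓞 L) = 2 * 2 := by norm_num
      rw [this] at h6
      exact hp2 ((hp.dvd_or_dvd h6).elim id id)
    · have : p ∣ E.I ^ 2 := dvd_pow h6 two_ne_zero
      rw [E.sq_I, dvd_neg] at this
      exact hp2 (hD p hp this)
  · exact hp.dvd_of_dvd_pow h5

end SexticField

theorem sexticField_θ {D : ℤ} [Fact (Irreducible (sextic ℚ D))] :
    algebraMap (𝓞 (SexticRoot D)) (SexticRoot D) (sexticField D).θ =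
      AdjoinRoot.root (sextic ℚ D) :=
  IsIntegralClosure.algebraMap_mk' (R := ℤ) (𝓞 (SexticRoot D)) _ isIntegral_root

theorem coe_aeval_θ {D : ℤ} [Fact (Irreducible (sextic ℚ D))] (g : ℤ[X]) :
    ((aeval (sexticField D).θ g : 𝓞 (SexticRoot D)) : SexticRoot D)
      = AdjoinRoot.mk (sextic ℚ D) (g.map (Int.castRingHom ℚ)) := by
  change algebraMap (𝓞 (SexticRoot D)) (SexticRoot D) _ = _
  rw [← aeval_algebraMap_apply, sexticField_θ, ← AdjoinRoot.aeval_eq, aeval_def, aeval_def,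
    eval₂_map]
  congr 1

theorem SexticField.aeval_eq_int {D : ℤ} {L : Type*} [Field L] [NumberField L]
    (E : SexticField D L) {m : ℤ[X]} (hm : m.natDegree ≤ 2) :
    aeval E.θ m = E.int ![m.coeff 0, m.coeff 1, m.coeff 2, 0, 0, 0] := by
  rw [aeval_eq_sum_range' (n := 3) (by omega)]
  simp [SexticField.int, cval, Finset.sum_range_succ]

theorem sextic_dvd_sub_sq {D : ℤ} (hD : D = 1 ∨ D = 2) {A m n : ℤ[X]} {e : ℤ}
    (h : A ^ 2 - C (e ^ 2) * sextic ℤ D = m * n) (hA0 : A ≠ 0) (hA : A.natDegree ≤ 3)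
    (hm : m.natDegree ≤ 2) (hm2 : m.map (Int.castRingHom (ZMod 2)) ≠ 0)
    (hcop : ∀ p : ℕ, p.Prime → (p : ℤ) ∣ e →
      IsCoprime (m.map (Int.castRingHom (ZMod p))) (n.map (Int.castRingHom (ZMod p)))) :
    (∀ t ∈ SexticField.squareTargets,
      SexticField.CoordModEq 4 ![m.coeff 0, m.coeff 1, m.coeff 2, 0, 0, 0] t →
      ∃ η : ℚ[X], sextic ℚ D ∣ m.map (Int.castRingHom ℚ) - η ^ 2) ∧
    ∀ t ∈ SexticField.twistedTargets,
      ¬ SexticField.CoordModEq 4 ![m.coeff 0, m.coeff 1, m.coeff 2, 0, 0, 0] t := by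
  have hD0 : 0 < D := by omega
  have : Fact (Irreducible (sextic ℚ D)) := ⟨irreducible_sextic hD0⟩
  let E := sexticField D
  have hγ : aeval E.θ A ^ 2 = E.int ![m.coeff 0, m.coeff 1, m.coeff 2, 0, 0, 0] * aeval E.θ n := by
    rw [← E.aeval_eq_int hm, ← map_mul, ← h]
    simp [E.aeval_sextic]
  have hγ0 : aeval E.θ A ≠ 0 := by
    intro h0
    have h1 := coe_aeval_θ (D := D) A
    rw [show aeval (sexticField D).θ A = 0 from h0] at h1
    have h2 : AdjoinRoot.mk (sextic ℚ D) (A.map (Int.castRingHom ℚ)) = 0 := by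
      rw [← h1]; rfl
    have h3 := eq_zero_of_mk_eq_zero (lt_of_le_of_lt natDegree_map_le (by omega)) h2
    exact hA0 ((Polynomial.map_eq_zero_iff (Int.castRingHom ℚ).injective_int).mp h3)
  have key : (∀ t ∈ SexticField.squareTargets,
      SexticField.CoordModEq 4 ![m.coeff 0, m.coeff 1, m.coeff 2, 0, 0, 0] t →
      IsSquare (E.int ![m.coeff 0, m.coeff 1, m.coeff 2, 0, 0, 0])) ∧
    ∀ t ∈ SexticField.twistedTargets,
      ¬ SexticField.CoordModEq 4 ![m.coeff 0, m.coeff 1, m.coeff 2, 0, 0, 0] t := by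
    rcases hD with rfl | rfl
    · refine E.isSquare_of_coordModEq_one hγ hγ0 fun p hp h1 h2 => ?_
      rw [← E.aeval_eq_int hm] at h1
      refine E.dvd_of_common_prime (v := 1) (j := 2) (fun p hp hd => ?_) ?_ h hm hm2 hcop p hp h1 h2
      · exact (hp.not_isUnit (isUnit_of_dvd_one (by simpa using hd))).elim
      · rw [one_mul, derivative_relation_one (by simpa using E.sq_I) E.cube_θ, derivative_sextic]
        simp [map_ofNat]
    · refine E.isSquare_of_coordModEq_two hγ hγ0 fun p hp h1 h2 => ?_
      rw [← E.aeval_eq_int hm] at h1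
      refine E.dvd_of_common_prime (j := 4)
        (v := 7 * E.θ + E.θ ^ 2 - 2 * E.I - 2 * (E.I * E.θ) + 2 * (E.I * E.θ ^ 2)) (fun p hp hd => by simpa using hd) ?_ h hm hm2 hcop p
        hp h1 h2
      · rw [derivative_relation_two (by simpa using E.sq_I) E.cube_θ, derivative_sextic]
        simp [map_ofNat]
  refine ⟨fun t ht hc => ?_, key.2⟩
  obtain ⟨η, hη⟩ := key.1 t ht hc
  obtain ⟨ηp, hηp⟩ := AdjoinRoot.mk_surjective (η : SexticRoot D)
  refine ⟨ηp, AdjoinRoot.mk_eq_mk.mp ?_⟩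
  rw [← coe_aeval_θ, E.aeval_eq_int hm, hη, map_pow, hηp, sq]
  rfl

/-- The ring of rational numbers with odd denominator. -/
noncomputable def OddDen : Subring ℚ := (PadicInt.subring 2).comap (algebraMap ℚ ℚ_[2])

namespace OddDen

theorem mem_iff {x : ℚ} : x ∈ OddDen ↔ ‖(x : ℚ_[2])‖ ≤ 1 := Iff.rfl

/-- The inclusion into the `2`-adic integers. -/
noncomputable def toPadicInt : OddDen →+* ℤ_[2] :=
  ((algebraMap ℚ ℚ_[2]).comp OddDen.subtype).codRestrict (PadicInt.subring 2) fun x => x.2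

/-- Reduction modulo `2`. -/
noncomputable def residue : OddDen →+* ZMod 2 := PadicInt.toZMod.comp toPadicInt

theorem residue_eq_zero_iff {x : OddDen} : residue x = 0 ↔ ∃ y, x = 2 * y := by
  constructor
  · intro h
    have h1 : toPadicInt x ∈ RingHom.ker (PadicInt.toZMod (p := 2)) := h
    rw [PadicInt.ker_toZMod, PadicInt.maximalIdeal_eq_span_p, Ideal.mem_span_singleton] at h1
    obtain ⟨z, hz⟩ := h1
    have h2 : ((x : ℚ) : ℚ_[2]) = 2 * (z : ℚ_[2]) := by
      have := congrArg (fun u : ℤ_[2] => (u : ℚ_[2])) hz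
      rw [PadicInt.coe_mul, PadicInt.coe_natCast] at this
      exact this
    refine ⟨⟨x / 2, ?_⟩, ?_⟩
    · rw [mem_iff]
      push_cast
      rw [h2, mul_div_cancel_left₀ _ two_ne_zero]
      exact z.2
    · ext
      exact (mul_div_cancel₀ (x : ℚ) two_ne_zero).symm
  · rintro ⟨y, rfl⟩
    rw [map_mul, show (2 : OddDen) = ((2 : ℕ) : OddDen) by norm_num, map_natCast]
    simp [show (2 : ZMod 2) = 0 from rfl]

theorem exists_pow_mul_mem (x : ℚ) : ∃ i : ℕ, 2 ^ i * x ∈ OddDen := by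
  obtain ⟨i, hi⟩ := pow_unbounded_of_one_lt ‖(x : ℚ_[2])‖ one_lt_two
  refine ⟨i, ?_⟩
  rw [mem_iff]
  have h2 : ‖(2 : ℚ_[2])‖ = 2⁻¹ := by simpa using Padic.norm_p (p := 2)
  push_cast
  rw [norm_mul, norm_pow, h2, inv_pow, inv_mul_le_iff₀ (by positivity), mul_one]
  exact hi.le

theorem mem_of_isIntegral {x : ℚ} {n : ℕ} (hn : n ≠ 0) (h : x ^ n ∈ OddDen) : x ∈ OddDen := by
  rw [mem_iff] at *
  push_cast at h
  rw [norm_pow] at h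
  exact (pow_le_one_iff_of_nonneg (norm_nonneg _) hn).mp h

theorem inv_mem {x : ℚ} (hx : x ∈ OddDen) (h : residue ⟨x, hx⟩ ≠ 0) : x⁻¹ ∈ OddDen := by
  rw [mem_iff]
  by_contra h1
  push Not at h1
  apply h
  have h3 : ‖toPadicInt ⟨x, hx⟩‖ < 1 := by
    change ‖(x : ℚ_[2])‖ < 1
    have h0 : x ≠ 0 := by rintro rfl; simp at h1; linarith
    push_cast at h1
    rw [norm_inv] at h1
    exact (one_lt_inv₀ (norm_pos_iff.mpr (by exact_mod_cast h0))).mp h1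
  have : toPadicInt ⟨x, hx⟩ ∈ RingHom.ker (PadicInt.toZMod (p := 2)) := by
    rw [PadicInt.ker_toZMod]
    exact PadicInt.mem_nonunits.mpr h3
  exact this

end OddDen

namespace OddDen

/-- The inclusion of polynomials with coefficients in `OddDen` into rational polynomials. -/
noncomputable def toRat : OddDen[X] →+* ℚ[X] := mapRingHom OddDen.subtype

/-- Reduction of polynomials modulo `2`. -/
noncomputable def red : OddDen[X] →+* (ZMod 2)[X] := mapRingHom residue

theorem toRat_injective : Function.Injective toRat :=
  map_injective _ Subtype.val_injective

@[simp] theorem toRat_inj {p q : OddDen[X]} : toRat p = toRat q ↔ p = q := toRat_injective.eq_iff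

@[simp] theorem natDegree_toRat (p : OddDen[X]) : (toRat p).natDegree = p.natDegree :=
  natDegree_map_eq_of_injective Subtype.val_injective p

theorem natDegree_red_le (p : OddDen[X]) : (red p).natDegree ≤ p.natDegree := natDegree_map_le

@[simp] theorem coeff_red (p : OddDen[X]) (i : ℕ) : (red p).coeff i = residue (p.coeff i) :=
  coeff_map _ _

@[simp] theorem toRat_X : toRat X = X := map_X _
@[simp] theorem red_X : red X = X := map_X _

@[simp] theorem toRat_cubic : toRat (cubic OddDen) = cubic ℚ := map_cubic _
@[simp] theorem red_cubic : red (cubic OddDen) = cubic (ZMod 2) := map_cubic _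
@[simp] theorem toRat_sextic (D : ℤ) : toRat (sextic OddDen D) = sextic ℚ D := map_sextic _ _

theorem red_two : red 2 = 0 := by
  rw [map_ofNat]
  exact CharTwo.two_eq_zero

theorem red_two_mul (p : OddDen[X]) : red (2 * p) = 0 := by rw [map_mul, red_two, zero_mul]

theorem red_two_pow_mul {i : ℕ} (hi : i ≠ 0) (p : OddDen[X]) : red (2 ^ i * p) = 0 := by
  rw [map_mul, map_pow, red_two, zero_pow hi, zero_mul]

theorem red_eq_zero_iff {p : OddDen[X]} : red p = 0 ↔ ∃ q, p = 2 * q := by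
  refine ⟨fun h => ?_, fun ⟨q, hq⟩ => hq ▸ red_two_mul q⟩
  have h1 (i : ℕ) : ∃ y, p.coeff i = 2 * y :=
    residue_eq_zero_iff.mp (by rw [← coeff_red, h, coeff_zero])
  have h2 : C (2 : OddDen) ∣ p := (C_dvd_iff_dvd_coeff _ _).mpr fun i => by
    obtain ⟨y, hy⟩ := h1 i
    exact ⟨y, hy⟩
  obtain ⟨q, hq⟩ := h2
  exact ⟨q, by rwa [map_ofNat] at hq⟩

theorem exists_eq_pow_mul {b g P : OddDen[X]} (hb : red b ≠ 0) {i : ℕ} (h : b * g = 2 ^ i * P) :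
    ∃ g', g = 2 ^ i * g' ∧ b * g' = P := by
  induction i generalizing g P with
  | zero => exact ⟨g, by simp, by simpa using h⟩
  | succ i ih =>
    have h1 : red g = 0 := by
      have := congrArg red h
      rw [map_mul, red_two_pow_mul (by omega)] at this
      exact (mul_eq_zero.mp this).resolve_left hb
    obtain ⟨q, rfl⟩ := red_eq_zero_iff.mp h1
    have h2 : b * q = 2 ^ i * P := by
      apply mul_left_cancel₀ (two_ne_zero (α := OddDen[X]))
      linear_combination h
    obtain ⟨g', h3, h4⟩ := ih h2
    exact ⟨g', by rw [h3]; ring, h4⟩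

theorem exists_pow_mul_eq_toRat (p : ℚ[X]) : ∃ (i : ℕ) (q : OddDen[X]), 2 ^ i * p = toRat q := by
  induction p using Polynomial.induction_on' with
  | add p q hp hq =>
    obtain ⟨i, a, ha⟩ := hp
    obtain ⟨j, b, hb⟩ := hq
    refine ⟨i + j, 2 ^ j * a + 2 ^ i * b, ?_⟩
    rw [map_add, map_mul, map_mul, ← ha, ← hb]
    simp only [map_pow, map_ofNat]
    ring
  | monomial n a =>
    obtain ⟨i, hi⟩ := exists_pow_mul_mem a
    refine ⟨i, monomial n ⟨_, hi⟩, ?_⟩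
    rw [toRat, coe_mapRingHom, map_monomial, ← C_ofNat, ← C_pow, C_mul_monomial, Subring.subtype_apply]

theorem integral_or_exists (p : ℚ[X]) : (∃ q, p = toRat (2 * q)) ∨
    ∃ (i : ℕ) (q : OddDen[X]), 2 ^ i * p = toRat q ∧ red q ≠ 0 := by
  classical
  have hex := exists_pow_mul_eq_toRat p
  obtain ⟨i, ⟨q, hq⟩, hmin⟩ : ∃ i : ℕ, (∃ q, 2 ^ i * p = toRat q) ∧
      ∀ j < i, ¬ ∃ q, 2 ^ j * p = toRat q :=
    ⟨Nat.find hex, Nat.find_spec hex, fun j => Nat.find_min hex⟩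
  by_cases hr : red q = 0
  · left
    obtain ⟨s, rfl⟩ := red_eq_zero_iff.mp hr
    cases i with
    | zero => exact ⟨s, by rw [← hq, pow_zero, one_mul]⟩
    | succ i =>
      refine (hmin i (by omega) ⟨s, ?_⟩).elim
      apply mul_left_cancel₀ (two_ne_zero (α := ℚ[X]))
      rw [← mul_assoc, ← pow_succ', hq, map_mul, map_ofNat]
  · exact Or.inr ⟨_, q, hq, hr⟩

theorem exists_toRat_eq {b P : OddDen[X]} {g : ℚ[X]} (hb : red b ≠ 0)
    (h : toRat b * g = toRat P) : ∃ g', g = toRat g' ∧ b * g' = P := by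
  suffices ∃ g', g = toRat g' by
    obtain ⟨g', rfl⟩ := this
    exact ⟨g', rfl, toRat_injective (by rw [map_mul, h])⟩
  rcases integral_or_exists g with ⟨q, hq⟩ | ⟨i, q, hq, -⟩
  · exact ⟨_, hq⟩
  · have h1 : b * q = 2 ^ i * P := by
      apply toRat_injective
      rw [map_mul, map_mul, ← hq, ← h, map_pow, map_ofNat]
      ring
    obtain ⟨g', h2, -⟩ := exists_eq_pow_mul hb h1
    refine ⟨g', mul_left_cancel₀ (pow_ne_zero i (two_ne_zero (α := ℚ[X]))) ?_⟩
    rw [hq, h2, map_mul, map_pow, map_ofNat]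

theorem map_intCast_toRat (p : ℤ[X]) :
    toRat (p.map (Int.castRingHom OddDen)) = p.map (Int.castRingHom ℚ) := by
  rw [toRat, coe_mapRingHom, map_map]
  congr 1

theorem map_intCast_red (p : ℤ[X]) :
    red (p.map (Int.castRingHom OddDen)) = p.map (Int.castRingHom (ZMod 2)) := by
  rw [red, coe_mapRingHom, map_map]
  congr 1
  exact RingHom.ext_int _ _

end OddDen

theorem exists_int_primitive {p : ℚ[X]} (hp : p ≠ 0) : ∃ (c : ℚ) (q : ℤ[X]), c ≠ 0 ∧
    p = C c * q.map (Int.castRingHom ℚ) ∧ q.IsPrimitive := by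
  obtain ⟨b, hbm, hb⟩ := IsLocalization.integerNormalization_spec (nonZeroDivisors ℤ) p
  have hb0 : (b : ℚ) ≠ 0 := by exact_mod_cast nonZeroDivisors.ne_zero hbm
  set q := IsLocalization.integerNormalization (nonZeroDivisors ℤ) p
  have hq : q.map (Int.castRingHom ℚ) = C (b : ℚ) * p := by
    rw [← smul_eq_C_mul, Int.cast_smul_eq_zsmul]
    exact hb
  have hq0 : q ≠ 0 := by
    rintro h0
    rw [h0, Polynomial.map_zero] at hq
    exact mul_ne_zero (C_ne_zero.mpr hb0) hp hq.symm
  have hc0 : (q.content : ℚ) ≠ 0 := by exact_mod_cast (content_eq_zero_iff.not.mpr hq0)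
  refine ⟨q.content / b, q.primPart, by positivity, ?_, q.isPrimitive_primPart⟩
  rw [q.eq_C_content_mul_primPart, Polynomial.map_mul, map_C] at hq
  have h1 : C (b : ℚ) * p = C (b : ℚ) * (C ((q.content : ℚ) / b) *
      q.primPart.map (Int.castRingHom ℚ)) := by
    rw [← hq, ← mul_assoc, ← C_mul, mul_div_cancel₀ _ hb0]
    rfl
  exact mul_left_cancel₀ (C_ne_zero.mpr hb0) h1

theorem Polynomial.IsPrimitive.map_zmod_ne_zero {q : ℤ[X]} (hq : q.IsPrimitive) {p : ℕ}
    (hp : p.Prime) : q.map (Int.castRingHom (ZMod p)) ≠ 0 := by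
  intro h
  have h1 : C (p : ℤ) ∣ q := (C_dvd_iff_dvd_coeff _ _).mpr fun i => by
    have := congrArg (fun r => r.coeff i) h
    simpa [ZMod.intCast_zmod_eq_zero_iff_dvd] using this
  have := hq _ h1
  exact hp.one_lt.ne' (by simpa [Int.isUnit_iff_natAbs_eq] using this)

theorem OddDen.exists_primitive {p : ℚ[X]} (hp : p ≠ 0) :
    ∃ (c : ℚ) (q : OddDen[X]), c ≠ 0 ∧ p = C c * toRat q ∧ red q ≠ 0 := by
  obtain ⟨c, q, hc, h1, h2⟩ := exists_int_primitive hp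
  exact ⟨c, q.map (Int.castRingHom OddDen), hc, by rw [map_intCast_toRat, h1], by
    rw [map_intCast_red]; exact h2.map_zmod_ne_zero Nat.prime_two⟩

theorem ZMod.eq_one_of_ne_zero_two {a : ZMod 2} (h : a ≠ 0) : a = 1 := by
  revert a; decide

theorem Polynomial.eq_quadratic {S : Type*} [CommRing S] {p : S[X]} (h : p.natDegree ≤ 2) :
    p = C (p.coeff 0) + C (p.coeff 1) * X + C (p.coeff 2) * X ^ 2 := by
  conv_lhs => rw [p.as_sum_range' 3 (by omega)]
  simp [Finset.sum_range_succ, ← C_mul_X_pow_eq_monomial]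

theorem Polynomial.eq_linear {S : Type*} [CommRing S] {p : S[X]} (h : p.natDegree ≤ 1) :
    p = C (p.coeff 0) + C (p.coeff 1) * X := by
  conv_lhs => rw [p.as_sum_range' 2 (by omega)]
  simp [Finset.sum_range_succ, ← C_mul_X_pow_eq_monomial]

/-- `q` is not divisible by `l`, where `l` and `q` stand for binary forms of degree `1` and `2`. -/
def NotDvdForm (l q : (ZMod 2)[X]) : Prop :=
  (l = 1 ∧ q.coeff 2 = 1) ∨ (l = X ∧ q.eval 0 = 1) ∨ (l = X + 1 ∧ q.eval 1 = 1)

theorem natDegree_le_of_sq_eq_mul {F : Type*} [Field F] {b A n w : F[X]}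
    (hb : b.natDegree ≤ 2) (hb0 : 1 ≤ b.natDegree)
    (hn : n.natDegree ≤ 4) (h : A ^ 2 = b * n) (hw : A = b * w) : w.natDegree ≤ 1 := by
  by_cases hw0 : w = 0
  · simp [hw0]
  have hb' : b ≠ 0 := by rintro rfl; simp at hb0
  have h1 := congrArg natDegree hw
  rw [natDegree_mul hb' hw0] at h1
  have h2 := congrArg natDegree h
  rw [natDegree_pow] at h2
  have h3 := natDegree_mul_le (p := b) (q := n)
  omega

theorem exists_eq_sq_of_not_dvd {b A n : (ZMod 2)[X]} (hb0 : b ≠ 0) (hb : b.natDegree ≤ 2)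
    (hn : n.natDegree ≤ 4) (h : A ^ 2 = b * n)
    (hA : ∀ w : (ZMod 2)[X], w.natDegree ≤ 1 → A ≠ b * w) :
    ∃ l q, b = l ^ 2 ∧ A = l * q ∧ n = q ^ 2 ∧ q.natDegree ≤ 2 ∧ NotDvdForm l q := by
  by_cases h1 : b.coeff 1 = 0
  · have hbl : b = (C (b.coeff 0) + C (b.coeff 2) * X) ^ 2 := by
      have hf (a : ZMod 2) : a ^ 2 = a := by revert a; decide
      rw [CharTwo.add_sq, mul_pow, ← C_pow, ← C_pow, hf, hf]
      conv_lhs => rw [Polynomial.eq_quadratic hb, h1]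
      simp
    obtain ⟨l, hl, hl'⟩ : ∃ l : (ZMod 2)[X], b = l ^ 2 ∧ (l = 1 ∨ l = X ∨ l = X + 1) := by
      refine ⟨_, hbl, ?_⟩
      by_cases c0 : b.coeff 0 = 0
      · rw [c0] at hbl ⊢
        by_cases c2 : b.coeff 2 = 0
        · rw [c2] at hbl; simp at hbl; exact (hb0 hbl).elim
        · rw [ZMod.eq_one_of_ne_zero_two c2]; simp
      · rw [ZMod.eq_one_of_ne_zero_two c0]
        by_cases c2 : b.coeff 2 = 0
        · rw [c2]; simp
        · rw [ZMod.eq_one_of_ne_zero_two c2]; simp [add_comm]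
    clear hbl
    subst hl
    have hl0 : l ≠ 0 := by rintro rfl; simp at hb0
    obtain ⟨q, rfl⟩ : l ∣ A := by
      exact (IsIntegrallyClosed.pow_dvd_pow_iff (R := (ZMod 2)[X]) two_ne_zero).mp ⟨n, h⟩
    have hnq : n = q ^ 2 := by
      rw [mul_pow] at h
      exact (mul_left_cancel₀ (pow_ne_zero 2 hl0) h).symm
    have hq : q.natDegree ≤ 2 := by
      have := congrArg natDegree hnq
      rw [natDegree_pow] at this
      omega
    have hnd (w : (ZMod 2)[X]) (hw : w.natDegree ≤ 1) : q ≠ l * w := by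
      rintro rfl
      exact hA w hw (by ring)
    have hdeg {w : (ZMod 2)[X]} (hl : l.natDegree = 1) (hqw : q = l * w) : False := by
      refine hnd w ?_ hqw
      by_cases hw0 : w = 0
      · simp [hw0]
      rw [hqw, natDegree_mul hl0 hw0] at hq
      omega
    refine ⟨l, q, rfl, rfl, hnq, hq, ?_⟩
    rcases hl' with rfl | rfl | rfl
    · refine Or.inl ⟨rfl, ZMod.eq_one_of_ne_zero_two fun h0 => ?_⟩
      refine hnd q ?_ (one_mul q).symm
      rw [Polynomial.eq_quadratic hq, h0, C_0, zero_mul, add_zero]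
      compute_degree
    · refine Or.inr (Or.inl ⟨rfl, ZMod.eq_one_of_ne_zero_two fun h0 => ?_⟩)
      obtain ⟨w, hw⟩ := X_dvd_iff.mpr ((coeff_zero_eq_eval_zero q).trans h0)
      exact hdeg natDegree_X hw
    · refine Or.inr (Or.inr ⟨rfl, ZMod.eq_one_of_ne_zero_two fun h0 => ?_⟩)
      obtain ⟨w, hw⟩ := dvd_iff_isRoot.mpr h0
      have hX : X - C (1 : ZMod 2) = X + 1 := by
        rw [CharTwo.sub_eq_add, C_1]
      rw [hX] at hw
      exact hdeg (natDegree_X_add_C 1) hw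
  · exfalso
    have hsep : b.Separable := by
      rw [separable_def]
      have : derivative b = 1 := by
        rw [Polynomial.eq_quadratic hb, ZMod.eq_one_of_ne_zero_two h1]
        simp [CharTwo.add_self_eq_zero]
      rw [this]
      exact isCoprime_one_right
    obtain ⟨w, hw⟩ := (hsep.squarefree.dvd_pow_iff_dvd two_ne_zero).mp ⟨n, h⟩
    exact hA w (natDegree_le_of_sq_eq_mul hb (le_natDegree_of_ne_zero h1) hn h hw) hw

namespace NotDvdForm
variable {l q : (ZMod 2)[X]}

theorem ne_sq_eq_mul (h : NotDvdForm l q) (hq : q.natDegree ≤ 2) {s : (ZMod 2)[X]}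
    (hs : s.natDegree ≤ 3) : q ^ 2 ≠ l * s := by
  intro he
  rcases h with ⟨rfl, h⟩ | ⟨rfl, h⟩ | ⟨rfl, h⟩
  · have h1 := congrArg (fun p => p.coeff (2 * 2)) he
    simp only [one_mul, coeff_eq_zero_of_natDegree_lt (show s.natDegree < 2 * 2 by omega),
      coeff_pow_of_natDegree_le hq, h, one_pow, one_ne_zero] at h1
  · have h1 := congrArg (eval 0) he
    simp [h] at h1
  · have h1 := congrArg (eval 1) he
    simp [h, show (1 : ZMod 2) + 1 = 0 from rfl] at h1

theorem eq_of_mul_eq_mul (h : NotDvdForm l q) (hq : q.natDegree ≤ 2) {r v : (ZMod 2)[X]}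
    (hr0 : r ≠ 0) (hr : r.natDegree ≤ 1) (hv : v.natDegree ≤ 2) (he : q * r = l * v) : r = l := by
  rcases h with ⟨rfl, h⟩ | ⟨rfl, h⟩ | ⟨rfl, h⟩
  · have h1 := congrArg (fun p => p.coeff (2 + 1)) he
    simp only [one_mul, coeff_eq_zero_of_natDegree_lt (show v.natDegree < 2 + 1 by omega),
      coeff_mul_add_eq_of_natDegree_le hq hr, h] at h1
    have h2 := Polynomial.eq_linear hr
    rw [h1, C_0, zero_mul, add_zero] at h2
    rw [h2]
    have h3 : r.coeff 0 ≠ 0 := fun h0 => hr0 (by rw [h2, h0, C_0])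
    rw [ZMod.eq_one_of_ne_zero_two h3, C_1]
  · have h1 := congrArg (eval 0) he
    simp only [eval_mul, h, eval_X, one_mul, zero_mul] at h1
    have h2 := Polynomial.eq_linear hr
    rw [coeff_zero_eq_eval_zero, h1, C_0, zero_add] at h2
    have h3 : r.coeff 1 ≠ 0 := fun h0 => hr0 (by rw [h2, h0, C_0, zero_mul])
    rw [h2, ZMod.eq_one_of_ne_zero_two h3, C_1, one_mul]
  · have h1 := congrArg (eval 1) he
    simp only [eval_mul, h, eval_X, one_mul, eval_add, eval_one,
      show (1 : ZMod 2) + 1 = 0 from rfl, zero_mul] at h1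
    have h2 := Polynomial.eq_linear hr
    rw [h2] at h1
    simp only [eval_add, eval_mul, eval_C, eval_X, mul_one] at h1
    have h3 : r.coeff 0 = r.coeff 1 := by
      rwa [← CharTwo.sub_eq_add, sub_eq_zero] at h1
    have h4 : r.coeff 1 ≠ 0 := fun h0 => hr0 (by rw [h2, h3, h0, C_0, zero_mul, zero_add])
    rw [h2, h3, ZMod.eq_one_of_ne_zero_two h4, C_1, one_mul, add_comm]

theorem ne_add_eq (h : NotDvdForm l q) (hq : q.natDegree ≤ 2) {r g : (ZMod 2)[X]}
    (hr : r.natDegree ≤ 1) (hg : g.natDegree ≤ 2) : q ^ 2 + l * q * r ≠ l ^ 2 * g := by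
  intro he
  rw [add_comm] at he
  have hl : l.natDegree ≤ 1 := by
    rcases h with ⟨rfl, h⟩ | ⟨rfl, h⟩ | ⟨rfl, h⟩ <;> compute_degree!
  refine h.ne_sq_eq_mul hq (s := l * g - q * r) ?_ (by linear_combination he)
  refine natDegree_sub_le_of_le (natDegree_mul_le_of_le hl hg)
    (natDegree_mul_le_of_le hq hr) |>.trans (by norm_num)

end NotDvdForm

open OddDen

/-- A pair `(m, y)` describing a divisor class on the curve `y ^ 2 = sextic ℚ D`; here `m` and `y`
are binary forms of degree `2` and `3`. -/
structure IsPair (D : ℤ) (m y : ℚ[X]) : Prop where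
  ne_zero : m ≠ 0
  natDegree_left : m.natDegree ≤ 2
  natDegree_right : y.natDegree ≤ 3
  exists_eq_mul : ∃ n : ℚ[X], n.natDegree ≤ 4 ∧ y ^ 2 - sextic ℚ D = m * n

/-- The divisor class of `(m, y)` does not reduce to zero modulo `2`. -/
def HasReduction (m y : ℚ[X]) : Prop :=
  ∃ (Y : OddDen[X]) (w : ℚ[X]), w.natDegree ≤ 1 ∧ y = cubic ℚ + 2 * toRat Y + m * w

/-- `2 ^ j * y` is integral modulo `m`. -/
def IntegralUpTo (j : ℕ) (m y : ℚ[X]) : Prop :=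
  ∃ (A : OddDen[X]) (w : ℚ[X]), w.natDegree ≤ 1 ∧ 2 ^ j * y = toRat A + m * w

theorem natDegree_two_pow_mul {S : Type*} [CommRing S] [IsDomain S] [CharZero S] (i : ℕ)
    (p : S[X]) : (2 ^ i * p).natDegree = p.natDegree := by
  rw [show (2 ^ i : S[X]) = C (2 ^ i) by rw [C_pow, map_ofNat],
    natDegree_C_mul (pow_ne_zero i two_ne_zero)]

theorem natDegree_C_mul_sub_sq_le {m w : ℚ[X]} {κ : ℚ} (hm : m.natDegree ≤ 2)
    (hw : w.natDegree ≤ 1) : (C κ * m - w ^ 2).natDegree ≤ 2 :=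
  (natDegree_sub_le _ _).trans (max_le ((natDegree_C_mul_le _ _).trans hm)
    ((natDegree_pow_le_of_le 2 hw).trans (by norm_num)))

theorem HasReduction.of_C_mul {m y : ℚ[X]} {c : ℚ} (h : HasReduction (C c * m) y) :
    HasReduction m y := by
  obtain ⟨Y, w, hw, h⟩ := h
  exact ⟨Y, C c * w, (natDegree_C_mul_le _ _).trans hw, by rw [h]; ring⟩

theorem HasReduction.mul_C {m y : ℚ[X]} {c : ℚ} (hc : c ≠ 0) (h : HasReduction m y) :
    HasReduction (C c * m) y := by
  refine HasReduction.of_C_mul (c := c⁻¹) ?_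
  rwa [← mul_assoc, ← C_mul, inv_mul_cancel₀ hc, C_1, one_mul]

theorem IntegralUpTo.of_C_mul {j : ℕ} {m y : ℚ[X]} {c : ℚ} (h : IntegralUpTo j (C c * m) y) :
    IntegralUpTo j m y := by
  obtain ⟨A, w, hw, h⟩ := h
  exact ⟨A, C c * w, (natDegree_C_mul_le _ _).trans hw, by rw [h]; ring⟩

theorem IntegralUpTo.mul_C {j : ℕ} {m y : ℚ[X]} {c : ℚ} (hc : c ≠ 0) (h : IntegralUpTo j m y) :
    IntegralUpTo j (C c * m) y := by
  refine IntegralUpTo.of_C_mul (c := c⁻¹) ?_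
  rwa [← mul_assoc, ← C_mul, inv_mul_cancel₀ hc, C_1, one_mul]

theorem HasReduction.add_mul {m y w' : ℚ[X]} (hw' : w'.natDegree ≤ 1) (h : HasReduction m y) :
    HasReduction m (y + m * w') := by
  obtain ⟨Y, w, hw, h⟩ := h
  refine ⟨Y, w + w', natDegree_add_le_of_degree_le hw hw', ?_⟩
  rw [h]
  ring

theorem IntegralUpTo.add_mul {j : ℕ} {m y w' : ℚ[X]} (hw' : w'.natDegree ≤ 1)
    (h : IntegralUpTo j m y) : IntegralUpTo j m (y + m * w') := by
  obtain ⟨A, w, hw, h⟩ := h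
  refine ⟨A, w + 2 ^ j * w', natDegree_add_le_of_degree_le hw
    (by rwa [natDegree_two_pow_mul]), ?_⟩
  rw [mul_add, h]
  ring

theorem IntegralUpTo.mono {i j : ℕ} (hij : i ≤ j) {m y : ℚ[X]} (h : IntegralUpTo i m y) :
    IntegralUpTo j m y := by
  obtain ⟨A, w, hw, h⟩ := h
  obtain ⟨k, rfl⟩ := Nat.exists_eq_add_of_le hij
  refine ⟨2 ^ k * A, 2 ^ k * w, by rwa [natDegree_two_pow_mul], ?_⟩
  rw [pow_add, mul_comm (2 ^ i), mul_assoc, h, map_mul, map_pow, map_ofNat]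
  ring

theorem exists_integralUpTo (m y : ℚ[X]) : ∃ j, IntegralUpTo j m y := by
  obtain ⟨j, A, h⟩ := exists_pow_mul_eq_toRat y
  exact ⟨j, A, 0, by simp, by rw [h]; ring⟩

theorem not_cubic_mul_eq {w b g : (ZMod 2)[X]} (hw : w ≠ 0) (hb : b.natDegree ≤ 2)
    (hg : g.natDegree ≤ 2) : cubic (ZMod 2) * w ≠ b * g := by
  intro h
  have h0 : b * g ≠ 0 := h ▸ mul_ne_zero irreducible_cubic.ne_zero hw
  rcases irreducible_cubic.prime.dvd_or_dvd (Dvd.intro _ h) with hd | hd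
  · have := natDegree_le_of_dvd hd (left_ne_zero_of_mul h0)
    rw [cubic_natDegree] at this
    omega
  · have := natDegree_le_of_dvd hd (right_ne_zero_of_mul h0)
    rw [cubic_natDegree] at this
    omega

theorem HasReduction.of_half {D : ℤ} {m a b : ℚ[X]} {κ : ℚ} (hm : m.natDegree ≤ 2) (hb0 : b ≠ 0)
    (hb : b.natDegree ≤ 2) (h : a ^ 2 - sextic ℚ D = C κ * m * b ^ 2) (hr : HasReduction b a) :
    HasReduction m a := by
  obtain ⟨c, b, hc, rfl, hbr⟩ := exists_primitive hb0
  rw [natDegree_C_mul hc, natDegree_toRat] at hb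
  obtain ⟨Y, w, hw, ha⟩ := hr.of_C_mul
  obtain ⟨κ, h⟩ : ∃ κ : ℚ, a ^ 2 - sextic ℚ D = C κ * m * toRat b ^ 2 := ⟨κ * c ^ 2, by
    rw [h, C_mul, C_pow]; ring⟩
  let P : OddDen[X] := Y ^ 2 + cubic _ * Y -
    ((X ^ 2 + X) + ((D : OddDen[X]) - 1) * (X ^ 2 + X) ^ 2)
  have hP : toRat P = toRat Y ^ 2 + cubic ℚ * toRat Y -
    ((X ^ 2 + X) + ((D : ℚ[X]) - 1) * (X ^ 2 + X) ^ 2) := by simp [P]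
  have h1 : toRat b * (C κ * m * toRat b - w * (2 * (cubic ℚ + 2 * toRat Y) + toRat b * w)) =
      toRat (2 ^ 2 * P) := by
    rw [map_mul, hP, map_pow, map_ofNat]
    rw [sextic_eq, ha] at h
    linear_combination -h
  obtain ⟨g, hg, hg'⟩ := exists_toRat_eq hbr h1
  obtain ⟨N, rfl, hN⟩ := exists_eq_pow_mul hbr hg'
  rw [map_mul, map_pow, map_ofNat] at hg
  rcases integral_or_exists w with ⟨v, hv⟩ | ⟨i, w0, hw0, hw0r⟩
  · refine ⟨Y + b * v, 0, by simp, ?_⟩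
    rw [ha, hv, map_add, map_mul, map_mul, map_ofNat]
    ring
  exfalso
  have h2 : toRat b * (2 ^ i * (C κ * m - w ^ 2)) =
      toRat (2 ^ 1 * (2 ^ (i + 1) * N + (cubic _ + 2 * Y) * w0)) := by
    simp only [map_mul, map_add, map_pow, map_ofNat, ← hw0, toRat_cubic]
    linear_combination 2 ^ i * hg
  obtain ⟨g, hg2, hg2'⟩ := exists_toRat_eq hbr h2
  obtain ⟨g, rfl, hg3⟩ := exists_eq_pow_mul hbr hg2'
  have hgd : g.natDegree ≤ 2 := by
    have h3 := congrArg natDegree hg2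
    rw [natDegree_toRat, natDegree_two_pow_mul, natDegree_two_pow_mul] at h3
    rw [← h3]
    exact natDegree_C_mul_sub_sq_le hm hw
  have h4 := congrArg red hg3
  rw [map_mul, map_add, red_two_pow_mul (by omega), zero_add, map_mul, map_add, red_two_mul,
    add_zero, red_cubic] at h4
  exact not_cubic_mul_eq hw0r ((natDegree_red_le b).trans hb) ((natDegree_red_le g).trans hgd)
    h4.symm

theorem exists_int_lift {n : ℕ} (p : (ZMod n)[X]) :
    ∃ q : ℤ[X], q.map (Int.castRingHom (ZMod n)) = p ∧ q.natDegree ≤ p.natDegree := by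
  obtain ⟨q, hq, hd⟩ := exists_natDegree_eq_of_mem_lifts
    (mem_lifts_of_surjective (f := Int.castRingHom (ZMod n)) ZMod.intCast_surjective p)
  exact ⟨q, hq, hd.le⟩

theorem OddDen.exists_lift (p : (ZMod 2)[X]) :
    ∃ q : OddDen[X], red q = p ∧ q.natDegree ≤ p.natDegree := by
  obtain ⟨q, hq, hd⟩ := exists_int_lift p
  exact ⟨q.map (Int.castRingHom OddDen), by rw [map_intCast_red, hq], natDegree_map_le.trans hd⟩

theorem red_ne_mul_of_not_integralUpTo {k : ℕ} {y W : ℚ[X]} {A b : OddDen[X]}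
    (hW : W.natDegree ≤ 1) (h : 2 ^ (k + 1) * y = toRat A + toRat b * W)
    (hk : ¬ IntegralUpTo k (toRat b) y) {w : (ZMod 2)[X]} (hw : w.natDegree ≤ 1) :
    red A ≠ red b * w := by
  intro he
  obtain ⟨w, rfl, hd⟩ := OddDen.exists_lift w
  rw [← map_mul, ← sub_eq_zero, ← map_sub, red_eq_zero_iff] at he
  obtain ⟨B, hB⟩ := he
  obtain rfl : A = 2 * B + b * w := by linear_combination hB
  refine hk ⟨B, C (1 / 2) * (toRat w + W), (natDegree_C_mul_le _ _).trans
    (natDegree_add_le_of_degree_le (by rw [natDegree_toRat]; exact hd.trans hw) hW), ?_⟩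
  have h2 : (2 : ℚ[X]) * C (1 / 2) = 1 := by
    rw [← map_ofNat C, ← C_mul]; norm_num
  apply mul_left_cancel₀ (two_ne_zero (α := ℚ[X]))
  rw [map_add, map_mul, map_mul, map_ofNat] at h
  linear_combination h - toRat b * (toRat w + W) * h2

theorem not_integralUpTo_of_half {D : ℤ} {m a W : ℚ[X]} {A b : OddDen[X]} {κ : ℚ} {k : ℕ}
    (hm : m.natDegree ≤ 2) (ha : a.natDegree ≤ 3) (hb : b.natDegree ≤ 2) (hbr : red b ≠ 0)
    (h : a ^ 2 - sextic ℚ D = C κ * m * toRat b ^ 2) (hW : W.natDegree ≤ 1)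
    (hA : 2 ^ (k + 1) * a = toRat A + toRat b * W) (hk : ¬ IntegralUpTo k (toRat b) a) :
    ¬ IntegralUpTo (k + 1) m a := by
  obtain ⟨κ', hκ⟩ : ∃ κ' : ℚ, C κ' = (2 ^ (k + 1)) ^ 2 * C κ :=
    ⟨(2 ^ (k + 1)) ^ 2 * κ, by simp only [C_mul, C_pow, map_ofNat]⟩
  have hAd : A.natDegree ≤ 3 := by
    rw [← natDegree_toRat, eq_sub_of_add_eq hA.symm]
    refine (natDegree_sub_le _ _).trans (max_le (by rwa [natDegree_two_pow_mul]) ?_)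
    exact natDegree_mul_le_of_le ((natDegree_toRat b).le.trans hb) hW
  have h1 : toRat b * (C κ' * m * toRat b - 2 * toRat A * W - toRat b * W ^ 2) =
      toRat (A ^ 2 - (2 ^ (k + 1)) ^ 2 * sextic _ D) := by
    simp only [map_mul, map_sub, map_pow, map_ofNat, toRat_sextic, hκ]
    linear_combination -(2 ^ (k + 1)) ^ 2 * h + (2 ^ (k + 1) * a + toRat A + toRat b * W) * hA
  obtain ⟨n, hn, hbn⟩ := exists_toRat_eq hbr h1
  have hnd : n.natDegree ≤ 4 := by
    rw [← natDegree_toRat, ← hn]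
    refine (natDegree_sub_le _ _).trans (max_le ((natDegree_sub_le _ _).trans (max_le ?_ ?_)) ?_)
    · rw [mul_assoc]
      exact (natDegree_C_mul_le _ _).trans (natDegree_mul_le_of_le hm
        ((natDegree_toRat b).le.trans hb))
    · rw [mul_assoc, ← pow_one (2 : ℚ[X]), natDegree_two_pow_mul]
      exact natDegree_mul_le_of_le ((natDegree_toRat A).le.trans hAd) hW
    · exact natDegree_mul_le_of_le ((natDegree_toRat b).le.trans hb) (natDegree_pow_le_of_le 2 hW)
  have hred : red A ^ 2 = red b * red n := by
    rw [← map_mul, hbn, map_sub, map_pow, ← pow_mul, red_two_pow_mul (by omega), sub_zero]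
  obtain ⟨l, q, hbl, hAl, hnq, hqd, hlq⟩ := exists_eq_sq_of_not_dvd hbr
    ((natDegree_red_le b).trans hb) ((natDegree_red_le n).trans hnd) hred
    fun w hw => red_ne_mul_of_not_integralUpTo hW hA hk hw
  have hl0 : l ≠ 0 := by rintro rfl; simp [hbl] at hbr
  have h2W : ¬ ∃ r, 2 * W = toRat r := by
    rintro ⟨r, hr⟩
    have h2 : toRat b * (C κ' * m - W ^ 2) = toRat (n + A * r) := by
      rw [map_add, map_mul, ← hn, ← hr]
      ring
    obtain ⟨g, hg, hg'⟩ := exists_toRat_eq hbr h2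
    have hgd : g.natDegree ≤ 2 := by
      rw [← natDegree_toRat, ← hg]
      exact natDegree_C_mul_sub_sq_le hm hW
    have hrd : r.natDegree ≤ 1 := by
      rwa [← natDegree_toRat, ← hr, ← pow_one (2 : ℚ[X]), natDegree_two_pow_mul]
    have h3 := congrArg red hg'
    rw [map_mul, map_add, map_mul, hbl, hAl, hnq] at h3
    exact hlq.ne_add_eq hqd ((natDegree_red_le r).trans hrd) ((natDegree_red_le g).trans hgd)
      h3.symm
  obtain ⟨i, r, hr, hr0⟩ : ∃ (i : ℕ) (r : OddDen[X]), 2 ^ (i + 2) * W = toRat r ∧ red r ≠ 0 := by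
    rcases integral_or_exists W with ⟨r, hr⟩ | ⟨i, r, hr, hr0⟩
    · exact (h2W ⟨2 * (2 * r), by rw [hr, map_mul (f := toRat) 2 (2 * r), map_ofNat]⟩).elim
    · match i, hr with
      | 0, hr => exact (h2W ⟨2 * r, by rw [map_mul, map_ofNat, ← hr]; ring⟩).elim
      | 1, hr => exact (h2W ⟨r, by rw [← hr]; ring⟩).elim
      | i + 2, hr => exact ⟨i, r, hr, hr0⟩
  have hrd : r.natDegree ≤ 1 := by
    rwa [← natDegree_toRat, ← hr, natDegree_two_pow_mul]
  have h2 : toRat b * (2 ^ (i + 1) * (C κ' * m - W ^ 2)) = toRat (2 ^ (i + 1) * n + A * r) := by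
    simp only [map_add, map_mul, map_pow, map_ofNat, ← hn, ← hr]
    ring
  obtain ⟨v, hv, hbv⟩ := exists_toRat_eq hbr h2
  have hvd : v.natDegree ≤ 2 := by
    rw [← natDegree_toRat, ← hv, natDegree_two_pow_mul]
    exact natDegree_C_mul_sub_sq_le hm hW
  have hrl : red r = l := by
    have h3 := congrArg red hbv
    rw [map_mul red b v, map_add, red_two_pow_mul (by omega), zero_add, map_mul, hbl, hAl] at h3
    refine hlq.eq_of_mul_eq_mul hqd hr0 ((natDegree_red_le r).trans hrd)
      ((natDegree_red_le v).trans hvd) (mul_left_cancel₀ hl0 ?_)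
    linear_combination -h3
  have hM : C (2 ^ (2 * (i + 2)) * κ') * m = toRat (r ^ 2 + 2 ^ (i + 3) * v) := by
    simp only [map_add, map_mul, map_pow, map_ofNat, ← hr, ← hv]
    ring
  have hMr : red (r ^ 2 + 2 ^ (i + 3) * v) ≠ 0 := by
    rw [map_add, red_two_pow_mul (by omega), map_pow, add_zero]
    exact pow_ne_zero 2 hr0
  intro h_int
  have hc0 : (2 ^ (2 * (i + 2)) * κ') ≠ 0 := by
    intro h0
    rw [h0, C_0, zero_mul] at hM
    rw [← map_zero toRat, toRat_inj] at hM
    rw [← hM, map_zero] at hMr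
    exact hMr rfl
  have h_int' := h_int.mul_C hc0
  rw [hM] at h_int'
  obtain ⟨B, z, hz, hB⟩ := h_int'
  have h4 : toRat (r ^ 2 + 2 ^ (i + 3) * v) * (2 ^ (i + 2) * z) =
      toRat (2 ^ (i + 2) * (A - B) + b * r) := by
    rw [map_add _ (2 ^ (i + 2) * (A - B)), map_mul _ b, ← hr, map_mul, map_pow, map_ofNat, map_sub]
    linear_combination 2 ^ (i + 2) * hA - 2 ^ (i + 2) * hB
  obtain ⟨z0, hz0, hMz⟩ := exists_toRat_eq hMr h4
  have hz0d : z0.natDegree ≤ 1 := by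
    rwa [← natDegree_toRat, ← hz0, natDegree_two_pow_mul]
  have h5 : r * (b - r * z0) = 2 ^ (i + 2) * (2 * v * z0 - A + B) := by
    linear_combination -hMz
  obtain ⟨g, hg, -⟩ := exists_eq_pow_mul hr0 h5
  have hgd : g.natDegree ≤ 2 := by
    rw [← natDegree_two_pow_mul (i + 2) g, ← hg]
    exact (natDegree_sub_le _ _).trans (max_le hb (natDegree_mul_le_of_le hrd hz0d))
  have h6 : r * (z0 * v - A) = 2 ^ (i + 1) * (n - 2 * (g * v)) := by
    linear_combination hbv - v * hg
  obtain ⟨s, hs, hrs⟩ := exists_eq_pow_mul hr0 h6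
  have hsd : s.natDegree ≤ 3 := by
    rw [← natDegree_two_pow_mul (i + 1) s, ← hs]
    exact (natDegree_sub_le _ _).trans (max_le (natDegree_mul_le_of_le hz0d hvd) hAd)
  have h7 := congrArg red hrs
  rw [map_mul, map_sub, red_two_mul, sub_zero, hrl, hnq] at h7
  exact hlq.ne_sq_eq_mul hqd ((natDegree_red_le s).trans hsd) h7.symm

theorem IntegralUpTo.half {D : ℤ} {m a b : ℚ[X]} {κ : ℚ} {j : ℕ} (hm : m.natDegree ≤ 2)
    (ha : a.natDegree ≤ 3) (hb0 : b ≠ 0) (hb : b.natDegree ≤ 2)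
    (h : a ^ 2 - sextic ℚ D = C κ * m * b ^ 2) (hba : ¬ IntegralUpTo 0 b a)
    (hj : IntegralUpTo (j + 1) m a) : IntegralUpTo j b a := by
  classical
  obtain ⟨c, b, hc, rfl, hbr⟩ := exists_primitive hb0
  rw [natDegree_C_mul hc, natDegree_toRat] at hb
  have hex := exists_integralUpTo (toRat b) a
  obtain ⟨k, hk, hmin⟩ : ∃ k, IntegralUpTo k (toRat b) a ∧
      ∀ i < k, ¬ IntegralUpTo i (toRat b) a :=
    ⟨Nat.find hex, Nat.find_spec hex, fun i => Nat.find_min hex⟩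
  cases k with
  | zero => exact (hba (hk.mul_C hc)).elim
  | succ k =>
    by_cases hkj : k + 1 ≤ j
    · exact (hk.mono hkj).mul_C hc
    · obtain ⟨A, W, hW, hA⟩ := hk
      refine (not_integralUpTo_of_half (D := D) (κ := κ * c ^ 2) hm ha hb hbr ?_ hW hA
        (hmin k (by omega)) (hj.mono (by omega))).elim
      rw [h, Polynomial.C_mul, C_pow]
      ring

theorem exists_eq_C_mul_of_map_eq_zero {p : ℕ} {P : ℤ[X]}
    (h : P.map (Int.castRingHom (ZMod p)) = 0) : ∃ Q, P = C (p : ℤ) * Q := by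
  refine (C_dvd_iff_dvd_coeff _ _).mpr fun i => ?_
  have h1 := congrArg (fun r => r.coeff i) h
  rwa [coeff_map, coeff_zero, eq_intCast, ZMod.intCast_zmod_eq_zero_iff_dvd] at h1

theorem NotDvdForm.coeff_eq {l q m n : (ZMod 2)[X]} {δ : ZMod 2} (h : NotDvdForm l q)
    (hq : q.natDegree ≤ 2) (hm : m.natDegree ≤ 2) (hn : n.natDegree ≤ 4)
    (he : l ^ 2 * n + m * q ^ 2 = C δ * cubic _ * l * q) :
    m.coeff 1 = δ ∧ ((l = 1 ∧ m.coeff 2 = 0) ∨ (l = X ∧ m.coeff 0 = 0) ∨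
      (l = X + 1 ∧ m.coeff 0 + m.coeff 1 + m.coeff 2 = 0)) := by
  have hc : (cubic (ZMod 2)).natDegree ≤ 3 := cubic_natDegree.le
  have hc' : (C δ * cubic (ZMod 2)).natDegree ≤ 3 := (natDegree_C_mul_le _ _).trans hc
  have hq2 : (q ^ 2).natDegree ≤ 4 := natDegree_pow_le_of_le 2 hq
  have hsq (p : (ZMod 2)[X]) : derivative (p ^ 2) = 0 := by
    rw [sq, derivative_mul, mul_comm, CharTwo.add_self_eq_zero]
  rcases h with ⟨rfl, h⟩ | ⟨rfl, h⟩ | ⟨rfl, h⟩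
  · simp only [one_pow, one_mul, mul_one] at he
    have hq4 : (q ^ 2).coeff 4 = 1 := by
      rw [show 4 = 2 * 2 from rfl, coeff_pow_of_natDegree_le hq, h, one_pow]
    have h6 := congrArg (fun p => p.coeff (2 + 4)) he
    simp only [coeff_add, coeff_eq_zero_of_natDegree_lt (show n.natDegree < 2 + 4 by omega),
      coeff_mul_add_eq_of_natDegree_le hm hq2, hq4, mul_one, zero_add] at h6
    rw [coeff_eq_zero_of_natDegree_lt
      (lt_of_le_of_lt (natDegree_mul_le_of_le hc' hq) (by norm_num))] at h6
    have hm1 : m.natDegree ≤ 1 := by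
      rw [Polynomial.eq_quadratic hm, h6]
      simp only [C_0, zero_mul, add_zero]
      compute_degree
    have h5 := congrArg (fun p => p.coeff (1 + 4)) he
    simp only [coeff_add, coeff_eq_zero_of_natDegree_lt (show n.natDegree < 1 + 4 by omega),
      coeff_mul_add_eq_of_natDegree_le hm1 hq2, hq4, mul_one, zero_add] at h5
    rw [show 1 + 4 = 3 + 2 from rfl, coeff_mul_add_eq_of_natDegree_le hc' hq, h, coeff_C_mul] at h5
    refine ⟨?_, Or.inl ⟨rfl, h6⟩⟩
    rw [h5, cubic]
    simp [coeff_one, coeff_X_pow]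
  · have h0 := congrArg (eval 0) he
    simp [h, ← coeff_zero_eq_eval_zero] at h0
    have h1 := congrArg (eval 0) (congrArg derivative he)
    simp [h, derivative_mul, cubic, hsq] at h1
    rw [Polynomial.eq_quadratic hm] at h1
    simp at h1
    exact ⟨h1, Or.inr (Or.inl ⟨rfl, h0⟩)⟩
  · have h0 := congrArg (eval 1) he
    simp [h, show (1 : ZMod 2) + 1 = 0 from rfl] at h0
    have h1 := congrArg (eval 1) (congrArg derivative he)
    simp [h, derivative_mul, cubic, hsq, show (1 : ZMod 2) + 1 = 0 from rfl] at h1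
    rw [Polynomial.eq_quadratic hm] at h0 h1
    simp [show (1 : ZMod 2) + 1 = 0 from rfl] at h1 h0
    exact ⟨h1, Or.inr (Or.inr ⟨rfl, h0⟩)⟩

theorem coordModEq_iff {a b c a' b' c' : ℤ} :
    SexticField.CoordModEq 4 ![a, b, c, 0, 0, 0] ![a', b', c', 0, 0, 0] ↔
      4 ∣ a - a' ∧ 4 ∣ b - b' ∧ 4 ∣ c - c' := by
  simp [SexticField.CoordModEq, Fin.forall_fin_succ]

theorem exists_coordModEq {m n B r : ℤ[X]} {d : ℤ} (hm : m.natDegree ≤ 2) (hn : n.natDegree ≤ 4)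
    (h : B ^ 2 + 2 * C d * cubic _ * B - 4 * r = m * n)
    (hm0 : m.map (Int.castRingHom (ZMod 2)) ≠ 0)
    (hB : ∀ w : (ZMod 2)[X], w.natDegree ≤ 1 →
      B.map (Int.castRingHom (ZMod 2)) ≠ m.map (Int.castRingHom (ZMod 2)) * w) :
    (Even d ∧ ∃ t ∈ SexticField.squareTargets,
      SexticField.CoordModEq 4 ![m.coeff 0, m.coeff 1, m.coeff 2, 0, 0, 0] t ∨
      SexticField.CoordModEq 4 ![(-m).coeff 0, (-m).coeff 1, (-m).coeff 2, 0, 0, 0] t) ∨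
    ∃ t ∈ SexticField.twistedTargets,
      SexticField.CoordModEq 4 ![m.coeff 0, m.coeff 1, m.coeff 2, 0, 0, 0] t := by
  let φ := mapRingHom (Int.castRingHom (ZMod 2))
  have h2 : φ 2 = 0 := by rw [map_ofNat]; exact CharTwo.two_eq_zero
  have hdiv {P : ℤ[X]} (hP : φ P = 0) : ∃ Q, P = 2 * Q := by
    obtain ⟨Q, hQ⟩ := exists_eq_C_mul_of_map_eq_zero hP
    exact ⟨Q, by rw [hQ]; simp⟩
  have hsq : φ B ^ 2 = φ m * φ n := by
    rw [← map_mul, ← h]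
    simp only [map_sub, map_add, map_mul, map_pow, show (4 : ℤ[X]) = 2 * 2 by norm_num, h2]
    ring
  obtain ⟨l, q, hml, hBl, hnq, hqd, hlq⟩ := exists_eq_sq_of_not_dvd hm0
    (natDegree_map_le.trans hm) (natDegree_map_le.trans hn) hsq hB
  change φ m = _ at hml
  change φ B = _ at hBl
  change φ n = _ at hnq
  have hX1 : (X : (ZMod 2)[X]) ≠ 1 := fun h => by simpa using congrArg (eval 0) h
  obtain ⟨L, hL, hLd⟩ : ∃ L : ℤ[X], φ L = l ∧ ((l = 1 → L = 1) ∧ (l = X → L = X) ∧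
      (l = X + 1 → L = X + 1)) := by
    rcases hlq with ⟨rfl, -⟩ | ⟨rfl, -⟩ | ⟨rfl, -⟩
    · exact ⟨1, by simp [φ], by simp [hX1.symm]⟩
    · exact ⟨X, by simp [φ], by simp [hX1]⟩
    · exact ⟨X + 1, by simp [φ], by simp⟩
  obtain ⟨Q, hQ, hQd⟩ := exists_int_lift q
  change φ Q = q at hQ
  obtain ⟨M, hM⟩ := hdiv (P := m - L ^ 2) (by rw [map_sub, map_pow, hL, hml, sub_self])
  obtain ⟨N, hN⟩ := hdiv (P := n - Q ^ 2) (by rw [map_sub, map_pow, hQ, hnq, sub_self])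
  obtain ⟨B', hB'⟩ := hdiv (P := B - L * Q) (by rw [map_sub, map_mul, hL, hQ, hBl, sub_self])
  have hLd1 : L.natDegree ≤ 1 := by
    rcases hlq with ⟨hl, -⟩ | ⟨hl, -⟩ | ⟨hl, -⟩
    · rw [hLd.1 hl]; simp
    · rw [hLd.2.1 hl]; simp
    · rw [hLd.2.2 hl]; compute_degree
  have hMd : M.natDegree ≤ 2 := by
    rw [← natDegree_two_pow_mul 1, pow_one, ← hM]
    exact (natDegree_sub_le _ _).trans (max_le hm (natDegree_pow_le_of_le 2 hLd1))
  have hNd : N.natDegree ≤ 4 := by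
    rw [← natDegree_two_pow_mul 1, pow_one, ← hN]
    exact (natDegree_sub_le _ _).trans (max_le hn (natDegree_pow_le_of_le 2 (hQd.trans hqd)))
  have hkey : φ (L ^ 2 * N + M * Q ^ 2) = φ (C d * cubic _ * L * Q) := by
    have : L ^ 2 * N + M * Q ^ 2 = C d * cubic _ * L * Q + 2 * (B' * L * Q + B' ^ 2 +
        C d * cubic _ * B' - r - M * N) := by
      apply mul_left_cancel₀ (two_ne_zero (α := ℤ[X]))
      linear_combination -h - m * hN - Q ^ 2 * hM + (B + L * Q + 2 * B' + 2 * C d * cubic _) * hB'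
        - 2 * N * hM
    rw [this, map_add, map_mul φ 2, h2, zero_mul, add_zero]
  simp only [map_add, map_mul, map_pow, hL, hQ] at hkey
  rw [show φ (C d) = C (d : ZMod 2) by simp [φ], show φ (cubic ℤ) = cubic _ from map_cubic _] at hkey
  obtain ⟨h1, h3⟩ := hlq.coeff_eq hqd (natDegree_map_le.trans hMd) (natDegree_map_le.trans hNd) hkey
  simp only [coeff_map, eq_intCast] at h1 h3
  rw [← sub_eq_zero] at h1
  norm_cast at h1 h3
  simp only [ZMod.intCast_eq_zero_iff_even, Int.even_iff] at h1 h3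
  have hmc (i : ℕ) : m.coeff i = (L ^ 2).coeff i + 2 * M.coeff i := by
    rw [eq_add_of_sub_eq' hM, coeff_add, coeff_ofNat_mul]
  have hX2 : ((X : ℤ[X]) + 1) ^ 2 = X ^ 2 + 2 * X + 1 := by ring
  have c0 := hmc 0
  have c1 := hmc 1
  have c2 := hmc 2
  rw [Int.even_iff]
  simp only [SexticField.squareTargets, SexticField.twistedTargets, List.mem_cons,
    List.not_mem_nil, or_false, exists_eq_or_imp, exists_eq_left, coordModEq_iff, coeff_neg]
  rcases h3 with ⟨hl, h3⟩ | ⟨hl, h3⟩ | ⟨hl, h3⟩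
  · rw [hLd.1 hl] at c0 c1 c2
    simp [coeff_one] at c0 c1 c2
    rcases Int.emod_two_eq_zero_or_one d with hd | hd <;>
      rcases Int.emod_two_eq_zero_or_one (M.coeff 0) with hM0 | hM0
    · exact Or.inl ⟨hd, Or.inl (Or.inl (by omega))⟩
    · exact Or.inl ⟨hd, Or.inl (Or.inr (by omega))⟩
    · exact Or.inr (Or.inl (by omega))
    · exact Or.inr (Or.inr (Or.inl (by omega)))
  · rw [hLd.2.1 hl] at c0 c1 c2
    simp [coeff_X_pow] at c0 c1 c2
    rcases Int.emod_two_eq_zero_or_one d with hd | hd <;>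
      rcases Int.emod_two_eq_zero_or_one (M.coeff 2) with hM0 | hM0
    · exact Or.inl ⟨hd, Or.inr (Or.inl (Or.inl (by omega)))⟩
    · exact Or.inl ⟨hd, Or.inr (Or.inl (Or.inr (by omega)))⟩
    · exact Or.inr (Or.inr (Or.inr (Or.inl (by omega))))
    · exact Or.inr (Or.inr (Or.inr (Or.inr (Or.inl (by omega)))))
  · rw [hLd.2.2 hl, hX2] at c0 c1 c2
    simp [coeff_X_pow, coeff_one, coeff_X] at c0 c1 c2
    rcases Int.emod_two_eq_zero_or_one d with hd | hd <;>
      rcases Int.emod_two_eq_zero_or_one (M.coeff 0) with hM0 | hM0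
    · exact Or.inl ⟨hd, Or.inr (Or.inr (Or.inl (by omega)))⟩
    · exact Or.inl ⟨hd, Or.inr (Or.inr (Or.inr (by omega)))⟩
    · exact Or.inr (Or.inr (Or.inr (Or.inr (Or.inr (Or.inr (by omega))))))
    · exact Or.inr (Or.inr (Or.inr (Or.inr (Or.inr (Or.inl (by omega))))))

theorem isCoprime_of_sq_eq_mul {F : Type*} [Field F] {m A n : F[X]} (hm0 : m ≠ 0)
    (hm : m.natDegree ≤ 2) (hn : n.natDegree ≤ 4) (h : A ^ 2 = m * n)
    (hA : ∀ w : F[X], w.natDegree ≤ 1 → A ≠ m * w) : IsCoprime m n := by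
  refine isCoprime_of_irreducible_dvd (fun h0 => hm0 h0.1) fun g hg hgm hgn => ?_
  obtain ⟨l, rfl⟩ := hgm
  obtain ⟨n, rfl⟩ := hgn
  have hg0 := hg.ne_zero
  have hgd := hg.natDegree_pos
  obtain ⟨A, rfl⟩ : g ∣ A := hg.prime.dvd_of_dvd_pow ⟨l * (g * n), by rw [h]; ring⟩
  have hl0 : l ≠ 0 := right_ne_zero_of_mul hm0
  have h1 : A ^ 2 = l * n := mul_left_cancel₀ (pow_ne_zero 2 hg0) (by linear_combination h)
  have hd : g.natDegree + l.natDegree = (g * l).natDegree := (natDegree_mul hg0 hl0).symm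
  obtain ⟨w, rfl⟩ : l ∣ A := by
    rcases Nat.eq_zero_or_pos l.natDegree with h0 | h0
    · exact (isUnit_iff_degree_eq_zero.mpr (by
        rw [degree_eq_natDegree hl0, h0]; rfl)).dvd
    · exact (irreducible_of_degree_eq_one (by
        rw [degree_eq_natDegree hl0, show l.natDegree = 1 by omega]; rfl)).prime.dvd_of_dvd_pow
        ⟨n, h1⟩
  exact hA w (natDegree_le_of_sq_eq_mul hm (by omega) hn h (by ring)) (by ring)

/-- The denominator of `y` modulo `m` can be chosen minimal. -/
theorem exists_minimal_denominator (m : ℤ[X]) (y : ℚ[X]) :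
    ∃ (e : ℕ) (A : ℤ[X]) (w : ℚ[X]), e ≠ 0 ∧ w.natDegree ≤ 1 ∧
      C (e : ℚ) * y = A.map (Int.castRingHom ℚ) + m.map (Int.castRingHom ℚ) * w ∧
      ∀ p : ℕ, p.Prime → (p : ℤ) ∣ e → ∀ v : (ZMod p)[X], v.natDegree ≤ 1 →
        A.map (Int.castRingHom (ZMod p)) ≠ m.map (Int.castRingHom (ZMod p)) * v := by
  classical
  let P (e : ℕ) : Prop := e ≠ 0 ∧ ∃ (A : ℤ[X]) (w : ℚ[X]), w.natDegree ≤ 1 ∧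
    C (e : ℚ) * y = A.map (Int.castRingHom ℚ) + m.map (Int.castRingHom ℚ) * w
  have hex : ∃ e, P e := by
    by_cases hy : y = 0
    · exact ⟨1, one_ne_zero, 0, 0, by simp, by simp [hy]⟩
    obtain ⟨c, q, hc, rfl, -⟩ := exists_int_primitive hy
    refine ⟨c.den, c.den_ne_zero, C c.num * q, 0, by simp, ?_⟩
    rw [← mul_assoc, ← C_mul, mul_comm (c.den : ℚ), Rat.mul_den_eq_num]
    simp
  obtain ⟨e, ⟨he, A, w, hw, h⟩, hmin⟩ : ∃ e, P e ∧ ∀ i < e, ¬ P i :=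
    ⟨Nat.find hex, Nat.find_spec hex, fun i => Nat.find_min hex⟩
  refine ⟨e, A, w, he, hw, h, fun p hp hpe v hv hA => ?_⟩
  obtain ⟨v, rfl, hvd⟩ := exists_int_lift v
  rw [← Polynomial.map_mul, ← sub_eq_zero, ← Polynomial.map_sub] at hA
  obtain ⟨B, hB⟩ := exists_eq_C_mul_of_map_eq_zero hA
  obtain ⟨k, rfl⟩ := Int.natCast_dvd_natCast.mp hpe
  have hp0 : (p : ℚ) ≠ 0 := by exact_mod_cast hp.ne_zero
  have hk0 : k ≠ 0 := right_ne_zero_of_mul he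
  refine hmin k ?_ ⟨hk0, B, C (p : ℚ)⁻¹ * (v.map (Int.castRingHom ℚ) + w), ?_, ?_⟩
  · have := hp.one_lt
    nlinarith [Nat.pos_of_ne_zero hk0]
  · exact (natDegree_C_mul_le _ _).trans (natDegree_add_le_of_degree_le
      (natDegree_map_le.trans (hvd.trans hv)) hw)
  · have h1 : C (p : ℚ) * C (p : ℚ)⁻¹ = 1 := by rw [← C_mul, mul_inv_cancel₀ hp0, C_1]
    have h2 := congrArg (Polynomial.map (Int.castRingHom ℚ)) hB
    simp only [Polynomial.map_sub, Polynomial.map_mul, Polynomial.map_C, Int.coe_castRingHom,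
      Int.cast_natCast] at h2
    rw [Nat.cast_mul, C_mul] at h
    apply mul_left_cancel₀ (C_ne_zero.mpr hp0)
    linear_combination h + h2 - m.map (Int.castRingHom ℚ) * (v.map (Int.castRingHom ℚ) + w) * h1

theorem exists_int_cofactor {D : ℤ} {m A : ℤ[X]} {y w n : ℚ[X]} {e : ℕ} {c : ℚ}
    (hm : m.IsPrimitive) (hm2 : m.natDegree ≤ 2) (hy : y.natDegree ≤ 3) (hw : w.natDegree ≤ 1)
    (hn : n.natDegree ≤ 4)
    (h : y ^ 2 - sextic ℚ D = C c * m.map (Int.castRingHom ℚ) * n)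
    (hA : C (e : ℚ) * y = A.map (Int.castRingHom ℚ) + m.map (Int.castRingHom ℚ) * w) :
    A.natDegree ≤ 3 ∧ ∃ N : ℤ[X], N.natDegree ≤ 4 ∧ A ^ 2 - C ((e : ℤ) ^ 2) * sextic ℤ D = m * N := by
  have hdeg (P : ℤ[X]) : (P.map (Int.castRingHom ℚ)).natDegree = P.natDegree :=
    natDegree_map_eq_of_injective (RingHom.injective_int _) P
  have hAd : A.natDegree ≤ 3 := by
    rw [← hdeg, eq_sub_of_add_eq hA.symm]
    exact (natDegree_sub_le _ _).trans (max_le ((natDegree_C_mul_le _ _).trans hy)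
      (natDegree_mul_le_of_le ((hdeg m).le.trans hm2) hw))
  have hq : (A ^ 2 - C ((e : ℤ) ^ 2) * sextic ℤ D).map (Int.castRingHom ℚ) =
      m.map (Int.castRingHom ℚ) * (C ((e : ℚ) ^ 2 * c) * n - C 2 * (A.map (Int.castRingHom ℚ) * w) -
        m.map (Int.castRingHom ℚ) * w ^ 2) := by
    simp only [Polynomial.map_sub, Polynomial.map_pow, Polynomial.map_mul, Polynomial.map_C,
      map_sextic, Int.coe_castRingHom, C_mul, C_pow, Int.cast_natCast, map_ofNat]
    linear_combination C (e : ℚ) ^ 2 * h - (C (e : ℚ) * y + A.map (Int.castRingHom ℚ) +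
      m.map (Int.castRingHom ℚ) * w) * hA
  obtain ⟨N, hN⟩ := (IsPrimitive.Int.dvd_iff_map_cast_dvd_map_cast m _ hm).mpr ⟨_, hq⟩
  refine ⟨hAd, N, ?_, hN⟩
  rw [hN, Polynomial.map_mul] at hq
  have hm0 : m.map (Int.castRingHom ℚ) ≠ 0 :=
    (Polynomial.map_ne_zero_iff (RingHom.injective_int _)).mpr hm.ne_zero
  rw [← hdeg, mul_left_cancel₀ hm0 hq]
  refine (natDegree_sub_le _ _).trans (max_le ((natDegree_sub_le _ _).trans (max_le ?_ ?_)) ?_)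
  · exact (natDegree_C_mul_le _ _).trans hn
  · exact (natDegree_C_mul_le _ _).trans (natDegree_mul_le_of_le ((hdeg A).le.trans hAd) hw)
  · exact natDegree_mul_le_of_le ((hdeg m).le.trans hm2) (natDegree_pow_le_of_le 2 hw)

theorem ne_zero_of_sq_sub_eq {D : ℤ} (hD : 0 < D) {A m n : ℤ[X]} {e : ℤ} (he : e ≠ 0)
    (hm : m.natDegree ≤ 2) (hn : n.natDegree ≤ 4)
    (h : A ^ 2 - C (e ^ 2) * sextic ℤ D = m * n) : A ≠ 0 := by
  rintro rfl
  have he2 : (e : ℚ) ^ 2 ≠ 0 := pow_ne_zero 2 (by exact_mod_cast he)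
  have h1 := congrArg (Polynomial.map (Int.castRingHom ℚ)) h
  simp only [Polynomial.map_sub, Polynomial.map_pow, Polynomial.map_mul, Polynomial.map_C,
      map_sextic, Int.coe_castRingHom, Polynomial.map_zero, Int.cast_pow] at h1
  have h0 : m.map (Int.castRingHom ℚ) * n.map (Int.castRingHom ℚ) ≠ 0 := by
    rw [← h1]
    simp [he, (irreducible_sextic hD).ne_zero]
  have hdvd : sextic ℚ D ∣ m.map (Int.castRingHom ℚ) * n.map (Int.castRingHom ℚ) :=
    ⟨-C ((e : ℚ) ^ 2), by rw [← h1]; ring⟩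
  rcases (irreducible_sextic hD).prime.dvd_or_dvd hdvd with hd | hd
  · have := natDegree_le_of_dvd hd (left_ne_zero_of_mul h0)
    rw [sextic_natDegree] at this
    have := this.trans (natDegree_map_le.trans hm)
    omega
  · have := natDegree_le_of_dvd hd (right_ne_zero_of_mul h0)
    rw [sextic_natDegree] at this
    have := this.trans (natDegree_map_le.trans hn)
    omega

theorem IsPair.not_integralUpTo_zero_and_dvd {D : ℤ} (hD : D = 1 ∨ D = 2) {m y : ℚ[X]}
    (h : IsPair D m y) (hr : ¬ HasReduction m y) :
    ¬ IntegralUpTo 0 m y ∧ ∃ (κ : ℚ) (η : ℚ[X]), κ ≠ 0 ∧ sextic ℚ D ∣ m - C κ * η ^ 2 := by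
  obtain ⟨n, hn, hmn⟩ := h.exists_eq_mul
  obtain ⟨c, m, hc, rfl, hprim⟩ := exists_int_primitive h.ne_zero
  have hm : m.natDegree ≤ 2 := by
    have := h.natDegree_left
    rwa [natDegree_C_mul hc, natDegree_map_eq_of_injective (RingHom.injective_int _)] at this
  have hr' : ¬ HasReduction (m.map (Int.castRingHom ℚ)) y := fun h => hr (h.mul_C hc)
  obtain ⟨e, A, w, he, hw, hA, hmin⟩ := exists_minimal_denominator m y
  obtain ⟨hAd, N, hN, hAN⟩ := exists_int_cofactor hprim hm h.natDegree_right hw hn hmn hA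
  have hm2 := hprim.map_zmod_ne_zero Nat.prime_two
  have hA0 : A ≠ 0 := ne_zero_of_sq_sub_eq (by omega) (by exact_mod_cast he) hm hN hAN
  have hcop (p : ℕ) (hp : p.Prime) (hpe : (p : ℤ) ∣ e) :
      IsCoprime (m.map (Int.castRingHom (ZMod p))) (N.map (Int.castRingHom (ZMod p))) := by
    have : Fact p.Prime := ⟨hp⟩
    refine isCoprime_of_sq_eq_mul (hprim.map_zmod_ne_zero hp) (natDegree_map_le.trans hm)
      (natDegree_map_le.trans hN) ?_ (hmin p hp hpe)
    rw [← Polynomial.map_mul, ← hAN]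
    have h0 : (e : ZMod p) = 0 := by
      rwa [← Int.cast_natCast, ZMod.intCast_zmod_eq_zero_iff_dvd]
    rw [Polynomial.map_sub, Polynomial.map_mul, Polynomial.map_C, map_pow, eq_intCast,
      Int.cast_natCast, h0, Polynomial.map_pow]
    simp
  obtain ⟨hsq, htw⟩ := sextic_dvd_sub_sq hD hAN hA0 hAd hm hm2 hcop
  obtain ⟨hsq', -⟩ := sextic_dvd_sub_sq hD (m := -m) (n := -N) (by rw [hAN]; ring) hA0 hAd
    (by rwa [natDegree_neg]) (by simpa using hm2) fun p hp hpe => by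
      rw [Polynomial.map_neg, Polynomial.map_neg]
      exact (hcop p hp hpe).neg_neg
  have hodd : ¬ Odd e := by
    intro hodd
    have hB (v : (ZMod 2)[X]) (hv : v.natDegree ≤ 1) :
        (A - C (e : ℤ) * cubic _).map (Int.castRingHom (ZMod 2)) ≠
          m.map (Int.castRingHom (ZMod 2)) * v := by
      intro hB
      apply hr'
      obtain ⟨v, rfl, hvd⟩ := exists_int_lift v
      rw [← Polynomial.map_mul, ← sub_eq_zero, ← Polynomial.map_sub] at hB
      obtain ⟨B, hB⟩ := exists_eq_C_mul_of_map_eq_zero hB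
      have he0 : (e : ℚ) ≠ 0 := by exact_mod_cast he
      have hinv : (e : ℚ)⁻¹ ∈ OddDen := by
        refine inv_mem (natCast_mem _ _) ?_
        have : (⟨(e : ℚ), natCast_mem _ _⟩ : OddDen) = (e : OddDen) := by ext; simp
        rw [this, map_natCast]
        exact fun h0 => by
          rw [ZMod.natCast_eq_zero_iff_even] at h0
          exact Nat.not_even_iff_odd.mpr hodd h0
      have h2 := congrArg (Polynomial.map (Int.castRingHom ℚ)) hB
      simp only [Polynomial.map_sub, Polynomial.map_mul, Polynomial.map_C, Int.coe_castRingHom,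
        Int.cast_natCast, map_cubic, Nat.cast_ofNat, map_ofNat, Polynomial.map_ofNat] at h2
      have h3 : C (e : ℚ) * C (e : ℚ)⁻¹ = 1 := by rw [← C_mul, mul_inv_cancel₀ he0, C_1]
      refine ⟨C ⟨_, hinv⟩ * B.map (Int.castRingHom OddDen),
        C (e : ℚ)⁻¹ * (v.map (Int.castRingHom ℚ) + w), (natDegree_C_mul_le _ _).trans
        (natDegree_add_le_of_degree_le (natDegree_map_le.trans (hvd.trans hv)) hw), ?_⟩
      rw [map_mul, map_intCast_toRat, show toRat (C ⟨_, hinv⟩) = C (e : ℚ)⁻¹ from map_C _]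
      apply mul_left_cancel₀ (C_ne_zero.mpr he0)
      linear_combination hA + h2 - (m.map (Int.castRingHom ℚ) * (v.map (Int.castRingHom ℚ) + w) +
        2 * B.map (Int.castRingHom ℚ)) * h3
    rcases exists_coordModEq (d := e) (B := A - C (e : ℤ) * cubic _)
      (r := C ((e : ℤ) ^ 2) * ((X ^ 2 + X) + ((D : ℤ[X]) - 1) * (X ^ 2 + X) ^ 2)) hm hN (by
        rw [← hAN, sextic_eq, C_pow]; ring) hm2 hB with ⟨h1, -⟩ | ⟨t, ht, h1⟩
    · rw [Int.even_coe_nat] at h1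
      exact Nat.not_even_iff_odd.mpr hodd h1
    · exact htw t ht h1
  rw [Nat.not_odd_iff_even] at hodd
  have h2e : ((2 : ℕ) : ℤ) ∣ e := Int.natCast_dvd_natCast.mpr hodd.two_dvd
  have hmin2 := hmin 2 Nat.prime_two h2e
  constructor
  · intro h_int
    obtain ⟨P, v, hv, hP⟩ := h_int.of_C_mul
    rw [pow_zero, one_mul, ← map_intCast_toRat] at hP
    rw [← map_intCast_toRat, ← map_intCast_toRat m] at hA
    have h1 : toRat (m.map (Int.castRingHom OddDen)) * (C (e : ℚ) * v - w) =
        toRat (A.map (Int.castRingHom OddDen) - C (e : OddDen) * P) := by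
      rw [map_sub, map_mul, show toRat (C (e : OddDen)) = C (e : ℚ) by simp]
      linear_combination hA - C (e : ℚ) * hP
    obtain ⟨g, hg, hmg⟩ := exists_toRat_eq (by rwa [map_intCast_red]) h1
    refine hmin2 (red g) ?_ ?_
    · refine (natDegree_red_le g).trans ?_
      rw [← natDegree_toRat, ← hg]
      exact (natDegree_sub_le _ _).trans (max_le ((natDegree_C_mul_le _ _).trans hv) hw)
    · have hCe : red (C (e : OddDen)) = 0 := by
        have h0 : (e : ZMod 2) = 0 := by rwa [ZMod.natCast_eq_zero_iff_even]
        rw [show red (C (e : OddDen)) = C (residue e) from map_C _, map_natCast, h0, C_0]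
      have h3 := congrArg red hmg
      rw [map_mul, map_sub, map_mul, map_intCast_red, map_intCast_red,
        hCe, zero_mul, sub_zero] at h3
      exact h3.symm
  · obtain ⟨k, hk⟩ := hodd.two_dvd
    rcases exists_coordModEq (d := 0) (B := A) (r := C ((k : ℤ) ^ 2) * sextic ℤ D) hm hN (by
        rw [← hAN, hk]; simp; ring) hm2 hmin2 with ⟨-, t, ht, h1 | h1⟩ | ⟨t, ht, h1⟩
    · obtain ⟨η, hη⟩ := hsq t ht h1
      refine ⟨c, η, hc, ?_⟩
      rw [← mul_sub]
      exact hη.mul_left _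
    · obtain ⟨η, hη⟩ := hsq' t ht h1
      refine ⟨-c, η, neg_ne_zero.mpr hc, ?_⟩
      convert hη.mul_left (-C c) using 1
      rw [Polynomial.map_neg, C_neg]
      ring
    · exact (htw t ht h1).elim

theorem exists_dvd_sq_add {D : ℤ} (hD : 0 < D) :
    ∃ J : ℚ[X], sextic ℚ D ∣ J ^ 2 + C (D : ℚ) := by
  have hcop : IsCoprime (sextic ℚ D) (X ^ 2 + X : ℚ[X]) := by
    refine (irreducible_sextic hD).coprime_iff_not_dvd.mpr fun h => ?_
    have hd : (X ^ 2 + X : ℚ[X]).natDegree = 2 := by compute_degree!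
    have := natDegree_le_of_dvd h (by rintro h0; simp [h0] at hd)
    rw [sextic_natDegree, hd] at this
    omega
  obtain ⟨u, v, huv⟩ := hcop
  refine ⟨C (1 / 2) * (X ^ 3 + X ^ 2 - 2 * X - 1) * v, C (1 / 4) * v ^ 2 +
    C (D : ℚ) * (1 + v * (X ^ 2 + X)) * u, ?_⟩
  have h2 : (4 : ℚ[X]) * C (1 / 4) = 1 := by
    rw [← map_ofNat C, ← C_mul]; norm_num
  have h4 : (C (1 / 2) ^ 2 : ℚ[X]) = C (1 / 4) := by
    rw [← C_pow]; norm_num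
  have hDC : C (D : ℚ) = (D : ℚ[X]) := by simp
  have huv' : u * sextic ℚ D = 1 - v * (X ^ 2 + X) := by linear_combination huv
  rw [mul_add, show sextic ℚ D * (C (D : ℚ) * (1 + v * (X ^ 2 + X)) * u) =
    C (D : ℚ) * (1 + v * (X ^ 2 + X)) * (u * sextic ℚ D) by ring, huv', hDC, sextic]
  linear_combination (X ^ 3 + X ^ 2 - 2 * X - 1) ^ 2 * v ^ 2 * h4 -
    D * (X ^ 2 + X) ^ 2 * v ^ 2 * h2

theorem exists_twist {D : ℤ} (hD : 0 < D) {m η : ℚ[X]} {κ s : ℚ} (hκ : κ ≠ 0) (hs : s ≠ 0)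
    (h : sextic ℚ D ∣ m - C κ * η ^ 2) :
    ∃ (κ : ℚ) (η : ℚ[X]), 0 < κ * s ∧ sextic ℚ D ∣ m - C κ * η ^ 2 := by
  rcases lt_or_gt_of_ne (mul_ne_zero hκ hs) with h1 | h1
  · obtain ⟨J, hJ⟩ := exists_dvd_sq_add hD
    have hD0 : (0 : ℚ) < D := by exact_mod_cast hD
    refine ⟨-κ / D, J * η, by rw [div_mul_eq_mul_div]; exact div_pos (by linarith) hD0, ?_⟩
    have h2 : m - C (-κ / D) * (J * η) ^ 2 =
        (m - C κ * η ^ 2) + (J ^ 2 + C (D : ℚ)) * (C (κ / D) * η ^ 2) := by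
      have h3 : C κ = C (D : ℚ) * C (κ / D) := by rw [← C_mul, mul_div_cancel₀ _ hD0.ne']
      rw [neg_div, C_neg, h3]
      ring
    rw [h2]
    exact h.add (hJ.mul_right _)
  · exact ⟨κ, η, h1, h⟩

theorem exists_small_multiple (D : ℤ) (g : ℚ[X]) :
    ∃ a b : ℚ[X], b ≠ 0 ∧ a.natDegree ≤ 3 ∧ b.natDegree ≤ 2 ∧ sextic ℚ D ∣ a - g * b := by
  have hf0 : sextic ℚ D ≠ 0 := (sextic_monic D).ne_zero
  have hfin : Module.finrank ℚ (AdjoinRoot (sextic ℚ D)) = 6 := by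
    rw [(AdjoinRoot.powerBasis hf0).finrank, AdjoinRoot.powerBasis_dim, sextic_natDegree]
  have : Module.Finite ℚ (AdjoinRoot (sextic ℚ D)) := (AdjoinRoot.powerBasis hf0).finite
  let T : (degreeLT ℚ 4 × degreeLT ℚ 3) →ₗ[ℚ] AdjoinRoot (sextic ℚ D) :=
    (AdjoinRoot.mkₐ (sextic ℚ D)).toLinearMap ∘ₗ
      ((degreeLT ℚ 4).subtype.coprod (-(LinearMap.mulLeft ℚ g) ∘ₗ (degreeLT ℚ 3).subtype))
  have hdim (n : ℕ) : Module.finrank ℚ (degreeLT ℚ n) = n := by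
    rw [(degreeLTEquiv ℚ n).finrank_eq]; simp
  have hfd (n : ℕ) : Module.Finite ℚ (degreeLT ℚ n) := Module.Finite.equiv (degreeLTEquiv ℚ n).symm
  have hker : LinearMap.ker T ≠ ⊥ := LinearMap.ker_ne_bot_of_finrank_lt (by
    rw [Module.finrank_prod, hdim, hdim, hfin]; norm_num)
  obtain ⟨⟨⟨a, ha⟩, ⟨b, hb⟩⟩, hab, hne⟩ := Submodule.exists_mem_ne_zero_of_ne_bot hker
  have hdvd : sextic ℚ D ∣ a - g * b := by
    rw [← AdjoinRoot.mk_eq_zero, ← LinearMap.mem_ker.mp hab]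
    simp [T, sub_eq_add_neg]
  have hdeg {n : ℕ} {p : ℚ[X]} (hp : p ∈ degreeLT ℚ (n + 1)) : p.natDegree ≤ n := by
    rw [mem_degreeLT] at hp
    exact natDegree_le_of_degree_le (Order.le_of_lt_succ (by exact_mod_cast hp))
  refine ⟨a, b, ?_, hdeg ha, hdeg hb, hdvd⟩
  rintro rfl
  rw [mul_zero, sub_zero] at hdvd
  refine hne ?_
  have h0 : a = 0 := by
    by_contra h0
    have := natDegree_le_of_dvd hdvd h0
    rw [sextic_natDegree] at this
    have := hdeg ha
    omega
  subst h0
  rfl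

theorem exists_sq_sub_eq_C_mul {D : ℤ} (hD : 0 < D) {m η : ℚ[X]} {κ s : ℚ} (hκ : κ ≠ 0)
    (hs : s ≠ 0) (hm : m.natDegree ≤ 2) (h : sextic ℚ D ∣ m - C κ * η ^ 2) :
    ∃ (κ l : ℚ) (a b : ℚ[X]), 0 < κ * s ∧ b ≠ 0 ∧ a.natDegree ≤ 3 ∧ b.natDegree ≤ 2 ∧
      a ^ 2 - C κ * m * b ^ 2 = C l * sextic ℚ D := by
  obtain ⟨κ, η, hκs, h⟩ := exists_twist hD hκ hs h
  obtain ⟨a, b, hb0, ha, hb, hab⟩ := exists_small_multiple D (C κ * η)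
  have h1 : sextic ℚ D ∣ a ^ 2 - C κ * m * b ^ 2 := by
    have h2 : a ^ 2 - C κ * m * b ^ 2 = (a - C κ * η * b) * (a + C κ * η * b) -
        (m - C κ * η ^ 2) * (C κ * b ^ 2) := by ring
    rw [h2]
    exact (hab.mul_right _).sub (h.mul_right _)
  obtain ⟨l, hl⟩ := h1
  refine ⟨κ, l.coeff 0, a, b, hκs, hb0, ha, hb, ?_⟩
  have hld : l.natDegree = 0 := by
    by_cases hl0 : l = 0
    · simp [hl0]
    have h3 := congrArg natDegree hl
    rw [natDegree_mul (sextic_monic D).ne_zero hl0, sextic_natDegree] at h3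
    have h4 : (a ^ 2 - C κ * m * b ^ 2).natDegree ≤ 6 := by
      rw [mul_assoc]
      exact (natDegree_sub_le _ _).trans (max_le (natDegree_pow_le_of_le 2 ha)
        ((natDegree_C_mul_le _ _).trans (natDegree_mul_le_of_le hm (natDegree_pow_le_of_le 2 hb))))
    omega
  rw [hl, mul_comm, ← eq_C_of_natDegree_eq_zero hld]

theorem eval_mul_eval_pos {p : ℝ[X]} {s t : ℝ} (hst : s ≤ t)
    (h : ∀ x, s ≤ x → x ≤ t → p.eval x ≠ 0) : 0 < p.eval s * p.eval t := by
  by_contra hn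
  push Not at hn
  have hc : ContinuousOn (fun x => p.eval x) (Set.Icc s t) := p.continuous.continuousOn
  have h0 : (0 : ℝ) ∈ Set.uIcc (p.eval s) (p.eval t) := by
    rw [Set.mem_uIcc]
    rcases mul_nonpos_iff.mp hn with h1 | h1
    · exact Or.inr ⟨h1.2, h1.1⟩
    · exact Or.inl h1
  obtain ⟨x, hx, hx0⟩ := intermediate_value_uIcc (by rwa [Set.uIcc_of_le hst]) h0
  rw [Set.uIcc_of_le hst] at hx
  exact h x hx.1 hx.2 hx0

theorem eval_mul_leadingCoeff_pos {p : ℝ[X]} {s : ℝ} (hp : 0 < p.degree)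
    (h : ∀ x, s ≤ x → p.eval x ≠ 0) : 0 < p.eval s * p.leadingCoeff := by
  have h0 : p.leadingCoeff ≠ 0 := leadingCoeff_ne_zero.mpr (ne_zero_of_degree_gt hp)
  rcases lt_or_gt_of_ne h0 with hneg | hpos
  · obtain ⟨t, hts, ht⟩ := ((tendsto_atBot_of_leadingCoeff_nonpos p hp hneg.le).eventually_lt_atBot
      0 |>.and (Filter.eventually_ge_atTop s)).exists
    have := eval_mul_eval_pos ht fun x hx _ => h x hx
    nlinarith
  · obtain ⟨t, hts, ht⟩ := ((tendsto_atTop_of_leadingCoeff_nonneg p hp hpos.le).eventually_gt_atTop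
      0 |>.and (Filter.eventually_ge_atTop s)).exists
    have := eval_mul_eval_pos ht fun x hx _ => h x hx
    have h3 : 0 < p.eval s := by
      by_contra hn
      nlinarith
    exact mul_pos h3 hpos

theorem eval_mul_coeff_three_pos {p : ℝ[X]} {s : ℝ} (hp : p.natDegree ≤ 3) (h3 : p.coeff 3 ≠ 0)
    (h : ∀ x, s ≤ x → p.eval x ≠ 0) : 0 < p.eval s * p.coeff 3 := by
  have hd : p.natDegree = 3 := natDegree_eq_of_le_of_coeff_ne_zero hp h3
  rw [← hd]
  exact eval_mul_leadingCoeff_pos (natDegree_pos_iff_degree_pos.mp (by omega)) h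

theorem eval_mul_coeff_three_neg {p : ℝ[X]} {s : ℝ} (hp : p.natDegree ≤ 3) (h3 : p.coeff 3 ≠ 0)
    (h : ∀ x, x ≤ s → p.eval x ≠ 0) : p.eval s * p.coeff 3 < 0 := by
  have hc : (p.comp (-X)).coeff 3 = -p.coeff 3 := by
    rw [show (-X : ℝ[X]) = C (-1) * X by simp, comp_C_mul_X_coeff]
    ring
  have := eval_mul_coeff_three_pos (p := p.comp (-X)) (s := -s)
    (by rw [natDegree_comp, natDegree_neg, natDegree_X, mul_one]; exact hp)
    (by rw [hc]; exact neg_ne_zero.mpr h3) (fun x hx => by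
      rw [eval_comp, eval_neg, eval_X]; exact h _ (by linarith))
  rw [hc, eval_comp, eval_neg, eval_X, neg_neg] at this
  linarith

/-- A relation `a ^ 2 - κ m b ^ 2 = l f` in degrees at most `3`, `2`, `2`. -/
structure IsNormRelation (D : ℤ) (m : ℚ[X]) (κ l : ℚ) (a b : ℚ[X]) : Prop where
  ne_zero : b ≠ 0
  natDegree_left : a.natDegree ≤ 3
  natDegree_right : b.natDegree ≤ 2
  eq : a ^ 2 - C κ * m * b ^ 2 = C l * sextic ℚ D

namespace IsNormRelation
variable {D : ℤ} {m a b : ℚ[X]} {κ l : ℚ}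

theorem aeval_eq (h : IsNormRelation D m κ l a b) (x : ℝ) :
    (aeval x a) ^ 2 - κ * aeval x m * (aeval x b) ^ 2 = l * (sextic ℝ D).eval x := by
  have hs : aeval x (sextic ℚ D) = (sextic ℝ D).eval x := by
    rw [← eval_map_algebraMap, map_sextic]
  have := congrArg (aeval x) h.eq
  rwa [map_sub, map_mul, map_mul, map_mul, map_pow, map_pow, aeval_C, aeval_C, hs, eq_ratCast,
    eq_ratCast] at this

theorem pos (h : IsNormRelation D m κ l a b) (hD : 0 < D)
    (hinf : {x : ℝ | κ * aeval x m < 0}.Infinite) : 0 < l := by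
  have hb0 : b.map (algebraMap ℚ ℝ) ≠ 0 := (Polynomial.map_ne_zero_iff (algebraMap ℚ ℝ).injective).mpr
    h.ne_zero
  obtain ⟨x, hx, hxb⟩ := hinf.exists_notMem_finset (b.map (algebraMap ℚ ℝ)).roots.toFinset
  rw [Multiset.mem_toFinset, mem_roots hb0, IsRoot, eval_map_algebraMap] at hxb
  have h1 := h.aeval_eq x
  have h2 := eval_sextic_pos hD x
  have h3 : κ * aeval x m * (aeval x b) ^ 2 < 0 := mul_neg_of_neg_of_pos hx (by positivity)
  have h4 : 0 < (l : ℝ) * (sextic ℝ D).eval x := by nlinarith [sq_nonneg (aeval x a)]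
  exact_mod_cast pos_of_mul_pos_left h4 h2.le

theorem eval_ne_zero (h : IsNormRelation D m κ l a b) (hD : 0 < D) (hl : 0 < l) {x : ℝ}
    (hx : 0 ≤ κ * aeval x m) : (a.map (algebraMap ℚ ℝ)).eval x ≠ 0 := by
  intro h0
  rw [eval_map_algebraMap] at h0
  have h1 := h.aeval_eq x
  have h2 := eval_sextic_pos hD x
  have h3 : 0 < (l : ℝ) * (sextic ℝ D).eval x := mul_pos (by exact_mod_cast hl) h2
  rw [h0] at h1
  nlinarith [mul_nonneg hx (sq_nonneg (aeval x b))]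

/-- After rescaling, the relation exhibits half of the class of `(m, a)`. -/
theorem exists_half {y : ℚ[X]} (h : IsNormRelation D m κ l a b) {e : ℚ} (he : e ≠ 0)
    (hl : l = e ^ 2) (hd : ∃ w : ℚ[X], w.natDegree ≤ 1 ∧ a = C e * y + m * w) :
    ∃ (κ : ℚ) (b w : ℚ[X]), b ≠ 0 ∧ b.natDegree ≤ 2 ∧ w.natDegree ≤ 1 ∧
      (y + m * w).natDegree ≤ 3 ∧ (y + m * w) ^ 2 - sextic ℚ D = C κ * m * b ^ 2 := by
  obtain ⟨w, hw, hd⟩ := hd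
  have h1 : C e⁻¹ * C e = 1 := by rw [← C_mul, inv_mul_cancel₀ he, C_1]
  have hyw : y + m * (C e⁻¹ * w) = C e⁻¹ * a := by
    rw [hd]
    linear_combination -y * h1
  refine ⟨κ, C e⁻¹ * b, C e⁻¹ * w, mul_ne_zero (C_ne_zero.mpr (inv_ne_zero he)) h.ne_zero,
    (natDegree_C_mul_le _ _).trans h.natDegree_right, (natDegree_C_mul_le _ _).trans hw, ?_, ?_⟩
  · rw [hyw]
    exact (natDegree_C_mul_le _ _).trans h.natDegree_left
  · have h2 := h.eq
    rw [hl, C_pow] at h2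
    rw [hyw]
    linear_combination C e⁻¹ ^ 2 * h2 + sextic ℚ D * (C e⁻¹ * C e + 1) * h1

end IsNormRelation

theorem coeff_six_sq {a : ℚ[X]} (ha : a.natDegree ≤ 3) : (a ^ 2).coeff 6 = a.coeff 3 ^ 2 :=
  coeff_pow_of_natDegree_le ha (m := 2)

theorem coeff_five_sq {a : ℚ[X]} (ha : a.natDegree ≤ 3) :
    (a ^ 2).coeff 5 = 2 * (a.coeff 3 * a.coeff 2) := by
  have h4 : a.coeff 4 = 0 := coeff_eq_zero_of_natDegree_lt (by omega)
  have h5 : a.coeff 5 = 0 := coeff_eq_zero_of_natDegree_lt (by omega)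
  simp [sq, coeff_mul, Finset.Nat.antidiagonal_succ, h4, h5]
  ring

theorem sextic_coeff_six (D : ℤ) : (sextic ℚ D).coeff 6 = 1 := by
  have := (sextic_monic (S := ℚ) D).coeff_natDegree
  rwa [sextic_natDegree] at this

theorem sextic_coeff_five (D : ℤ) : (sextic ℚ D).coeff 5 = 2 := by
  rw [sextic_expand, show (2 : ℚ[X]) = C 2 from rfl, show (4 : ℚ[X]) = C 4 from rfl]
  simp only [coeff_add, coeff_C_mul, coeff_X_pow, coeff_X, coeff_one]
  norm_num

theorem natDegree_le_of_mul_le {m w : ℚ[X]} {k n : ℕ} (hm0 : m ≠ 0) (hm : m.natDegree = k)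
    (h : (m * w).natDegree ≤ k + n) : w.natDegree ≤ n := by
  by_cases hw : w = 0
  · simp [hw]
  · rw [natDegree_mul hm0 hw] at h
    omega

theorem infinite_setOf_mul_aeval_neg {m : ℚ[X]} {κ : ℚ} (hm : 0 < m.natDegree)
    (h : κ * m.leadingCoeff < 0) : {x : ℝ | κ * aeval x m < 0}.Infinite := by
  let p : ℝ[X] := (C κ * m).map (algebraMap ℚ ℝ)
  have hlc : p.leadingCoeff < 0 := by
    rw [leadingCoeff_map, leadingCoeff_mul, leadingCoeff_C, eq_ratCast]
    exact_mod_cast h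
  have hd : 0 < p.degree := by
    rw [degree_map, ← natDegree_pos_iff_degree_pos, natDegree_C_mul (left_ne_zero_of_mul h.ne)]
    exact hm
  obtain ⟨t, ht⟩ := Filter.eventually_atTop.mp
    ((tendsto_atBot_of_leadingCoeff_nonpos p hd hlc.le).eventually_lt_atBot 0)
  refine (Set.Ici_infinite t).mono fun x hx => ?_
  have := ht x hx
  rwa [eval_map_algebraMap, map_mul, aeval_C, eq_ratCast] at this

namespace IsPair
variable {D : ℤ} {m y : ℚ[X]}

theorem exists_mul_add_mul_eq_one (h : IsPair D m y) (hD : 0 < D) :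
    ∃ v u : ℚ[X], y * v + m * u = 1 := by
  obtain ⟨n, hn, hy⟩ := h.exists_eq_mul
  have hco : IsCoprime (sextic ℚ D) m := by
    refine ((irreducible_sextic hD).coprime_iff_not_dvd).mpr fun hd => ?_
    have := natDegree_le_of_dvd hd h.ne_zero
    rw [sextic_natDegree] at this
    have := h.natDegree_left
    omega
  obtain ⟨p, q, hpq⟩ := hco
  exact ⟨p * y, q - n * p, by linear_combination hpq + p * hy⟩

theorem aeval_sq {S : Type*} [CommRing S] [Algebra ℚ S] (h : IsPair D m y) {x : S}
    (hx : aeval x m = 0) : aeval x y ^ 2 = aeval x (sextic ℚ D) := by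
  obtain ⟨n, hn, hy⟩ := h.exists_eq_mul
  have := congrArg (aeval x) hy
  rw [map_sub, map_mul, map_pow, hx, zero_mul] at this
  linear_combination this

end IsPair

/-- The square roots of `l` modulo a quadratic polynomial are constant or proportional to its
derivative. -/
theorem IsNormRelation.exists_eq_mul_add {D : ℤ} {m y a b : ℚ[X]} {κ l : ℚ} (hD : 0 < D)
    (h : IsPair D m y) (hm : m.natDegree = 2) (hr : IsNormRelation D m κ l a b) :
    ∃ (e g : ℚ) (w : ℚ[X]), a = (C e + C g * (C (2 * m.coeff 2) * X + C (m.coeff 1))) * y + m * w ∧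
      e * g = 0 ∧ l = e ^ 2 + g ^ 2 * (m.coeff 1 ^ 2 - 4 * m.coeff 2 * m.coeff 0) := by
  obtain ⟨v, u, hvu⟩ := h.exists_mul_add_mul_eq_one hD
  obtain ⟨n, hn, hy⟩ := h.exists_eq_mul
  have hm2 : m.coeff 2 ≠ 0 := by
    rw [← hm]; exact leadingCoeff_ne_zero.mpr h.ne_zero
  have hmq := eq_quadratic hm.le
  obtain ⟨q, r, hqr, hrd⟩ : ∃ q r : ℚ[X], a * v = m * q + r ∧ r.natDegree ≤ 1 := by
    refine ⟨a * v / m, a * v % m, (EuclideanDomain.div_add_mod _ _).symm, ?_⟩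
    have := natDegree_mod_lt (a * v) (q := m) (by omega)
    omega
  have hrl := eq_linear hrd
  set S : ℚ[X] := C (2 * m.coeff 2) * X + C (m.coeff 1) with hS
  set g : ℚ := r.coeff 1 / (2 * m.coeff 2) with hg
  set e : ℚ := r.coeff 0 - g * m.coeff 1 with he
  have hre : r = C e + C g * S := by
    rw [hrl, he, hS]
    have : r.coeff 1 = g * (2 * m.coeff 2) := by rw [hg]; field_simp
    rw [this]
    simp only [C_sub, C_mul]
    ring
  have ha : a = (C e + C g * S) * y + m * (q * y + a * u) := by
    rw [← hre]
    linear_combination -a * hvu + y * hqr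
  have hSS : S ^ 2 = C (m.coeff 1 ^ 2 - 4 * m.coeff 2 * m.coeff 0) + m * C (4 * m.coeff 2) := by
    rw [hS]
    simp only [C_sub, C_mul, C_pow, map_ofNat]
    linear_combination -4 * C (m.coeff 2) * hmq
  -- modulo `m`, the square of `e + g S` is `l`
  have hdvd : m ∣ (C e + C g * S) ^ 2 - C l := by
    set R := C e + C g * S
    have h1 : m ∣ y ^ 2 * (R ^ 2 - C l) := by
      refine ⟨C κ * b ^ 2 - C l * n - (q * y + a * u) * (a + R * y), ?_⟩
      have h2 := hr.eq
      have h3 : a ^ 2 = (R * y) ^ 2 + m * (q * y + a * u) * (a + R * y) := by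
        linear_combination (a + R * y) * ha
      linear_combination h2 - C l * hy - h3
    have h4 : IsCoprime m (y ^ 2) := by
      refine IsCoprime.pow_right ⟨u, v, by linear_combination hvu⟩
    exact h4.dvd_of_dvd_mul_left h1
  have hlin : (C e + C g * S) ^ 2 - C l = C (e ^ 2 + g ^ 2 * (m.coeff 1 ^ 2 - 4 * m.coeff 2 * m.coeff 0) - l
      + 2 * e * g * m.coeff 1) + C (4 * (e * g) * m.coeff 2) * X + m * C (g ^ 2 * (4 * m.coeff 2)) := by
    have : (C e + C g * S) ^ 2 = C e ^ 2 + 2 * C e * C g * S + C g ^ 2 * S ^ 2 := by ring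
    rw [this, hSS, hS]
    simp only [C_add, C_sub, C_mul, C_pow, map_ofNat]
    ring
  rw [hlin, dvd_add_left (Dvd.intro _ rfl)] at hdvd
  have h0 := eq_zero_of_dvd_of_natDegree_lt hdvd (by
    rw [hm]; refine lt_of_le_of_lt (?_ : _ ≤ 1) one_lt_two; compute_degree)
  have c1 := congrArg (fun p => p.coeff 1) h0
  have c0 := congrArg (fun p => p.coeff 0) h0
  simp only [coeff_add, coeff_C_mul, coeff_X_one, coeff_X_zero, coeff_C_succ, coeff_C_zero,
    coeff_zero, mul_zero, add_zero, zero_add, mul_one] at c0 c1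
  have heg : e * g = 0 := by
    rcases mul_eq_zero.mp c1 with h1 | h1
    · linarith
    · exact absurd h1 hm2
  exact ⟨e, g, q * y + a * u, ha, heg, by linear_combination -c0 + 2 * m.coeff 1 * heg⟩

section

variable {D : ℤ} {m y η : ℚ[X]} {κ : ℚ}

theorem exists_isNormRelation (hD : 0 < D) {s : ℚ} (hκ : κ ≠ 0) (hs : s ≠ 0)
    (hm : m.natDegree ≤ 2) (h : sextic ℚ D ∣ m - C κ * η ^ 2) :
    ∃ (κ l : ℚ) (a b : ℚ[X]), 0 < κ * s ∧ IsNormRelation D m κ l a b := by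
  obtain ⟨κ, l, a, b, h1, h2, h3, h4, h5⟩ := exists_sq_sub_eq_C_mul hD hκ hs hm h
  exact ⟨κ, l, a, b, h1, h2, h3, h4, h5⟩

/-- The class of `(m, y)` is twice the class of `(b, -(y + m w))`. -/
def IsHalvable (D : ℤ) (m y : ℚ[X]) : Prop :=
  ∃ (κ : ℚ) (b w : ℚ[X]), b ≠ 0 ∧ b.natDegree ≤ 2 ∧ w.natDegree ≤ 1 ∧
    (y + m * w).natDegree ≤ 3 ∧ (y + m * w) ^ 2 - sextic ℚ D = C κ * m * b ^ 2

theorem isHalvable_of_natDegree_eq_two (hD : 0 < D) (h : IsPair D m y) (hm : m.natDegree = 2)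
    (hκ : κ ≠ 0) (hdvd : sextic ℚ D ∣ m - C κ * η ^ 2) : IsHalvable D m y := by
  have hm2 : m.coeff 2 ≠ 0 := by
    rw [← hm]; exact leadingCoeff_ne_zero.mpr h.ne_zero
  have hmq := eq_quadratic hm.le
  have key : ∀ {κ l : ℚ} {a b : ℚ[X]}, IsNormRelation D m κ l a b → 0 < l →
      (∀ g : ℚ, g ≠ 0 → l = g ^ 2 * (m.coeff 1 ^ 2 - 4 * m.coeff 2 * m.coeff 0) →
        ∀ w, a = C g * (C (2 * m.coeff 2) * X + C (m.coeff 1)) * y + m * w → False) →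
      IsHalvable D m y := by
    intro κ l a b hr hl hno
    obtain ⟨e, g, w, ha, heg, hle⟩ := hr.exists_eq_mul_add hD h hm
    by_cases hg : g = 0
    · subst hg
      have he : e ≠ 0 := by
        rintro rfl
        norm_num at hle
        exact hl.ne' hle
      rw [C_0, zero_mul, add_zero] at ha
      refine hr.exists_half he (by rw [hle]; ring) ⟨w, ?_, ha⟩
      refine natDegree_le_of_mul_le h.ne_zero hm ?_
      rw [show m * w = a - C e * y by rw [ha]; ring]
      exact (natDegree_sub_le _ _).trans
        (max_le hr.natDegree_left ((natDegree_C_mul_le _ _).trans h.natDegree_right))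
    · have he : e = 0 := (mul_eq_zero.mp heg).resolve_right hg
      subst he
      exact (hno g hg (by rw [hle]; ring) w (by rw [ha, C_0, zero_add])).elim
  have hprod : ∀ {a w : ℚ[X]} {g : ℚ} {s t : ℝ},
      (∀ x : ℝ, aeval x m = m.coeff 2 * ((x - s) * (x - t))) →
      a = C g * (C (2 * m.coeff 2) * X + C (m.coeff 1)) * y + m * w →
      (a.map (algebraMap ℚ ℝ)).eval s * (a.map (algebraMap ℚ ℝ)).eval t =
        -((g * m.coeff 2 * (s - t)) ^ 2 * (aeval s y * aeval t y)) := by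
    intro a w g s t hst ha
    have h2 : ((m.coeff 1 : ℚ) : ℝ) = - m.coeff 2 * (s + t) := by
      have e0 := hst 0
      have e1 := hst 1
      rw [hmq] at e0 e1
      simp at e0 e1
      linear_combination e1 - e0
    have hs : aeval s m = 0 := by rw [hst]; ring
    have ht : aeval t m = 0 := by rw [hst]; ring
    have es := congrArg (aeval s) ha
    have et := congrArg (aeval t) ha
    simp only [map_add, map_mul, aeval_C, aeval_X, hs, ht, zero_mul, add_zero, eq_ratCast,
      h2, Rat.cast_ofNat] at es et
    rw [eval_map_algebraMap, eval_map_algebraMap, es, et]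
    ring
  by_cases hc : ∃ s t : ℝ, s < t ∧ (∀ x : ℝ, aeval x m = m.coeff 2 * ((x - s) * (x - t))) ∧
      aeval s y * aeval t y < 0
  · obtain ⟨s, t, hlt, hst, hy⟩ := hc
    obtain ⟨κ, l, a, b, hs, hr⟩ := exists_isNormRelation hD hκ hm2 h.natDegree_left hdvd
    have hsR : (0 : ℝ) < κ * m.coeff 2 := by exact_mod_cast hs
    have hl := hr.pos hD ((Set.Ioo_infinite hlt).mono fun x hx => by
      rw [Set.mem_ofPred_eq, hst, ← mul_assoc]
      exact mul_neg_of_pos_of_neg hsR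
        (mul_neg_of_pos_of_neg (by linarith [hx.1]) (by linarith [hx.2])))
    refine key hr hl fun g hg _ w ha => ?_
    have h3 : a.coeff 3 ^ 2 = l + κ * m.coeff 2 * b.coeff 2 ^ 2 := by
      have := congrArg (fun p => p.coeff 6) hr.eq
      simp only [coeff_sub, coeff_C_mul, mul_assoc, sextic_coeff_six,
        coeff_six_sq hr.natDegree_left] at this
      rw [show (6 : ℕ) = 2 + 2 * 2 from rfl, coeff_mul_add_eq_of_natDegree_le hm.le
        (natDegree_pow_le_of_le 2 hr.natDegree_right), coeff_pow_of_natDegree_le hr.natDegree_right]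
        at this
      linear_combination this
    have h3' : a.coeff 3 ≠ 0 := by
      intro h0
      rw [h0] at h3
      nlinarith [mul_nonneg hs.le (sq_nonneg (b.coeff 2))]
    have hd : (a.map (algebraMap ℚ ℝ)).natDegree ≤ 3 := (natDegree_map_le).trans hr.natDegree_left
    have h3R : (a.map (algebraMap ℚ ℝ)).coeff 3 ≠ 0 := by
      rw [coeff_map]; simpa using h3'
    have e1 := eval_mul_coeff_three_neg hd h3R fun x (hx : x ≤ s) => hr.eval_ne_zero hD hl (by
      rw [hst, ← mul_assoc]
      exact mul_nonneg hsR.le (mul_nonneg_of_nonpos_of_nonpos (by linarith) (by linarith)))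
    have e2 := eval_mul_coeff_three_pos hd h3R fun x (hx : t ≤ x) => hr.eval_ne_zero hD hl (by
      rw [hst, ← mul_assoc]
      exact mul_nonneg hsR.le (mul_nonneg (by linarith) (by linarith)))
    have e3 := hprod hst ha
    have e4 := mul_neg_of_neg_of_pos e1 e2
    have e5 : (a.map (algebraMap ℚ ℝ)).eval s * (a.map (algebraMap ℚ ℝ)).eval t < 0 := by
      by_contra hn
      nlinarith [mul_nonneg (not_lt.mp hn) (sq_nonneg ((a.map (algebraMap ℚ ℝ)).coeff 3))]
    nlinarith [mul_nonneg (sq_nonneg (g * m.coeff 2 * (s - t))) (neg_nonneg.mpr hy.le)]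
  · obtain ⟨κ, l, a, b, hs, hr⟩ :=
      exists_isNormRelation hD hκ (neg_ne_zero.mpr hm2) h.natDegree_left hdvd
    have hneg : κ * m.coeff 2 < 0 := by linarith
    have hl := hr.pos hD (infinite_setOf_mul_aeval_neg (by omega)
      (by rw [leadingCoeff, hm]; exact hneg))
    refine key hr hl fun g hg hlg w ha => hc ?_
    have hΔ : 0 < m.coeff 1 ^ 2 - 4 * m.coeff 2 * m.coeff 0 := by
      by_contra hn
      nlinarith [mul_nonneg (sq_nonneg g) (neg_nonneg.mpr (not_lt.mp hn))]
    obtain ⟨s, t, hlt, hst⟩ : ∃ s t : ℝ, s < t ∧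
        ∀ x : ℝ, aeval x m = m.coeff 2 * ((x - s) * (x - t)) := by
      have hm2R : ((m.coeff 2 : ℚ) : ℝ) ≠ 0 := by exact_mod_cast hm2
      have hΔR : (0 : ℝ) < m.coeff 1 ^ 2 - 4 * m.coeff 2 * m.coeff 0 := by exact_mod_cast hΔ
      set r := √((m.coeff 1 : ℝ) ^ 2 - 4 * m.coeff 2 * m.coeff 0) with hrdef
      have hr0 : 0 < r := Real.sqrt_pos.mpr hΔR
      have hr2 : r ^ 2 = (m.coeff 1 : ℝ) ^ 2 - 4 * m.coeff 2 * m.coeff 0 := Real.sq_sqrt hΔR.le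
      have ha0 : 0 < |(m.coeff 2 : ℝ)| := abs_pos.mpr hm2R
      refine ⟨-m.coeff 1 / (2 * m.coeff 2) - r / (2 * |(m.coeff 2 : ℝ)|),
        -m.coeff 1 / (2 * m.coeff 2) + r / (2 * |(m.coeff 2 : ℝ)|), ?_, fun x => ?_⟩
      · have : 0 < r / (2 * |(m.coeff 2 : ℝ)|) := by positivity
        linarith
      · have h4 : (r / (2 * |(m.coeff 2 : ℝ)|)) ^ 2 =
            ((m.coeff 1 : ℝ) ^ 2 - 4 * m.coeff 2 * m.coeff 0) / (4 * m.coeff 2 ^ 2) := by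
          rw [div_pow, hr2, mul_pow, sq_abs]; norm_num
        set q := r / (2 * |(m.coeff 2 : ℝ)|)
        have h5 : (x - (-m.coeff 1 / (2 * m.coeff 2) - q)) * (x - (-m.coeff 1 / (2 * m.coeff 2) + q))
            = (x + m.coeff 1 / (2 * m.coeff 2)) ^ 2 - q ^ 2 := by ring
        rw [h5, h4, hmq]
        simp
        field_simp
        ring
    refine ⟨s, t, hlt, hst, ?_⟩
    have e1 := eval_mul_eval_pos hlt.le fun x (h1 : s ≤ x) (h2 : x ≤ t) => hr.eval_ne_zero hD hl (by
      rw [hst, ← mul_assoc]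
      exact mul_nonneg_of_nonpos_of_nonpos (by exact_mod_cast hneg.le)
        (mul_nonpos_of_nonneg_of_nonpos (by linarith) (by linarith)))
    rw [hprod hst ha] at e1
    by_contra hn
    nlinarith [mul_nonneg (sq_nonneg (g * m.coeff 2 * (s - t))) (not_lt.mp hn)]

end

section

variable {D : ℤ} {m y η a b : ℚ[X]} {κ l : ℚ}

theorem IsNormRelation.coeff_three_sq (hr : IsNormRelation D m κ l a b) (hm : m.natDegree ≤ 1) :
    a.coeff 3 ^ 2 = l := by
  have := congrArg (fun p => p.coeff 6) hr.eq
  have h2 : (m * b ^ 2).coeff 6 = 0 := coeff_eq_zero_of_natDegree_lt (lt_of_le_of_lt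
    (natDegree_mul_le_of_le hm (natDegree_pow_le_of_le 2 hr.natDegree_right)) (by norm_num))
  simp only [coeff_sub, coeff_C_mul, mul_assoc, sextic_coeff_six,
    coeff_six_sq hr.natDegree_left, h2] at this
  linear_combination this

theorem IsPair.coeff_three_sq (h : IsPair D m y) (hm : m.natDegree ≤ 1) : y.coeff 3 ^ 2 = 1 := by
  obtain ⟨n, hn, hy⟩ := h.exists_eq_mul
  have := congrArg (fun p => p.coeff 6) hy
  have h2 : (m * n).coeff 6 = 0 := coeff_eq_zero_of_natDegree_lt (lt_of_le_of_lt
    (natDegree_mul_le_of_le hm hn) (by norm_num))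
  simp only [coeff_sub, sextic_coeff_six, coeff_six_sq h.natDegree_right, h2] at this
  linear_combination this

theorem isHalvable_of_natDegree_eq_one (hD : 0 < D) (h : IsPair D m y) (hm : m.natDegree = 1)
    (hκ : κ ≠ 0) (hdvd : sextic ℚ D ∣ m - C κ * η ^ 2) : IsHalvable D m y := by
  have hm1 : m.coeff 1 ≠ 0 := by
    rw [← hm]; exact leadingCoeff_ne_zero.mpr h.ne_zero
  have hml := eq_linear hm.le
  set r : ℚ := - m.coeff 0 / m.coeff 1 with hr
  have hmr : m = C (m.coeff 1) * (X - C r) := by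
    have : m.coeff 0 = - m.coeff 1 * r := by rw [hr]; field_simp
    conv_lhs => rw [hml, this]
    simp only [C_mul, C_neg]
    ring
  have hr0 : m.eval r = 0 := by rw [hmr]; simp
  have hy3 := h.coeff_three_sq hm.le
  have hyr := h.aeval_sq (x := r) (by rw [coe_aeval_eq_eval]; exact hr0)
  rw [coe_aeval_eq_eval] at hyr
  have hfr : 0 < (sextic ℚ D).eval r := by
    have h1 := eval_sextic_pos hD (r : ℝ)
    rw [← map_sextic (algebraMap ℚ ℝ), ← eq_ratCast (algebraMap ℚ ℝ) r, eval_map_apply, eq_ratCast] at h1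
    exact_mod_cast h1
  have hyr0 : y.eval r ≠ 0 := by
    intro h0
    rw [h0] at hyr
    linarith
  have hy30 : y.coeff 3 ≠ 0 := by
    intro h0
    rw [h0] at hy3
    norm_num at hy3
  obtain ⟨κ, l, a, b, hs, hr⟩ := exists_isNormRelation hD hκ
    (mul_ne_zero hm1 (mul_ne_zero hyr0 hy30)) h.natDegree_left hdvd
  have hma : ∀ x : ℝ, aeval x m = m.coeff 1 * (x - r) := by
    intro x
    conv_lhs => rw [hmr]
    simp
  have ha3 := hr.coeff_three_sq hm.le
  have hl : 0 < l := by
    refine hr.pos hD ?_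
    rcases lt_or_gt_of_ne (show κ * m.coeff 1 ≠ 0 from
      mul_ne_zero (left_ne_zero_of_mul hs.ne') hm1) with h1 | h1
    · exact infinite_setOf_mul_aeval_neg (by omega) (by rw [leadingCoeff, hm]; exact h1)
    · refine (Set.Iio_infinite (r : ℝ)).mono fun x hx => ?_
      rw [Set.mem_ofPred_eq, hma, ← mul_assoc]
      exact mul_neg_of_pos_of_neg (by exact_mod_cast h1) (by linarith [Set.mem_Iio.mp hx])
  have ha30 : a.coeff 3 ≠ 0 := by
    intro h0
    rw [h0] at ha3
    norm_num at ha3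
    exact hl.ne ha3
  have hd : (a.map (algebraMap ℚ ℝ)).natDegree ≤ 3 := (natDegree_map_le).trans hr.natDegree_left
  have h3R : (a.map (algebraMap ℚ ℝ)).coeff 3 ≠ 0 := by
    rw [coeff_map]; simpa using ha30
  have hev : (a.map (algebraMap ℚ ℝ)).eval (r : ℝ) = ((a.eval r : ℚ) : ℝ) := by
    rw [← eq_ratCast (algebraMap ℚ ℝ) r, eval_map_apply, eq_ratCast]
  have hsign : 0 < a.eval r * (a.coeff 3 * y.coeff 3) * y.eval r := by
    rcases lt_or_gt_of_ne (show κ * m.coeff 1 ≠ 0 from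
      mul_ne_zero (left_ne_zero_of_mul hs.ne') hm1) with h1 | h1
    · have e1 := eval_mul_coeff_three_neg hd h3R fun x (hx : x ≤ r) => hr.eval_ne_zero hD hl (by
        rw [hma, ← mul_assoc]
        exact mul_nonneg_of_nonpos_of_nonpos (by exact_mod_cast h1.le) (by linarith))
      rw [hev, coeff_map, eq_ratCast] at e1
      have e2 : a.eval r * a.coeff 3 < 0 := by exact_mod_cast e1
      have e3 : y.eval r * y.coeff 3 < 0 := by
        by_contra hn
        nlinarith [mul_nonneg (neg_nonneg.mpr h1.le) (not_lt.mp hn)]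
      nlinarith [mul_pos_of_neg_of_neg e2 e3]
    · have e1 := eval_mul_coeff_three_pos hd h3R fun x (hx : r ≤ x) => hr.eval_ne_zero hD hl (by
        rw [hma, ← mul_assoc]
        exact mul_nonneg (by exact_mod_cast h1.le) (by linarith))
      rw [hev, coeff_map, eq_ratCast] at e1
      have e2 : 0 < a.eval r * a.coeff 3 := by exact_mod_cast e1
      have e3 : 0 < y.eval r * y.coeff 3 := by
        by_contra hn
        nlinarith [mul_nonneg h1.le (neg_nonneg.mpr (not_lt.mp hn))]
      nlinarith [mul_pos e2 e3]
  have har : a.eval r ^ 2 = l * (sextic ℚ D).eval r := by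
    have := congrArg (eval r) hr.eq
    simpa only [eval_sub, eval_mul, eval_pow, eval_C, hr0, mul_zero, zero_mul, sub_zero] using this
  set e := a.coeff 3 * y.coeff 3 with he
  have hae : a.eval r = e * y.eval r := by
    have : (a.eval r - e * y.eval r) * (a.eval r + e * y.eval r) = 0 := by
      rw [he]
      linear_combination har - l * hyr - ha3 * y.eval r ^ 2 - a.coeff 3 ^ 2 * y.eval r ^ 2 * hy3
    rcases mul_eq_zero.mp this with h1 | h1
    · linear_combination h1
    · have : a.eval r = - (e * y.eval r) := by linear_combination h1
      rw [this] at hsign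
      nlinarith [sq_nonneg (e * y.eval r)]
  have hle : l = e ^ 2 := by rw [he, mul_pow, hy3, ha3, mul_one]
  refine hr.exists_half (e := e) (mul_ne_zero ha30 hy30) hle ?_
  obtain ⟨w, hw⟩ : m ∣ a - C e * y := by
    rw [hmr]
    refine (IsUnit.mul_left_dvd (isUnit_C.mpr (isUnit_iff_ne_zero.mpr hm1))).mpr ?_
    rw [dvd_iff_isRoot, IsRoot, eval_sub, eval_mul, eval_C, hae, sub_self]
  refine ⟨w, natDegree_le_of_mul_le h.ne_zero hm ?_, by linear_combination hw⟩
  rw [← hw]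
  have h3 : (a - C e * y).natDegree ≤ 3 := (natDegree_sub_le _ _).trans
    (max_le hr.natDegree_left ((natDegree_C_mul_le _ _).trans h.natDegree_right))
  refine natDegree_le_pred h3 ?_
  rw [coeff_sub, coeff_C_mul, he]
  linear_combination -a.coeff 3 * hy3

theorem isHalvable_of_natDegree_eq_zero (hD : 0 < D) (h : IsPair D m y) (hm : m.natDegree = 0)
    (hκ : κ ≠ 0) (hdvd : sextic ℚ D ∣ m - C κ * η ^ 2) : IsHalvable D m y := by
  obtain ⟨m0, rfl⟩ := natDegree_eq_zero.mp hm
  have hm0 : m0 ≠ 0 := C_ne_zero.mp h.ne_zero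
  obtain ⟨κ, l, a, b, hs, hr⟩ := exists_isNormRelation hD hκ (neg_ne_zero.mpr hm0)
    h.natDegree_left hdvd
  have hl : 0 < l := by
    refine hr.pos hD (Set.infinite_univ.mono fun x _ => ?_)
    rw [Set.mem_ofPred_eq, aeval_C, eq_ratCast]
    have : κ * m0 < 0 := by linarith
    exact_mod_cast this
  have ha3 := hr.coeff_three_sq (by omega)
  have hy3 := h.coeff_three_sq (by omega)
  have ha30 : a.coeff 3 ≠ 0 := by
    intro h0
    rw [h0] at ha3
    norm_num at ha3
    exact hl.ne ha3
  have hy30 : y.coeff 3 ≠ 0 := by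
    intro h0
    rw [h0] at hy3
    norm_num at hy3
  have ha2 : a.coeff 2 = a.coeff 3 := by
    have := congrArg (fun p => p.coeff 5) hr.eq
    have h2 : (C m0 * b ^ 2).coeff 5 = 0 := coeff_eq_zero_of_natDegree_lt (lt_of_le_of_lt
      (natDegree_mul_le_of_le hm.le (natDegree_pow_le_of_le 2 hr.natDegree_right)) (by norm_num))
    simp only [coeff_sub, coeff_C_mul _ (a := κ), mul_assoc, sextic_coeff_five, h2,
      coeff_five_sq hr.natDegree_left, coeff_C_mul _ (a := l)] at this
    refine mul_left_cancel₀ ha30 ?_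
    linear_combination this / 2 - ha3
  have hy2 : y.coeff 2 = y.coeff 3 := by
    obtain ⟨n, hn, hy⟩ := h.exists_eq_mul
    have := congrArg (fun p => p.coeff 5) hy
    have h2 : (C m0 * n).coeff 5 = 0 := coeff_eq_zero_of_natDegree_lt (lt_of_le_of_lt
      (natDegree_mul_le_of_le hm.le hn) (by norm_num))
    simp only [coeff_sub, sextic_coeff_five, h2, coeff_five_sq h.natDegree_right] at this
    refine mul_left_cancel₀ hy30 ?_
    linear_combination this / 2 - hy3
  set e := a.coeff 3 * y.coeff 3 with he
  refine hr.exists_half (e := e) (mul_ne_zero ha30 hy30)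
    (by rw [he, mul_pow, hy3, ha3, mul_one]) ?_
  have h1 : C m0 * C m0⁻¹ = 1 := by rw [← C_mul, mul_inv_cancel₀ hm0, C_1]
  refine ⟨C m0⁻¹ * (a - C e * y), (natDegree_C_mul_le _ _).trans ?_,
    by linear_combination -(a - C e * y) * h1⟩
  have h3 : (a - C e * y).natDegree ≤ 3 := (natDegree_sub_le _ _).trans
    (max_le hr.natDegree_left ((natDegree_C_mul_le _ _).trans h.natDegree_right))
  refine natDegree_le_pred (n := 2) (natDegree_le_pred h3 ?_) ?_
  · rw [coeff_sub, coeff_C_mul, he]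
    linear_combination -a.coeff 3 * hy3
  · rw [coeff_sub, coeff_C_mul, he, ha2, hy2]
    linear_combination -a.coeff 3 * hy3

theorem IsPair.isHalvable (h : IsPair D m y) (hD : 0 < D) (hκ : κ ≠ 0)
    (hdvd : sextic ℚ D ∣ m - C κ * η ^ 2) : IsHalvable D m y := by
  have := h.natDegree_left
  interval_cases hm : m.natDegree
  · exact isHalvable_of_natDegree_eq_zero hD h hm hκ hdvd
  · exact isHalvable_of_natDegree_eq_one hD h hm hκ hdvd
  · exact isHalvable_of_natDegree_eq_two hD h hm hκ hdvd

theorem IsPair.not_integralUpTo (hD : D = 1 ∨ D = 2) (j : ℕ) : ∀ {m y : ℚ[X]}, IsPair D m y →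
    ¬HasReduction m y → ¬IntegralUpTo j m y := by
  have hD0 : 0 < D := by omega
  induction j with
  | zero => exact fun h hr => (h.not_integralUpTo_zero_and_dvd hD hr).1
  | succ j ih =>
    intro m y h hr hj
    obtain ⟨_, κ, η, hκ, hdvd⟩ := h.not_integralUpTo_zero_and_dvd hD hr
    obtain ⟨κ, b, w, hb0, hb, hw, hyw, heq⟩ := h.isHalvable hD0 hκ hdvd
    have hra : ¬HasReduction m (y + m * w) := fun h1 => hr (by
      have := h1.add_mul (w' := -w) (by rwa [natDegree_neg])
      rwa [show y + m * w + m * -w = y by ring] at this)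
    have hrb : ¬HasReduction b (y + m * w) := fun h1 => hra (h1.of_half h.natDegree_left hb0 hb heq)
    have hp : IsPair D b (y + m * w) := ⟨hb0, hb, hyw, C κ * m * b, natDegree_mul_le_of_le
      ((natDegree_C_mul_le _ _).trans h.natDegree_left) hb, by rw [heq]; ring⟩
    exact ih hp hrb (IntegralUpTo.half h.natDegree_left hyw hb0 hb heq
      (hp.not_integralUpTo_zero_and_dvd hD hrb).1 (hj.add_mul hw))

theorem IsPair.hasReduction (h : IsPair D m y) (hD : D = 1 ∨ D = 2) : HasReduction m y := by
  by_contra hr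
  obtain ⟨j, hj⟩ := exists_integralUpTo m y
  exact h.not_integralUpTo hD j hr hj

end

section

variable {D : ℤ}

theorem eval_toRat (p : OddDen[X]) (t : OddDen) : (toRat p).eval (t : ℚ) = p.eval t :=
  eval_map_apply (f := OddDen.subtype) t

theorem residue_eval (p : OddDen[X]) (t : OddDen) : residue (p.eval t) = (red p).eval (residue t) :=
  (eval_map_apply (f := residue) t).symm

theorem eval_sextic {S : Type*} [CommRing S] (D : ℤ) (t : S) : (sextic S D).eval t =
    (t ^ 3 + t ^ 2 - 2 * t - 1) ^ 2 + 4 * D * (t ^ 2 + t) ^ 2 := by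
  simp [sextic]

theorem eval_cubic {S : Type*} [CommRing S] (t : S) : (cubic S).eval t = t ^ 3 + t ^ 2 + 1 := by
  simp [cubic]

theorem natDegree_sq_sub_sextic_le {S : Type*} [CommRing S] [Nontrivial S] {y : S[X]}
    (hy : y.natDegree ≤ 3) : (y ^ 2 - sextic S D).natDegree ≤ 6 :=
  (natDegree_sub_le _ _).trans
    (max_le (natDegree_pow_le_of_le 2 hy) (sextic_natDegree D).le)

theorem sq_ne_eval_sextic_of_even (hD : D = 1 ∨ D = 2) {t Y : OddDen} (ht : residue t = 0)
    (ht0 : (t : ℚ) ≠ 0) (hY : residue Y = 0) :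
    (((cubic OddDen).eval t + 2 * Y : OddDen) : ℚ) ^ 2 ≠ (sextic ℚ D).eval (t : ℚ) := by
  intro h
  set u : ℚ := (((cubic OddDen).eval t + 2 * Y : OddDen) : ℚ) with hu
  set m : ℚ[X] := X * (X - C (t : ℚ)) with hm
  set y : ℚ[X] := -1 + C ((u + 1) / t) * X with hy
  have hm2 : m.natDegree = 2 := by
    rw [hm, natDegree_mul X_ne_zero (X_sub_C_ne_zero _), natDegree_X, natDegree_X_sub_C]
  have hm0 : m ≠ 0 := mul_ne_zero X_ne_zero (X_sub_C_ne_zero _)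
  have hy3 : y.natDegree ≤ 3 := by
    refine le_trans (?_ : _ ≤ 1) (by norm_num)
    rw [hy]
    compute_degree
  have hy0 : y.eval 0 = -1 := by rw [hy]; simp
  have hyt : y.eval (t : ℚ) = u := by
    rw [hy]
    simp
    field_simp
    ring
  have hp : IsPair D m y := by
    obtain ⟨n, hn⟩ : m ∣ y ^ 2 - sextic ℚ D := by
      rw [hm]
      refine IsCoprime.mul_dvd ?_ ?_ ?_
      · have := isCoprime_X_sub_C_of_isUnit_sub (R := ℚ) (a := 0) (b := t)
          (by rw [zero_sub]; exact (isUnit_iff_ne_zero.mpr ht0).neg)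
        rwa [C_0, sub_zero] at this
      · rw [X_dvd_iff, coeff_zero_eq_eval_zero, eval_sub, eval_pow, hy0, eval_sextic]
        norm_num
      · rw [dvd_iff_isRoot, IsRoot, eval_sub, eval_pow, hyt, h, sub_self]
    refine ⟨hm0, hm2.le, hy3, n, natDegree_le_of_mul_le hm0 hm2 ?_, hn⟩
    rw [← hn]
    exact natDegree_sq_sub_sextic_le hy3
  obtain ⟨Z, w, hw, hred⟩ := hp.hasReduction hD
  have e0 := congrArg (eval ((0 : OddDen) : ℚ)) hred
  have et := congrArg (eval (t : ℚ)) hred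
  rw [hm] at e0 et
  simp only [eval_add, eval_mul, eval_ofNat, eval_X, eval_sub, eval_C, sub_self, mul_zero, zero_mul,
    add_zero, eval_toRat, ← toRat_cubic, hyt] at e0 et
  rw [ZeroMemClass.coe_zero, zero_mul, zero_mul, add_zero, hy0] at e0
  have f0 : Z.eval 0 = -1 := by
    ext
    have : (((cubic OddDen).eval 0 : OddDen) : ℚ) = 1 := by rw [eval_cubic]; simp
    rw [this] at e0
    push_cast
    linarith
  have ft : Z.eval t = Y := by
    ext
    rw [hu] at et
    push_cast at et
    rw [show ((2 : OddDen) : ℚ) = 2 from rfl] at et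
    linarith
  have g0 := residue_eval Z 0
  have gt := residue_eval Z t
  rw [f0, map_neg, map_one, map_zero] at g0
  rw [ft, ht, hY, ← g0] at gt
  exact absurd gt (by decide)

theorem sq_ne_eval_sextic_of_residue_eq_zero (hD : D = 1 ∨ D = 2) {t : OddDen}
    (ht : residue t = 0) (ht0 : (t : ℚ) ≠ 0) (u : ℚ) : u ^ 2 ≠ (sextic ℚ D).eval (t : ℚ) := by
  intro h
  have hsx : (sextic ℚ D).eval (t : ℚ) = ((sextic OddDen D).eval t : OddDen) := by
    rw [← toRat_sextic, eval_toRat]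
  have hu : u ∈ OddDen := mem_of_isIntegral two_ne_zero (by rw [h, hsx]; exact Subtype.prop _)
  obtain ⟨u, rfl⟩ : ∃ v : OddDen, (v : ℚ) = u := ⟨⟨u, hu⟩, rfl⟩
  have h' : u ^ 2 = (sextic OddDen D).eval t := by
    ext
    rw [← hsx, ← h]
    rfl
  set q : OddDen := (cubic OddDen).eval t with hq
  set k : OddDen := t ^ 2 + t with hk
  have hsq : u ^ 2 = q ^ 2 + 4 * (k + (D - 1) * k ^ 2) := by
    rw [h', eval_sextic, hq, eval_cubic, hk]
    ring
  have h2 : residue 2 = 0 := residue_eq_zero_iff.mpr ⟨1, by ring⟩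
  have h4 : residue 4 = 0 := residue_eq_zero_iff.mpr ⟨2, by norm_num⟩
  obtain ⟨Y, hY⟩ : ∃ Y, u - q = 2 * Y := by
    refine residue_eq_zero_iff.mp ?_
    have := congrArg residue hsq
    rw [map_add, map_mul, h4, zero_mul, add_zero, map_pow, map_pow] at this
    rw [map_sub]
    generalize residue u = x at *
    generalize residue q = z at *
    revert x z
    decide
  have hYY : Y * (Y + q) = k + (D - 1) * k ^ 2 := by
    have hu : u = q + 2 * Y := by linear_combination hY
    rw [hu] at hsq
    have h40 : (4 : OddDen) ≠ 0 := four_ne_zero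
    refine mul_left_cancel₀ h40 ?_
    linear_combination hsq
  have hkr : residue k = 0 := by rw [hk, map_add, map_pow, ht]; ring
  have hpr : residue Y * (residue Y + residue q) = 0 := by
    rw [← map_add, ← map_mul, hYY, map_add, map_mul, map_pow, hkr]
    ring
  rcases mul_eq_zero.mp hpr with h1 | h1
  · refine sq_ne_eval_sextic_of_even hD ht ht0 h1 ?_
    rw [← hq, ← hY, ← h]
    congr 2
    ring
  · refine sq_ne_eval_sextic_of_even hD (Y := -Y - q) ht ht0 ?_ ?_
    · rw [map_sub, map_neg]
      linear_combination -h1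
    · rw [← hq, ← h, show q + 2 * (-Y - q) = -u by linear_combination hY, NegMemClass.coe_neg,
        neg_sq]

theorem OddDen.residue_inv_eq_zero {x : ℚ} (hx : x ∉ OddDen) :
    ∃ h : x⁻¹ ∈ OddDen, residue ⟨x⁻¹, h⟩ = 0 := by
  have h : x⁻¹ ∈ OddDen := by
    rw [mem_iff] at *
    push_cast
    rw [norm_inv]
    exact inv_le_one_of_one_le₀ (not_le.mp hx).le
  refine ⟨h, ?_⟩
  by_contra hn
  exact hx (by simpa using inv_mem h hn)

/-- The genus two curve `y ^ 2 = sextic` has only trivial rational points. -/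
theorem sq_ne_eval_sextic (hD : D = 1 ∨ D = 2) {t : ℚ} (ht0 : t ≠ 0) (ht1 : t + 1 ≠ 0) (u : ℚ) :
    u ^ 2 ≠ (sextic ℚ D).eval t := by
  intro h
  by_cases ht : t ∈ OddDen
  · by_cases hr : residue ⟨t, ht⟩ = 0
    · exact sq_ne_eval_sextic_of_residue_eq_zero hD hr ht0 u h
    · have hi := inv_mem ht hr
      refine sq_ne_eval_sextic_of_residue_eq_zero hD
        (t := -(⟨t, ht⟩ + 1) * ⟨t⁻¹, hi⟩) ?_ ?_ (u * t⁻¹ ^ 3) ?_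
      · have : residue ⟨t, ht⟩ = 1 := ZMod.eq_one_of_ne_zero_two hr
        rw [map_mul, map_neg, map_add, this, map_one]
        exact (congrArg (· * residue ⟨t⁻¹, hi⟩) (by decide : -(1 + 1 : ZMod 2) = 0)).trans (zero_mul _)
      · exact mul_ne_zero (neg_ne_zero.mpr ht1) (inv_ne_zero ht0)
      · rw [mul_pow, h, eval_sextic, eval_sextic]
        change _ = ((-(t + 1) * t⁻¹) ^ 3 + (-(t + 1) * t⁻¹) ^ 2 - 2 * (-(t + 1) * t⁻¹) - 1) ^ 2 +
          4 * D * ((-(t + 1) * t⁻¹) ^ 2 + (-(t + 1) * t⁻¹)) ^ 2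
        field_simp
        ring
  · obtain ⟨hm, hz⟩ := residue_inv_eq_zero ht
    have hs : 1 + t⁻¹ ∈ OddDen := OddDen.add_mem OddDen.one_mem hm
    have hsr : residue ⟨1 + t⁻¹, hs⟩ ≠ 0 := by
      rw [show (⟨1 + t⁻¹, hs⟩ : OddDen) = 1 + ⟨t⁻¹, hm⟩ from rfl, map_add, hz, map_one]
      decide
    have hi := inv_mem hs hsr
    have e : -t⁻¹ * (1 + t⁻¹)⁻¹ = -(t + 1)⁻¹ := by
      have : 1 + t⁻¹ = (t + 1) * t⁻¹ := by field_simp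
      rw [this, mul_inv, inv_inv]
      field_simp
    refine sq_ne_eval_sextic_of_residue_eq_zero hD
      (t := -⟨t⁻¹, hm⟩ * ⟨(1 + t⁻¹)⁻¹, hi⟩) ?_ ?_ (u * (t + 1)⁻¹ ^ 3) ?_
    · rw [map_mul, map_neg, hz, neg_zero, zero_mul]
    · change -t⁻¹ * (1 + t⁻¹)⁻¹ ≠ 0
      rw [e]
      exact neg_ne_zero.mpr (inv_ne_zero ht1)
    · change _ = (sextic ℚ D).eval (-t⁻¹ * (1 + t⁻¹)⁻¹)
      rw [mul_pow, h, e, eval_sextic, eval_sextic]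
      field_simp
      ring

end

/-- Integral pairs representing classes on `y ^ 2 = cubic ^ 2 + 4 (x ^ 2 + x)` through
`y = cubic + 2 Y`. -/
structure IsIntegralPair (M Y : OddDen[X]) : Prop where
  natDegree_left : M.natDegree ≤ 2
  natDegree_right : Y.natDegree ≤ 3
  exists_eq_mul : ∃ N : OddDen[X], N.natDegree ≤ 4 ∧ Y ^ 2 + cubic _ * Y - (X ^ 2 + X) = M * N

theorem sextic_one {S : Type*} [CommRing S] :
    sextic S 1 = cubic S ^ 2 + 4 * (X ^ 2 + X) := by
  rw [sextic, cubic]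
  simp only [Int.cast_one]
  ring

theorem exists_linear_mul_sub_mul_eq {p q r : ℚ[X]} (hp : p.natDegree = 2) (hq : q.natDegree ≤ 2)
    (hr : r.natDegree ≤ 3) (h : IsCoprime p q) :
    ∃ v w : ℚ[X], v.natDegree ≤ 1 ∧ w.natDegree ≤ 1 ∧ p * v - q * w = r := by
  obtain ⟨a, b, hab⟩ := h
  have hp0 : p ≠ 0 := by rintro rfl; simp at hp
  set w := (-b * r) % p with hw
  have hwd : w.natDegree ≤ 1 := by
    have := natDegree_mod_lt (-b * r) (q := p) (by omega)
    rw [← hw] at this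
    omega
  have hdm := EuclideanDomain.div_add_mod (-b * r) p
  rw [← hw] at hdm
  have he : p * (a * r - q * (-b * r / p)) = r + q * w := by
    linear_combination r * hab - q * hdm
  refine ⟨a * r - q * (-b * r / p), w, natDegree_le_of_mul_le hp0 hp ?_, hwd,
    by linear_combination he⟩
  rw [he]
  exact natDegree_add_le_of_degree_le hr (natDegree_mul_le_of_le hq hwd)

theorem natDegree_le_of_two_pow_mul_eq {p : ℚ[X]} {q : OddDen[X]} {i n : ℕ}
    (h : 2 ^ i * p = toRat q) (hp : p.natDegree ≤ n) : q.natDegree ≤ n := by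
  rwa [← natDegree_toRat, ← h, natDegree_two_pow_mul]

/-- Simultaneous version of clearing denominators for two polynomials, one of which does not
become even. -/
theorem exists_common_denominator {v w : ℚ[X]}
    (h : ¬∃ a b : OddDen[X], v = toRat a ∧ w = toRat b) :
    ∃ (i : ℕ) (a b : OddDen[X]), i ≠ 0 ∧ 2 ^ i * v = toRat a ∧ 2 ^ i * w = toRat b ∧
      (red a ≠ 0 ∨ red b ≠ 0) := by
  classical
  have hex : ∃ i : ℕ, ∃ a b : OddDen[X], 2 ^ i * v = toRat a ∧ 2 ^ i * w = toRat b := by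
    obtain ⟨i, a, ha⟩ := exists_pow_mul_eq_toRat v
    obtain ⟨j, b, hb⟩ := exists_pow_mul_eq_toRat w
    refine ⟨i + j, 2 ^ j * a, 2 ^ i * b, ?_, ?_⟩
    · rw [map_mul, ← ha, map_pow, map_ofNat]; ring
    · rw [map_mul, ← hb, map_pow, map_ofNat]; ring
  obtain ⟨i, ⟨a, b, ha, hb⟩, hmin⟩ : ∃ i : ℕ, (∃ a b : OddDen[X], 2 ^ i * v = toRat a ∧
      2 ^ i * w = toRat b) ∧ ∀ k < i, ¬∃ a b : OddDen[X], 2 ^ k * v = toRat a ∧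
      2 ^ k * w = toRat b :=
    ⟨Nat.find hex, Nat.find_spec hex, fun k => Nat.find_min hex⟩
  have hi : i ≠ 0 := by
    rintro rfl
    exact h ⟨a, b, by simpa using ha, by simpa using hb⟩
  refine ⟨i, a, b, hi, ha, hb, ?_⟩
  by_contra! hn
  obtain ⟨a', rfl⟩ := red_eq_zero_iff.mp hn.1
  obtain ⟨b', rfl⟩ := red_eq_zero_iff.mp hn.2
  obtain ⟨k, rfl⟩ := Nat.exists_eq_add_one_of_ne_zero hi
  refine hmin k (by omega) ⟨a', b', ?_, ?_⟩
  · rw [map_mul, map_ofNat] at ha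
    refine mul_left_cancel₀ (two_ne_zero : (2 : ℚ[X]) ≠ 0) ?_
    rw [← ha]; ring
  · rw [map_mul, map_ofNat] at hb
    refine mul_left_cancel₀ (two_ne_zero : (2 : ℚ[X]) ≠ 0) ?_
    rw [← hb]; ring

/-- The equation `(Y + M v) ^ 2 + cubic (Y + M v) - (X ^ 2 + X) = M q` after clearing
denominators. -/
theorem exists_eq_pow_mul_of_reduction {M Y N M' W Z Z₀ M'' : OddDen[X]} {i : ℕ}
    (hM : red M ≠ 0) (hW : red W ≠ 0)
    (hM'' : M' * M'' = 4 ^ i * N + 2 ^ i * (2 * Y + cubic _) * W + M * W ^ 2)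
    (hZ : 2 ^ i * (Z - Y) = M * W + M'' * Z₀) : ∃ V, M' + Z₀ * W = 2 ^ i * V := by
  have h4 : (4 : OddDen[X]) ^ i = 2 ^ i * 2 ^ i := by rw [← mul_pow]; norm_num
  rw [h4] at hM''
  have h : M * W * (M' + Z₀ * W) =
      2 ^ i * (M' * (Z - Y) - Z₀ * (2 ^ i * N + (2 * Y + cubic _) * W)) := by
    linear_combination -M' * hZ - Z₀ * hM''
  obtain ⟨V, hV, _⟩ := exists_eq_pow_mul (by rw [map_mul]; exact mul_ne_zero hM hW) h
  exact ⟨V, hV⟩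

theorem four_pow_eq {S : Type*} [CommRing S] (i : ℕ) : (4 : S) ^ i = 2 ^ i * 2 ^ i := by
  rw [← mul_pow]; norm_num

/-- Two classes with disjoint supports which agree modulo `2` differ by a class whose reduction
vanishes; there is no such class. -/
theorem IsIntegralPair.false_of_isCoprime {M₁ M₂ Y₁ Y₂ : OddDen[X]} (p₁ : IsIntegralPair M₁ Y₁)
    (p₂ : IsIntegralPair M₂ Y₂) (h₁ : M₁.natDegree = 2) (hM : red M₁ = red M₂) (hM0 : red M₁ ≠ 0)
    (hco : IsCoprime (toRat M₁) (toRat M₂)) (hY : red (Y₁ - Y₂) = cubic (ZMod 2)) : False := by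
  obtain ⟨N₁, hN₁, e₁⟩ := p₁.exists_eq_mul
  obtain ⟨N₂, hN₂, e₂⟩ := p₂.exists_eq_mul
  have f₁ := congrArg toRat e₁
  have f₂ := congrArg toRat e₂
  simp only [map_sub, map_add, map_mul, map_pow, toRat_X, toRat_cubic] at f₁ f₂
  have hnot : ∀ w g : (ZMod 2)[X], w.natDegree ≤ 2 → g.natDegree ≤ 2 → w * g ≠ cubic (ZMod 2) :=
    fun w g hw hg he => not_cubic_mul_eq one_ne_zero hw hg (by rw [mul_one, he])
  have hM0' : red M₂ ≠ 0 := hM ▸ hM0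
  have d₁ : (toRat M₁).natDegree ≤ 2 := by rw [natDegree_toRat]; exact p₁.natDegree_left
  have d₂ : (toRat M₂).natDegree ≤ 2 := by rw [natDegree_toRat]; exact p₂.natDegree_left
  have dY₁ : (toRat Y₁).natDegree ≤ 3 := by rw [natDegree_toRat]; exact p₁.natDegree_right
  have dY₂ : (toRat Y₂).natDegree ≤ 3 := by rw [natDegree_toRat]; exact p₂.natDegree_right
  have m₁0 : toRat M₁ ≠ 0 := fun h0 => hM0 (by
    rw [toRat_injective (h0.trans (map_zero _).symm), map_zero])
  have m₂0 : toRat M₂ ≠ 0 := fun h0 => hM0' (by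
    rw [toRat_injective (h0.trans (map_zero _).symm), map_zero])
  obtain ⟨v₁, v₂, hv₁, hv₂, hv⟩ := exists_linear_mul_sub_mul_eq (r := toRat Y₂ - toRat Y₁)
    (by rw [natDegree_toRat]; exact h₁) d₂ ((natDegree_sub_le _ _).trans (max_le dY₂ dY₁)) hco
  obtain ⟨i, W₁, W₂, hi, hW₁, hW₂, hne⟩ := exists_common_denominator (v := v₁) (w := v₂) (by
    rintro ⟨a, b, rfl, rfl⟩
    rw [← map_mul, ← map_mul, ← map_sub, ← map_sub, toRat_inj] at hv
    have := congrArg red hv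
    rw [natDegree_toRat] at hv₁ hv₂
    rw [map_sub, map_mul, map_mul, ← hM, ← neg_sub Y₁, map_neg, hY] at this
    refine hnot (red M₁) (red b - red a) ((natDegree_red_le _).trans p₁.natDegree_left)
      ((natDegree_sub_le _ _).trans (max_le ?_ ?_)) (by linear_combination -this)
    · exact (natDegree_red_le _).trans (by omega)
    · exact (natDegree_red_le _).trans (by omega))
  have dW₁ := natDegree_le_of_two_pow_mul_eq hW₁ hv₁
  have dW₂ := natDegree_le_of_two_pow_mul_eq hW₂ hv₂
  have hW : M₁ * W₁ - M₂ * W₂ = 2 ^ i * (Y₂ - Y₁) := by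
    refine toRat_injective ?_
    simp only [map_sub, map_mul, map_pow, map_ofNat]
    rw [← hW₁, ← hW₂]
    linear_combination 2 ^ i * hv
  have hWW : red W₁ = red W₂ := by
    have := congrArg red hW
    rw [map_sub, map_mul, map_mul, red_two_pow_mul hi, ← hM, ← mul_sub] at this
    exact sub_eq_zero.mp ((mul_eq_zero.mp this).resolve_left hM0)
  have hW0 : red W₁ ≠ 0 := by
    rcases hne with h | h
    · exact h
    · rwa [hWW]
  -- the residual polynomial `μ` on the cubic through both classes
  set U : ℚ[X] := toRat Y₁ + toRat M₁ * v₁ with hU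
  have hU₂ : U = toRat Y₂ + toRat M₂ * v₂ := by rw [hU]; linear_combination hv
  set q₁ : ℚ[X] := toRat N₁ + (2 * toRat Y₁ + cubic ℚ) * v₁ + toRat M₁ * v₁ ^ 2 with hq₁
  set q₂ : ℚ[X] := toRat N₂ + (2 * toRat Y₂ + cubic ℚ) * v₂ + toRat M₂ * v₂ ^ 2 with hq₂
  have g₁ : U ^ 2 + cubic ℚ * U - (X ^ 2 + X) = toRat M₁ * q₁ := by
    rw [hU, hq₁]; linear_combination f₁
  have g₂ : U ^ 2 + cubic ℚ * U - (X ^ 2 + X) = toRat M₂ * q₂ := by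
    rw [hU₂, hq₂]; linear_combination f₂
  obtain ⟨μ, hμ⟩ : toRat M₂ ∣ q₁ := hco.symm.dvd_of_dvd_mul_left ⟨q₂, by rw [← g₁, g₂]⟩
  have hμ₂ : q₂ = toRat M₁ * μ := mul_left_cancel₀ m₂0 (by rw [← g₂, g₁, hμ]; ring)
  have dc : (cubic ℚ).natDegree ≤ 3 := (cubic_natDegree).le
  have dq₂ : q₂.natDegree ≤ 4 := by
    refine natDegree_add_le_of_degree_le (natDegree_add_le_of_degree_le ?_ ?_) ?_
    · rwa [natDegree_toRat]
    · refine natDegree_mul_le_of_le (m := 3) (n := 1) (natDegree_add_le_of_degree_le ?_ dc) hv₂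
      rw [show (2 : ℚ[X]) = 2 ^ 1 by norm_num, natDegree_two_pow_mul]
      exact dY₂
    · exact natDegree_mul_le_of_le (m := 2) (n := 2) d₂ (natDegree_pow_le_of_le 2 hv₂)
  have dμ : μ.natDegree ≤ 2 := natDegree_le_of_mul_le m₁0 ((natDegree_toRat M₁).trans h₁)
    (by rw [← hμ₂]; exact dq₂)
  have dU : U.natDegree ≤ 3 :=
    natDegree_add_le_of_degree_le dY₁ (natDegree_mul_le_of_le d₁ hv₁)
  have heq : (cubic ℚ + 2 * U) ^ 2 - sextic ℚ 1 = μ * (4 * (toRat M₁ * toRat M₂)) := by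
    rw [sextic_one]
    linear_combination 4 * g₁ + 4 * toRat M₁ * hμ
  have hμ0 : μ ≠ 0 := by
    rintro rfl
    rw [zero_mul, sub_eq_zero] at heq
    have hirr := irreducible_sextic (D := 1) one_pos
    rw [← heq, sq] at hirr
    rcases hirr.isUnit_or_isUnit rfl with h | h <;> exact hirr.not_isUnit (h.mul h)
  have hp : IsPair 1 μ (cubic ℚ + 2 * U) := by
    refine ⟨hμ0, dμ, natDegree_add_le_of_degree_le dc ?_, _, ?_, heq⟩
    · rw [show (2 : ℚ[X]) = 2 ^ 1 by norm_num, natDegree_two_pow_mul]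
      exact dU
    · rw [show (4 : ℚ[X]) = 2 ^ 2 by norm_num, natDegree_two_pow_mul]
      exact natDegree_mul_le_of_le (m := 2) (n := 2) d₁ d₂
  obtain ⟨Z, w, hw, hred⟩ := hp.hasReduction (Or.inl rfl)
  obtain ⟨M, hμM, hM₂⟩ := exists_toRat_eq (b := M₂) (g := 4 ^ i * μ)
    (P := 4 ^ i * N₁ + 2 ^ i * (2 * Y₁ + cubic _) * W₁ + M₁ * W₁ ^ 2) hM0' (by
      simp only [map_add, map_mul, map_pow, map_ofNat, toRat_cubic]
      rw [← hW₁]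
      rw [four_pow_eq]
      linear_combination -2 ^ i * 2 ^ i * hμ)
  have hM₁ : M₁ * M = 4 ^ i * N₂ + 2 ^ i * (2 * Y₂ + cubic _) * W₂ + M₂ * W₂ ^ 2 := by
    refine toRat_injective ?_
    simp only [map_add, map_mul, map_pow, map_ofNat, toRat_cubic]
    rw [← hW₂, ← hμM]
    rw [four_pow_eq]
    linear_combination -2 ^ i * 2 ^ i * hμ₂
  have hMr : red M = red W₁ ^ 2 := by
    have := congrArg red hM₂
    rw [four_pow_eq, mul_assoc (2 ^ i), mul_assoc (2 ^ i)] at this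
    rw [map_add, map_add, red_two_pow_mul hi, red_two_pow_mul hi, map_mul, ← hM, map_mul,
      map_pow, zero_add, zero_add] at this
    exact mul_left_cancel₀ hM0 this
  have hMr0 : red M ≠ 0 := by rw [hMr]; exact pow_ne_zero 2 hW0
  obtain ⟨Z₀, hZ₀, hZM⟩ := exists_toRat_eq (b := M) (g := C (-(2 ^ i / (2 * 4 ^ i))) * w)
    (P := 2 ^ i * (Z - Y₁) - M₁ * W₁) hMr0 (by
      simp only [map_sub, map_mul, map_pow, map_ofNat]
      rw [← hW₁, ← hμM]
      have h2 : (4 : ℚ[X]) ^ i * C (-(2 ^ i / (2 * 4 ^ i))) = - 2 ^ i * C (1 / 2) := by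
        rw [show (4 : ℚ[X]) ^ i = C (4 ^ i) by rw [C_pow, map_ofNat],
          show (2 : ℚ[X]) ^ i = C (2 ^ i) by rw [C_pow, map_ofNat], ← C_neg, ← C_mul, ← C_mul]
        congr 1
        field_simp
      have h3 : (2 : ℚ[X]) * C (1 / 2) = 1 := by
        rw [← map_ofNat C 2, ← C_mul]
        norm_num
      have h4 : U - toRat Z = C (1 / 2) * μ * w := by
        linear_combination C (1 / 2) * hred - (U - toRat Z) * h3
      rw [hU] at h4
      linear_combination μ * w * h2 + 2 ^ i * h4)
  have dZ₀ : Z₀.natDegree ≤ 1 := by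
    rw [← natDegree_toRat, ← hZ₀]
    exact (natDegree_C_mul_le _ _).trans hw
  obtain ⟨V₁, hV₁⟩ := exists_eq_pow_mul_of_reduction hM0 hW0 hM₂
    (show 2 ^ i * (Z - Y₁) = M₁ * W₁ + M * Z₀ by linear_combination -hZM)
  obtain ⟨V₂, hV₂⟩ := exists_eq_pow_mul_of_reduction hM0' (hWW ▸ hW0) hM₁
    (show 2 ^ i * (Z - Y₂) = M₂ * W₂ + M * Z₀ by linear_combination -hZM + hW)
  have dV₁ : V₁.natDegree ≤ 2 := by
    rw [← natDegree_two_pow_mul i V₁, ← hV₁]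
    exact natDegree_add_le_of_degree_le p₂.natDegree_left (natDegree_mul_le_of_le dZ₀ dW₁)
  have dV₂ : V₂.natDegree ≤ 2 := by
    rw [← natDegree_two_pow_mul i V₂, ← hV₂]
    exact natDegree_add_le_of_degree_le p₁.natDegree_left (natDegree_mul_le_of_le dZ₀ dW₂)
  have hS : Y₁ - Y₂ = V₁ * W₂ - V₂ * W₁ := by
    refine mul_left_cancel₀ (pow_ne_zero i (two_ne_zero : (2 : OddDen[X]) ≠ 0)) ?_
    linear_combination hW - W₁ * hV₂ + W₂ * hV₁
  have := congrArg red hS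
  rw [hY, map_sub, map_mul, map_mul, ← hWW] at this
  refine hnot (red W₁) (red V₁ - red V₂) ((natDegree_red_le _).trans (by omega))
    ((natDegree_sub_le _ _).trans (max_le ((natDegree_red_le _).trans dV₁)
      ((natDegree_red_le _).trans dV₂))) (by rw [this]; ring)

/-- Coefficients `(m₀, m₁, m₂, c₀, c₁)` of the reductions of the known classes
`(m₀ + m₁ x + m₂ x ^ 2, c₀ + c₁ x)`. -/
def knownClasses : List (ZMod 2 × ZMod 2 × ZMod 2 × ZMod 2 × ZMod 2) :=
  [(0, 0, 1, 0, 1), (1, 0, 1, 1, 1), (1, 0, 0, 0, 0), (0, 1, 0, 0, 0), (0, 1, 0, 1, 0),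
    (1, 1, 0, 0, 0), (1, 1, 0, 1, 0), (0, 1, 1, 0, 0), (0, 1, 1, 0, 1)]

set_option synthInstance.maxSize 4000 in
set_option synthInstance.maxHeartbeats 400000 in
theorem exists_mem_knownClasses : ∀ m₀ m₁ m₂ : ZMod 2, ¬(m₀ = 0 ∧ m₁ = 0 ∧ m₂ = 0) →
    ∀ y₀ y₁ y₂ y₃ n₄ : ZMod 2, y₃ * y₃ + y₃ = m₂ * n₄ →
    ∀ n₃ : ZMod 2, y₂ + y₃ = m₁ * n₄ + m₂ * n₃ →
    ∀ n₂ : ZMod 2, y₂ * y₂ + y₁ + y₂ = m₀ * n₄ + m₁ * n₃ + m₂ * n₂ →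
    ∀ n₁ : ZMod 2, y₀ + y₁ + y₃ = m₀ * n₃ + m₁ * n₂ + m₂ * n₁ →
    ∀ n₀ : ZMod 2, y₁ * y₁ + y₀ + y₂ + 1 = m₀ * n₂ + m₁ * n₁ + m₂ * n₀ →
    y₁ + 1 = m₀ * n₁ + m₁ * n₀ → y₀ * y₀ + y₀ = m₀ * n₀ →
    ∃ z₀ z₁ ε c₀ c₁ : ZMod 2, (m₀, m₁, m₂, c₀, c₁) ∈ knownClasses ∧ y₃ = ε + m₂ * z₁ ∧
      y₂ = ε + m₁ * z₁ + m₂ * z₀ ∧ y₁ = c₁ + m₀ * z₁ + m₁ * z₀ ∧ y₀ = c₀ + ε + m₀ * z₀ := by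
  decide +kernel

theorem exists_coeff_mem_knownClasses {m y n : (ZMod 2)[X]} (hm0 : m ≠ 0) (hm : m.natDegree ≤ 2)
    (hy : y.natDegree ≤ 3) (hn : n.natDegree ≤ 4)
    (h : y ^ 2 + cubic _ * y - (X ^ 2 + X) = m * n) :
    ∃ (ε c₀ c₁ : ZMod 2) (z : (ZMod 2)[X]), z.natDegree ≤ 1 ∧
      (m.coeff 0, m.coeff 1, m.coeff 2, c₀, c₁) ∈ knownClasses ∧
      y = C c₀ + C c₁ * X + C ε * cubic _ + m * z := by
  have h2 : (2 : ZMod 2) = 0 := rfl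
  have hm' (i : ℕ) (hi : 2 < i) : m.coeff i = 0 := coeff_eq_zero_of_natDegree_lt (by omega)
  have hy' (i : ℕ) (hi : 3 < i) : y.coeff i = 0 := coeff_eq_zero_of_natDegree_lt (by omega)
  have hn' (i : ℕ) (hi : 4 < i) : n.coeff i = 0 := coeff_eq_zero_of_natDegree_lt (by omega)
  have hc : cubic (ZMod 2) * y = X ^ 3 * y + X ^ 2 * y + y := by rw [cubic]; ring
  rw [hc] at h
  have hco (i : ℕ) := congrArg (fun p => p.coeff i) h
  simp only [sq y, coeff_sub, coeff_add, coeff_mul, coeff_X_pow, coeff_X] at hco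
  have k0 := hco 0
  have k1 := hco 1
  have k2 := hco 2
  have k3 := hco 3
  have k4 := hco 4
  have k5 := hco 5
  have k6 := hco 6
  simp [Finset.Nat.antidiagonal_succ, hm', hy', hn'] at k0 k1 k2 k3 k4 k5 k6
  obtain ⟨z₀, z₁, ε, c₀, c₁, hmem, e3, e2, e1, e0⟩ := exists_mem_knownClasses (m.coeff 0) (m.coeff 1)
    (m.coeff 2) (fun h0 => hm0 (by rw [eq_quadratic hm, h0.1, h0.2.1, h0.2.2]; simp))
    (y.coeff 0) (y.coeff 1) (y.coeff 2) (y.coeff 3) (n.coeff 4)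
    (by linear_combination k6) (n.coeff 3)
    (by linear_combination k5 - y.coeff 2 * y.coeff 3 * h2) (n.coeff 2)
    (by linear_combination k4 - y.coeff 1 * y.coeff 3 * h2) (n.coeff 1)
    (by linear_combination k3 - (y.coeff 0 * y.coeff 3 + y.coeff 1 * y.coeff 2) * h2) (n.coeff 0)
    (by linear_combination k2 + (1 - y.coeff 0 * y.coeff 2) * h2)
    (by linear_combination k1 + (1 - y.coeff 0 * y.coeff 1) * h2)
    (by linear_combination k0)
  refine ⟨ε, c₀, c₁, C z₀ + C z₁ * X, by compute_degree, hmem, ?_⟩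
  have hyc : y = C (y.coeff 0) + C (y.coeff 1) * X + C (y.coeff 2) * X ^ 2 + C (y.coeff 3) * X ^ 3 := by
    conv_lhs => rw [y.as_sum_range' 4 (by omega)]
    simp [Finset.sum_range_succ, ← C_mul_X_pow_eq_monomial]
  rw [e0, e1, e2, e3] at hyc
  rw [hyc, cubic]
  conv_rhs => rw [eq_quadratic hm]
  simp only [C_add, C_mul]
  ring

theorem exists_isIntegralPair_of_mem_knownClasses {m : (ZMod 2)[X]} (hm : m.natDegree ≤ 2)
    {c₀ c₁ : ZMod 2} (h : (m.coeff 0, m.coeff 1, m.coeff 2, c₀, c₁) ∈ knownClasses) :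
    ∃ M Y : OddDen[X], IsIntegralPair M Y ∧ red M = m ∧ red Y = C c₀ + C c₁ * X ∧
      M ∣ (X * (X + 1)) ^ 2 := by
  have key (M Y N : OddDen[X]) (hM : M.natDegree ≤ 2) (hY : Y.natDegree ≤ 3) (hN : N.natDegree ≤ 4)
      (e : Y ^ 2 + cubic _ * Y - (X ^ 2 + X) = M * N) : IsIntegralPair M Y := ⟨hM, hY, N, hN, e⟩
  rw [Polynomial.eq_quadratic hm]
  simp only [knownClasses, List.mem_cons, Prod.mk.injEq, List.not_mem_nil, or_false] at h
  rcases h with ⟨h0, h1, h2, rfl, rfl⟩ | ⟨h0, h1, h2, rfl, rfl⟩ | ⟨h0, h1, h2, rfl, rfl⟩ |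
    ⟨h0, h1, h2, rfl, rfl⟩ | ⟨h0, h1, h2, rfl, rfl⟩ | ⟨h0, h1, h2, rfl, rfl⟩ |
    ⟨h0, h1, h2, rfl, rfl⟩ | ⟨h0, h1, h2, rfl, rfl⟩ | ⟨h0, h1, h2, rfl, rfl⟩ <;>
  simp only [h0, h1, h2, C_0, C_1, zero_mul, one_mul, zero_add, add_zero]
  · exact ⟨X ^ 2, X, key _ _ (X ^ 2 + X) (by compute_degree) (by compute_degree!)
      (by compute_degree!) (by rw [cubic]; ring), by simp, by simp, (X + 1) ^ 2, by ring⟩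
  · refine ⟨(X + 1) ^ 2, -(X + 1), key _ _ (-X ^ 2) (by compute_degree) (by compute_degree!)
      (by compute_degree!) (by rw [cubic]; ring), ?_, ?_, X ^ 2, by ring⟩
    · simp [CharTwo.add_sq, add_comm]
    · simp [CharTwo.neg_eq, add_comm]
  · exact ⟨1, 0, key _ _ (-(X ^ 2 + X)) (by simp) (by compute_degree!)
      (by compute_degree!) (by rw [cubic]; ring), by simp, by simp, one_dvd _⟩
  · exact ⟨X, 0, key _ _ (-(X + 1)) (by compute_degree!) (by compute_degree!)
      (by compute_degree!) (by rw [cubic]; ring), by simp, by simp, X * (X + 1) ^ 2, by ring⟩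
  · exact ⟨X, -1, key _ _ (-(X + 1) ^ 2) (by compute_degree!) (by compute_degree!)
      (by compute_degree!) (by rw [cubic]; ring), by simp, by simp [CharTwo.neg_eq],
      X * (X + 1) ^ 2, by ring⟩
  · exact ⟨X + 1, 0, key _ _ (-X) (by compute_degree!) (by compute_degree!)
      (by compute_degree!) (by rw [cubic]; ring), by simp [add_comm], by simp,
      X ^ 2 * (X + 1), by ring⟩
  · exact ⟨X + 1, -1, key _ _ (-(X * (X + 1))) (by compute_degree!) (by compute_degree!)
      (by compute_degree!) (by rw [cubic]; ring), by simp [add_comm], by simp [CharTwo.neg_eq],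
      X ^ 2 * (X + 1), by ring⟩
  · exact ⟨X + X ^ 2, 0, key _ _ (-1) (by compute_degree!) (by compute_degree!)
      (by compute_degree!) (by rw [cubic]; ring), by simp, by simp, X + X ^ 2, by ring⟩
  · exact ⟨X + X ^ 2, X, key _ _ (X ^ 2) (by compute_degree!) (by compute_degree!)
      (by compute_degree!) (by rw [cubic]; ring), by simp, by simp, X + X ^ 2, by ring⟩

theorem IsIntegralPair.neg_sub {M Y : OddDen[X]} (h : IsIntegralPair M Y) :
    IsIntegralPair M (-cubic _ - Y) := by
  obtain ⟨N, hN, e⟩ := h.exists_eq_mul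
  refine ⟨h.natDegree_left, (natDegree_sub_le _ _).trans (max_le ?_ h.natDegree_right), N, hN, ?_⟩
  · rw [natDegree_neg, cubic_natDegree]
  · linear_combination e

theorem IsIntegralPair.add_mul {M Y Z : OddDen[X]} (h : IsIntegralPair M Y)
    (hZ : Z.natDegree ≤ 1) : IsIntegralPair M (Y + M * Z) := by
  obtain ⟨N, hN, e⟩ := h.exists_eq_mul
  have hc : (cubic OddDen).natDegree ≤ 3 := cubic_natDegree.le
  refine ⟨h.natDegree_left, natDegree_add_le_of_degree_le h.natDegree_right
    (natDegree_mul_le_of_le (m := 2) (n := 1) h.natDegree_left hZ),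
    N + (2 * Y + cubic _) * Z + M * Z ^ 2, ?_, by linear_combination e⟩
  refine natDegree_add_le_of_degree_le (natDegree_add_le_of_degree_le hN
    (natDegree_mul_le_of_le (m := 3) (n := 1) (natDegree_add_le_of_degree_le ?_ hc) hZ))
    (natDegree_mul_le_of_le (m := 2) (n := 2) h.natDegree_left (natDegree_pow_le_of_le 2 hZ))
  rw [show (2 : OddDen[X]) = 2 ^ 1 by norm_num, natDegree_two_pow_mul]
  exact h.natDegree_right

theorem IsPair.exists_isIntegralPair {m y : ℚ[X]} (h : IsPair 1 m y) :
    ∃ (c : ℚ) (M Y : OddDen[X]), c ≠ 0 ∧ m = C c * toRat M ∧ red M ≠ 0 ∧ IsIntegralPair M Y := by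
  obtain ⟨c, M, hc, rfl, hM⟩ := exists_primitive h.ne_zero
  obtain ⟨Y, w, hw, hy⟩ := h.hasReduction (Or.inl rfl)
  obtain ⟨n, hn, e⟩ := h.exists_eq_mul
  have dM : (C c * toRat M).natDegree ≤ 2 := h.natDegree_left
  have dM' : M.natDegree ≤ 2 := by rwa [natDegree_C_mul hc, natDegree_toRat] at dM
  have dc : (cubic ℚ).natDegree ≤ 3 := cubic_natDegree.le
  have dY : Y.natDegree ≤ 3 := by
    rw [← natDegree_toRat, ← natDegree_two_pow_mul 1,
      show 2 ^ 1 * toRat Y = y - cubic ℚ - C c * toRat M * w by rw [hy]; ring]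
    exact (natDegree_sub_le _ _).trans (max_le ((natDegree_sub_le _ _).trans
      (max_le h.natDegree_right dc)) (natDegree_mul_le_of_le (m := 2) (n := 1) dM hw))
  obtain ⟨N, hN, hMN⟩ := exists_toRat_eq (P := Y ^ 2 + cubic _ * Y - (X ^ 2 + X))
    (g := C (1 / 4) * (C c * (n - 2 * (cubic ℚ + 2 * toRat Y) * w - C c * toRat M * w ^ 2))) hM (by
      simp only [map_sub, map_add, map_mul, map_pow, toRat_X, toRat_cubic]
      have h4 : (4 : ℚ[X]) * C (1 / 4) = 1 := by
        rw [← map_ofNat C 4, ← C_mul]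
        norm_num
      rw [sextic_one, hy] at e
      linear_combination -C (1 / 4) * e +
        (toRat Y ^ 2 + cubic ℚ * toRat Y - (X ^ 2 + X)) * h4)
  refine ⟨c, M, Y, hc, rfl, hM, dM', dY, N, ?_, hMN.symm⟩
  rw [← natDegree_toRat, ← hN]
  refine (natDegree_C_mul_le _ _).trans ((natDegree_C_mul_le _ _).trans
    ((natDegree_sub_le _ _).trans (max_le ((natDegree_sub_le _ _).trans (max_le hn ?_)) ?_)))
  · refine natDegree_mul_le_of_le (m := 3) (n := 1) ?_ hw
    rw [show (2 : ℚ[X]) = 2 ^ 1 by norm_num, natDegree_two_pow_mul]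
    refine natDegree_add_le_of_degree_le dc ?_
    rwa [natDegree_two_pow_mul, natDegree_toRat]
  · exact natDegree_mul_le_of_le (m := 2) (n := 2) dM (natDegree_pow_le_of_le 2 hw)

theorem not_isPair_of_irreducible {m y : ℚ[X]} (hm : Irreducible m) (hm2 : m.natDegree = 2) :
    ¬IsPair 1 m y := by
  intro h
  obtain ⟨c, M, Y, hc, rfl, hM0, hp⟩ := h.exists_isIntegralPair
  have dM : M.natDegree = 2 := by rwa [natDegree_C_mul hc, natDegree_toRat] at hm2
  obtain ⟨N, hN, e⟩ := hp.exists_eq_mul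
  have er := congrArg red e
  simp only [map_sub, map_add, map_mul, map_pow, red_X, red_cubic] at er
  obtain ⟨ε, c₀, c₁, z, hz, hmem, hY⟩ := exists_coeff_mem_knownClasses hM0
    ((natDegree_red_le _).trans hp.natDegree_left) ((natDegree_red_le _).trans hp.natDegree_right)
    ((natDegree_red_le _).trans hN) er
  obtain ⟨M₂, Y₂, hp₂, hM₂, hY₂, hdvd⟩ := exists_isIntegralPair_of_mem_knownClasses
    ((natDegree_red_le _).trans hp.natDegree_left) hmem
  obtain ⟨Z, rfl, hZ⟩ := exists_lift z
  have hco : IsCoprime (toRat M) (toRat M₂) := by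
    have hu : Irreducible (toRat M) :=
      (irreducible_isUnit_mul (isUnit_C.mpr (isUnit_iff_ne_zero.mpr hc))).mp hm
    have hd : toRat M₂ ∣ (X * (X + 1)) ^ 2 := by
      simpa using map_dvd toRat hdvd
    refine IsCoprime.of_isCoprime_of_dvd_right (IsCoprime.pow_right (IsCoprime.mul_right ?_ ?_)) hd
    · refine (hu.coprime_iff_not_dvd).mpr fun hX => ?_
      have := natDegree_le_of_dvd hX X_ne_zero
      rw [natDegree_toRat, natDegree_X] at this
      omega
    · refine (hu.coprime_iff_not_dvd).mpr fun hX => ?_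
      have := natDegree_le_of_dvd hX (X_add_C_ne_zero 1)
      rw [natDegree_toRat, ← C_1, natDegree_X_add_C] at this
      omega
  have hp₁ := hp.add_mul (Z := -Z) (by rw [natDegree_neg]; exact hZ.trans hz)
  have hY₁ : red (Y + M * -Z) = red Y₂ + C ε * cubic _ := by
    rw [map_add, map_mul, map_neg, hY, hY₂]
    ring
  by_cases hε : ε = 0
  · refine hp₁.false_of_isCoprime hp₂.neg_sub dM hM₂.symm hM0 hco ?_
    rw [map_sub, hY₁, hε, C_0, map_sub, map_neg, red_cubic]
    linear_combination red Y₂ * (CharTwo.two_eq_zero : (2 : (ZMod 2)[X]) = 0)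
  · refine hp₁.false_of_isCoprime hp₂ dM hM₂.symm hM0 hco ?_
    rw [map_sub, hY₁, ZMod.eq_one_of_ne_zero_two hε, C_1]
    ring

theorem exists_eq_add_smul_of_finrank_eq_two {K : Type*} [Field K] [Algebra ℚ K]
    (hdeg : Module.finrank ℚ K = 2) {t : K} (ht : t ∉ Set.range (algebraMap ℚ K)) (u : K) :
    ∃ a b : ℚ, u = algebraMap ℚ K a + algebraMap ℚ K b * t := by
  have hli : LinearIndependent ℚ ![1, t] := by
    rw [LinearIndependent.pair_iff' one_ne_zero]
    intro a ha
    exact ht ⟨a, by rw [Algebra.algebraMap_eq_smul_one, ha]⟩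
  have hu : u ∈ Submodule.span ℚ (Set.range ![1, t]) := by
    have hfin : FiniteDimensional ℚ K := FiniteDimensional.of_finrank_pos (by omega)
    rw [hli.span_eq_top_of_card_eq_finrank (by simp [hdeg])]
    trivial
  rw [Matrix.range_cons_cons_empty, Submodule.mem_span_pair] at hu
  obtain ⟨a, b, h⟩ := hu
  exact ⟨a, b, by rw [← h, Algebra.smul_def, Algebra.smul_def, mul_one]⟩

/-- The curve `y ^ 2 = sextic 1` has no quadratic points with irrational first coordinate. -/
theorem sq_ne_aeval_sextic_one {K : Type*} [Field K] [Algebra ℚ K]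
    (hdeg : Module.finrank ℚ K = 2) {t : K} (ht : t ∉ Set.range (algebraMap ℚ K)) (u : K) :
    u ^ 2 ≠ (sextic K 1).eval t := by
  intro h
  have hfin : FiniteDimensional ℚ K := FiniteDimensional.of_finrank_pos (by omega)
  have h_int : IsIntegral ℚ t := Algebra.IsIntegral.isIntegral t
  have hd : (minpoly ℚ t).natDegree = 2 := by
    have h1 : (minpoly ℚ t).natDegree ≠ 1 := fun h1 => ht (minpoly.natDegree_eq_one_iff.mp h1)
    have h2 : (minpoly ℚ t).natDegree ∣ 2 := hdeg ▸ minpoly.degree_dvd h_int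
    exact ((Nat.dvd_prime Nat.prime_two).mp h2).resolve_left h1
  obtain ⟨a, b, rfl⟩ := exists_eq_add_smul_of_finrank_eq_two hdeg ht u
  have hy3 : (C a + C b * X : ℚ[X]).natDegree ≤ 3 := by compute_degree!
  obtain ⟨n, hn⟩ : minpoly ℚ t ∣ (C a + C b * X) ^ 2 - sextic ℚ 1 := by
    refine minpoly.dvd _ _ ?_
    have hs : aeval t (sextic ℚ 1) = (sextic K 1).eval t := by
      rw [← map_sextic (algebraMap ℚ K), eval_map_algebraMap]
    rw [map_sub, hs, ← h]
    simp
  refine not_isPair_of_irreducible (minpoly.irreducible h_int) hd (y := C a + C b * X)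
    ⟨minpoly.ne_zero h_int, hd.le, hy3, n, natDegree_le_of_mul_le (minpoly.ne_zero h_int) hd ?_, hn⟩
  rw [← hn]
  exact natDegree_sq_sub_sextic_le hy3

theorem Int.exists_abs_eq_sq {a b c : ℤ} (h : IsCoprime a b) (heq : a * b = c ^ 2) :
    ∃ d : ℤ, |a| = d ^ 2 := by
  obtain ⟨d, hd | hd⟩ := Int.sq_of_isCoprime h heq
  · exact ⟨d, by rw [hd, abs_of_nonneg (sq_nonneg d)]⟩
  · exact ⟨d, by rw [hd, abs_neg, abs_of_nonneg (sq_nonneg d)]⟩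

theorem isCoprime_add_sub {m n : ℤ} (h : IsCoprime m n) (hodd : Odd (m + n)) :
    IsCoprime (m + n) (m - n) := by
  have h2 : IsCoprime (m + n) 2 := by
    obtain ⟨k, hk⟩ := hodd
    exact ⟨1, -k, by rw [hk]; ring⟩
  have h3 : IsCoprime (m + n) n := by
    have := h.add_mul_right_left 1
    rwa [one_mul] at this
  have h4 := (h2.mul_right h3).neg_right.add_mul_left_right 1
  rwa [show -(2 * n) + (m + n) * 1 = m - n by ring] at h4

/-- There are no two coprime squares whose sum and difference are squares. -/
theorem not_sq_add_sq_and_sq_sub_sq (N : ℕ) : ∀ x y u v : ℤ, x.natAbs = N → IsCoprime x y → y ≠ 0 →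
    x ^ 2 + y ^ 2 = u ^ 2 → x ^ 2 - y ^ 2 ≠ v ^ 2 := by
  induction N using Nat.strong_induction_on with
  | h N ih =>
  rintro x y u v rfl hxy hy hu hv
  obtain ⟨A, hA⟩ : (2 : ℤ) ∣ u + v := by
    have h1 : (2 : ℤ) ∣ (u + v) * (u - v) := ⟨y ^ 2, by linear_combination hv - hu⟩
    rcases Int.prime_two.dvd_or_dvd h1 with h | h <;> omega
  obtain ⟨B, hB⟩ : ∃ B, B = A - v := ⟨_, rfl⟩
  obtain rfl : u = A + B := by linear_combination hA - hB
  obtain rfl : v = A - B := by linear_combination hB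
  have hsq : A * A + B * B = x * x := mul_left_cancel₀ (two_ne_zero (α := ℤ)) (by
    linear_combination -hu - hv)
  have hAB : 2 * (A * B) = y ^ 2 := mul_left_cancel₀ (two_ne_zero (α := ℤ)) (by
    linear_combination hv - hu)
  obtain ⟨k, rfl⟩ : (2 : ℤ) ∣ y := Int.prime_two.dvd_of_dvd_pow ⟨_, hAB.symm⟩
  have hk : A * B = 2 * k ^ 2 := by linarith
  have hco : IsCoprime A B := by
    refine isCoprime_of_prime_dvd ?_ fun p hp hpA hpB => hp.not_isUnit (hxy.isUnit_of_dvd' ?_ ?_)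
    · rintro ⟨rfl, rfl⟩
      refine hy (pow_eq_zero_iff two_ne_zero |>.mp ?_)
      rw [← hAB]
      ring
    · exact hp.dvd_of_dvd_pow (n := 2) (by
        rw [sq, ← hsq]; exact dvd_add (hpA.mul_right _) (hpB.mul_right _))
    · exact hp.dvd_of_dvd_pow (n := 2) (by rw [← hAB]; exact (hpA.mul_right _).mul_left _)
  obtain ⟨m, n, hmn, hx, hgcd, hpar⟩ :=
    PythagoreanTriple.coprime_classification.mp ⟨hsq, Int.isCoprime_iff_gcd_eq_one.mp hco⟩
  rw [← Int.isCoprime_iff_gcd_eq_one] at hgcd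
  have hprod : m * n * ((m + n) * (m - n)) = k ^ 2 := by
    refine mul_left_cancel₀ (two_ne_zero (α := ℤ)) ?_
    rw [← hk]
    rcases hmn with ⟨rfl, rfl⟩ | ⟨rfl, rfl⟩ <;> ring
  have hpos : 0 < m * n * ((m + n) * (m - n)) := by
    rw [hprod]
    have : k ≠ 0 := fun h0 => hy (by rw [h0, mul_zero])
    positivity
  have hx2 : x ^ 2 = (m ^ 2 + n ^ 2) ^ 2 := by
    rcases hx with rfl | rfl <;> ring
  have hodd : Odd (m + n) := by rw [Int.odd_iff]; omega
  have h1 : IsCoprime m (m + n) := by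
    simpa [add_comm] using hgcd.add_mul_left_right 1
  have h2 : IsCoprime n (m + n) := by simpa using hgcd.symm.add_mul_left_right 1
  have h3 : IsCoprime m (m - n) := by
    simpa [sub_eq_neg_add] using hgcd.neg_right.add_mul_left_right 1
  have h4 : IsCoprime n (m - n) := by
    simpa [sub_eq_add_neg] using hgcd.symm.add_mul_left_right (-1)
  have h5 := isCoprime_add_sub hgcd hodd
  obtain ⟨a, ha⟩ := Int.exists_abs_eq_sq (hgcd.mul_right (h1.mul_right h3))
    (by rw [← hprod, mul_assoc] : m * (n * ((m + n) * (m - n))) = k ^ 2)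
  obtain ⟨b, hb⟩ := Int.exists_abs_eq_sq (hgcd.symm.mul_right (h2.mul_right h4))
    (by rw [← hprod]; ring : n * (m * ((m + n) * (m - n))) = k ^ 2)
  obtain ⟨c, hc⟩ := Int.exists_abs_eq_sq ((h1.symm.mul_right h2.symm).mul_right h5)
    (by rw [← hprod]; ring : (m + n) * (m * n * (m - n)) = k ^ 2)
  obtain ⟨d, hd⟩ := Int.exists_abs_eq_sq ((h3.symm.mul_right h4.symm).mul_right h5.symm)
    (by rw [← hprod]; ring : (m - n) * (m * n * (m + n)) = k ^ 2)
  have hm0 : m ≠ 0 := by rintro rfl; simp at hpos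
  have hn0 : n ≠ 0 := by rintro rfl; simp at hpos
  have ha0 : a ≠ 0 := by rintro rfl; simp [hm0] at ha
  have hb0 : b ≠ 0 := by rintro rfl; simp [hn0] at hb
  have hab : IsCoprime a b := by
    rw [← IsCoprime.pow_iff two_pos two_pos, ← ha, ← hb]
    exact hgcd.abs_abs
  have hm1 := Int.one_le_abs hm0
  have hn1 := Int.one_le_abs hn0
  have hax : a.natAbs < x.natAbs := by
    rw [Int.natAbs_lt_iff_sq_lt, hx2, ← ha, ← sq_abs m, ← sq_abs n]
    have : |m| + 1 ≤ |m| ^ 2 + |n| ^ 2 := by nlinarith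
    nlinarith
  have hbx : b.natAbs < x.natAbs := by
    rw [Int.natAbs_lt_iff_sq_lt, hx2, ← hb, ← sq_abs m, ← sq_abs n]
    have : |n| + 1 ≤ |m| ^ 2 + |n| ^ 2 := by nlinarith
    nlinarith
  rcases lt_or_gt_of_ne (mul_ne_zero hm0 hn0) with hs | hs
  · have hs' := (neg_iff_neg_of_mul_pos hpos).mp hs
    refine ih _ hbx b a d c rfl hab.symm ha0 ?_ ?_ <;> rw [← ha, ← hb]
    · rw [← hd]
      rcases mul_neg_iff.mp hs with ⟨h, h'⟩ | ⟨h, h'⟩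
      · rw [abs_of_pos h, abs_of_neg h', abs_of_pos (by omega)]; ring
      · rw [abs_of_neg h, abs_of_pos h', abs_of_neg (by omega)]; ring
    · rw [← hc]
      rcases mul_neg_iff.mp hs with ⟨h, h'⟩ | ⟨h, h'⟩
      · rw [abs_of_pos h, abs_of_neg h', abs_of_neg (neg_of_mul_neg_left hs' (by omega))]; ring
      · rw [abs_of_neg h, abs_of_pos h', abs_of_pos (pos_of_mul_neg_left hs' (by omega))]; ring
  · have hs' := (pos_iff_pos_of_mul_pos hpos).mp hs
    refine ih _ hax a b c d rfl hab hb0 ?_ ?_ <;> rw [← ha, ← hb]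
    · rw [← hc]
      rcases mul_pos_iff.mp hs with ⟨h, h'⟩ | ⟨h, h'⟩
      · rw [abs_of_pos h, abs_of_pos h', abs_of_pos (by omega)]
      · rw [abs_of_neg h, abs_of_neg h', abs_of_neg (by omega)]; ring
    · rw [← hd]
      rcases mul_pos_iff.mp hs with ⟨h, h'⟩ | ⟨h, h'⟩
      · rw [abs_of_pos h, abs_of_pos h', abs_of_pos (pos_of_mul_pos_right hs' (by omega))]
      · rw [abs_of_neg h, abs_of_neg h', abs_of_neg (neg_of_mul_pos_right hs' (by omega))]; ring

theorem sq_ne_sq_add_one_mul_sq_add_two (a w : ℚ) : w ^ 2 ≠ (a ^ 2 + 1) * (a ^ 2 + 2) := by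
  intro h
  set p := a.num with hp
  set q := (a.den : ℤ) with hq
  have hq0 : q ≠ 0 := by simp [hq]
  have ha : a = p / q := by rw [hp, hq]; exact_mod_cast (Rat.num_div_den a).symm
  have hpq : IsCoprime p q := Int.isCoprime_iff_gcd_eq_one.mpr a.reduced
  obtain ⟨W, hW⟩ : ∃ W : ℤ, (p ^ 2 + q ^ 2) * (p ^ 2 + 2 * q ^ 2) = W ^ 2 := by
    have h1 : (((p ^ 2 + q ^ 2) * (p ^ 2 + 2 * q ^ 2) : ℤ) : ℚ) = (w * q ^ 2) ^ 2 := by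
      have : (q : ℚ) ≠ 0 := by exact_mod_cast hq0
      rw [mul_pow, h, ha]
      push_cast
      field_simp
    obtain ⟨W, hW⟩ := Rat.isSquare_intCast_iff.mp ⟨w * q ^ 2, by rw [h1, sq]⟩
    exact ⟨W, by rw [hW, sq]⟩
  have hco : IsCoprime (p ^ 2 + q ^ 2) (p ^ 2 + 2 * q ^ 2) := by
    have h1 : IsCoprime (p ^ 2 + q ^ 2) (q ^ 2) := by
      simpa using (hpq.pow (m := 2) (n := 2)).add_mul_right_left 1
    have h2 := h1.add_mul_left_right 1
    rwa [show q ^ 2 + (p ^ 2 + q ^ 2) * 1 = p ^ 2 + 2 * q ^ 2 by ring] at h2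
  obtain ⟨r, hr⟩ := Int.exists_abs_eq_sq hco hW
  obtain ⟨s, hs⟩ := Int.exists_abs_eq_sq hco.symm (by rw [mul_comm]; exact hW)
  rw [abs_of_nonneg (by positivity)] at hr hs
  refine not_sq_add_sq_and_sq_sub_sq _ r q s p rfl ?_ hq0 (by rw [← hr, ← hs]; ring)
    (by rw [← hr]; ring)
  rw [← IsCoprime.pow_iff two_pos two_pos, ← hr]
  simpa using (hpq.pow (m := 2) (n := 2)).add_mul_right_left 1

theorem isSquare_or_isSquare_of_finrank_eq_two {K : Type*} [Field K] [Algebra ℚ K]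
    (hdeg : Module.finrank ℚ K = 2) {p q : ℚ} {x y : K} (hx : x ^ 2 = algebraMap ℚ K p)
    (hy : y ^ 2 = algebraMap ℚ K q) : ∃ w : ℚ, w ^ 2 = p ∨ w ^ 2 = q ∨ w ^ 2 = p * q := by
  have hinj := (algebraMap ℚ K).injective
  by_cases hxr : x ∈ Set.range (algebraMap ℚ K)
  · obtain ⟨w, rfl⟩ := hxr
    exact ⟨w, Or.inl (hinj (by rw [map_pow, hx]))⟩
  obtain ⟨a, b, rfl⟩ := exists_eq_add_smul_of_finrank_eq_two hdeg hxr y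
  have hab : a * b = 0 := by
    by_contra h0
    have h2 : algebraMap ℚ K (2 * (a * b)) ≠ 0 :=
      (_root_.map_ne_zero _).mpr (mul_ne_zero two_ne_zero h0)
    refine hxr ⟨(q - a ^ 2 - b ^ 2 * p) / (2 * (a * b)), ?_⟩
    rw [map_div₀, div_eq_iff h2]
    simp only [map_sub, map_mul, map_pow, map_ofNat]
    linear_combination -hy + algebraMap ℚ K b ^ 2 * hx
  rcases mul_eq_zero.mp hab with rfl | rfl
  · refine ⟨b * p, Or.inr (Or.inr (hinj ?_))⟩
    simp only [map_mul, map_pow, ← hy, ← hx, map_zero]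
    ring
  · refine ⟨a, Or.inr (Or.inl (hinj ?_))⟩
    simp only [map_pow, ← hy, map_zero]
    ring

theorem HasExactPeriod.exists_sq_of_one {K : Type*} [Field K] {c α : K}
    (h : HasExactPeriod c 1 α) : ∃ r : K, r ^ 2 = 1 - 4 * c := by
  have h1 : α ^ 2 + c = α := h.1
  exact ⟨2 * α - 1, by linear_combination 4 * h1⟩

theorem HasExactPeriod.exists_sq_of_two {K : Type*} [Field K] {c β : K}
    (h : HasExactPeriod c 2 β) : ∃ s : K, s ^ 2 = -3 - 4 * c := by
  have h1 : (β ^ 2 + c) ^ 2 + c = β := h.1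
  have h2 : β ^ 2 + c - β ≠ 0 := sub_ne_zero.mpr (h.2 1 le_rfl one_lt_two)
  have h3 : β ^ 2 + c + β + 1 = 0 := mul_left_cancel₀ h2 (by linear_combination h1)
  exact ⟨2 * β + 1, by linear_combination 4 * h3⟩

theorem HasExactPeriod.exists_parameter {K : Type*} [Field K] {c γ : K}
    (h : HasExactPeriod c 3 γ) : ∃ t : K, t ≠ 0 ∧ t + 1 ≠ 0 ∧
      -4 * c * (t ^ 2 + t) ^ 2 = (t ^ 3 + t ^ 2 - 2 * t - 1) ^ 2 + 7 * (t ^ 2 + t) ^ 2 := by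
  have h1 : γ ^ 2 + c ≠ γ := h.2 1 le_rfl (by norm_num)
  have h2 : (γ ^ 2 + c) ^ 2 + c ≠ γ := h.2 2 (by norm_num) (by norm_num)
  have h3 : ((γ ^ 2 + c) ^ 2 + c) ^ 2 + c = γ := h.1
  obtain ⟨b, hb⟩ : ∃ b, b = γ ^ 2 + c := ⟨_, rfl⟩
  obtain ⟨e, he⟩ : ∃ e, e = b ^ 2 + c := ⟨_, rfl⟩
  rw [← hb] at h1 h2 h3
  rw [← he] at h2 h3
  have hd : b - γ ≠ 0 := sub_ne_zero.mpr h1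
  have h21 : e - b = (γ + b) * (b - γ) := by linear_combination he - hb
  have ht0 : γ + b ≠ 0 := by
    intro h0
    have heb : e = b := by rw [h0, zero_mul] at h21; exact sub_eq_zero.mp h21
    refine h2 ?_
    rw [heb] at h3 he
    rw [heb, he, h3]
  refine ⟨γ + b, ht0, fun h0 => h2 (by linear_combination h21 + (b - γ) * h0), ?_⟩
  have hW : ((γ + b) ^ 2 + (γ + b)) * (b - γ) = -((γ + b) ^ 2 + (γ + b) + 1) := by
    refine mul_left_cancel₀ hd ?_
    linear_combination h3 + he - (e + b + (γ + b) * (b - γ) + 1) * h21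
  have hc : c = b - γ ^ 2 := by rw [hb]; ring
  rw [hc]
  generalize hd' : b - γ = d at *
  obtain rfl : b = γ + d := by rw [← hd']; ring
  linear_combination (((γ + (γ + d)) ^ 2 + (γ + (γ + d))) * (d - 2 * (γ + (γ + d)) - 2) -
    ((γ + (γ + d)) ^ 2 + (γ + (γ + d)) + 1)) * hW

theorem no_periods_1_2_and_3 {K : Type*} [Field K] [NumberField K]
    (hdeg : Module.finrank ℚ K = 2) (c : K) :
    ¬((∃ α : K, HasExactPeriod c 1 α) ∧ (∃ β : K, HasExactPeriod c 2 β) ∧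
      (∃ γ : K, HasExactPeriod c 3 γ)) := by
  rintro ⟨⟨α, hα⟩, ⟨β, hβ⟩, γ, hγ⟩
  obtain ⟨r, hr⟩ := hα.exists_sq_of_one
  obtain ⟨s, hs⟩ := hβ.exists_sq_of_two
  obtain ⟨t, ht0, ht1, ht⟩ := hγ.exists_parameter
  have hs' : (s * (t ^ 2 + t)) ^ 2 = (sextic K 1).eval t := by
    rw [eval_sextic, mul_pow, hs, Int.cast_one]
    linear_combination ht
  have hr' : (r * (t ^ 2 + t)) ^ 2 = (sextic K 2).eval t := by
    rw [eval_sextic, mul_pow, hr, Int.cast_ofNat]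
    linear_combination ht
  by_cases htr : t ∈ Set.range (algebraMap ℚ K)
  · obtain ⟨t, rfl⟩ := htr
    have ht0 : t ≠ 0 := fun h0 => ht0 (by rw [h0, map_zero])
    have ht1 : t + 1 ≠ 0 := fun h0 => ht1 (by rw [← map_one (algebraMap ℚ K), ← map_add, h0, map_zero])
    rw [← map_sextic (algebraMap ℚ K), eval_map_apply] at hs' hr'
    obtain ⟨w, hw | hw | hw⟩ := isSquare_or_isSquare_of_finrank_eq_two hdeg hs' hr'
    · exact sq_ne_eval_sextic (Or.inl rfl) ht0 ht1 w hw
    · exact sq_ne_eval_sextic (Or.inr rfl) ht0 ht1 w hw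
    · have hW : t ^ 2 + t ≠ 0 := by
        rw [show t ^ 2 + t = t * (t + 1) by ring]
        exact mul_ne_zero ht0 ht1
      refine sq_ne_sq_add_one_mul_sq_add_two ((t ^ 3 + t ^ 2 - 2 * t - 1) / (2 * (t ^ 2 + t)))
        (w / (4 * (t ^ 2 + t) ^ 2)) ?_
      rw [eval_sextic, eval_sextic, Int.cast_one, Int.cast_ofNat] at hw
      generalize t ^ 2 + t = W at *
      rw [div_pow, hw]
      field_simp
      ring
  · exact sq_ne_aeval_sextic_one hdeg htr _ hs'
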